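/- Let n ∈ ℕ and let K be a P_n-field of characteristic different from 2. Let F be a finite field extension of K((t₁,t₂)), the fraction field of the formal power series ring K[[t₁,t₂]] in two variables over K. Then p(F) ≤ 2^{n+1} + 1. -/

import Mathlib

open scoped Pointwise

universe u

namespace SosPaper

/-- The set of sums of `k` squares in a commutative ring. -/
def sumSq (A : Type*) [CommRing A] (k : ℕ) : Set A :=
  {x | ∃ f : Fin k → A, x = ∑ i, f i ^ 2}

/-- The set of sums of squares in a commutative ring. -/
def sums (A : Type*) [CommRing A] : Set A := ⋃ k, sumSq A k

/-- The Pythagoras number of a commutative ring, as an extended natural number: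
the least `k` such that every sum of squares is a sum of `k` squares. -/
noncomputable def pyth (A : Type*) [CommRing A] : ℕ∞ :=
  sInf ((fun k : ℕ => (k : ℕ∞)) '' {k : ℕ | sums A ⊆ sumSq A k})

/-- The level of a commutative ring: the least `k` such that `-1` is a sum of
`k` squares. -/
noncomputable def level (A : Type*) [CommRing A] : ℕ∞ :=
  sInf ((fun k : ℕ => (k : ℕ∞)) '' {k : ℕ | (-1 : A) ∈ sumSq A k})

/-- A subring `H` of a field (or commutative ring) `A` has `A` as its field of
fractions: every element of `A` is a quotient of two elements of `H`. -/
def IsFractionSubring {A : Type*} [CommRing A] (H : Subring A) : Prop :=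
  ∀ x : A, ∃ a b : H, b ≠ 0 ∧ x * b = a

/-- The invariant `p*(H)`: the least `k` such that every unit of `H` that is a
sum of squares in the ambient ring is a sum of `k` squares in the ambient ring. -/
noncomputable def pstar {A : Type*} [CommRing A] (H : Subring A) : ℕ∞ :=
  sInf ((fun k : ℕ => (k : ℕ∞)) '' {k : ℕ | ∀ h : H, IsUnit h → (h : A) ∈ sums A → (h : A) ∈ sumSq A k})

/-- A commutative ring is semilocal if it has only finitely many maximal ideals. -/
def Semilocal (A : Type*) [CommRing A] : Prop := {I : Ideal A | I.IsMaximal}.Finite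

/-- The `H`-submodule `f·H` of the ambient ring, as a set. -/
def mulSet {A : Type*} [CommRing A] (H : Subring A) (f : A) : Set A :=
  {x | ∃ h ∈ H, x = f * h}

/-- A subring `H` of a field `F` (with fraction field `F`) is square-effective if
every sum of two squares of elements of `F` can be rewritten as `g₁² + g₂²` with
`f₁H + f₂H = g₁H ⊇ g₂H`. -/
def SquareEffective {A : Type*} [CommRing A] (H : Subring A) : Prop :=
  ∀ f₁ f₂ : A, ∃ g₁ g₂ : A, f₁ ^ 2 + f₂ ^ 2 = g₁ ^ 2 + g₂ ^ 2 ∧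
    mulSet H f₁ + mulSet H f₂ = mulSet H g₁ ∧ mulSet H g₂ ⊆ mulSet H g₁

/-- The two defining conditions for a (semilocal Bézout) domain `H` to be
square-effective of order `n`:
`1 + Σ_{2ⁿ−1} H² ⊆ H^×` and `(1 + Σ_{2ⁿ} H²) ∩ Jac(H) ≠ ∅`. -/
def SqEffOrder {A : Type*} [CommRing A] (H : Subring A) (n : ℕ) : Prop :=
  (∀ x : H, x ∈ sumSq H (2 ^ n - 1) → IsUnit (1 + x)) ∧
  ∃ x : H, x ∈ sumSq H (2 ^ n) ∧ 1 + x ∈ Ideal.jacobson (⊥ : Ideal H)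

/-- A field `F` is `n`-effective if it has a semilocal Bézout subring `H` with
fraction field `F` which is square-effective of order `n` and with `p*(H) ≤ 2ⁿ`. -/
def IsNEffective (n : ℕ) (F : Type*) [Field F] : Prop :=
  ∃ H : Subring F, IsFractionSubring H ∧ Semilocal H ∧ IsBezout H ∧
    SqEffOrder H n ∧ pstar H ≤ ((2 ^ n : ℕ) : ℕ∞)

/-- A subring `H` of `F` characterises sums of `k` squares in `F` if every unit
of `H` which is a sum of squares in `F` and whose residue modulo every maximal
ideal of `H` is a sum of `k` squares is itself a sum of `k` squares in `F`. -/
def Characterises {A : Type*} [CommRing A] (H : Subring A) (k : ℕ) : Prop :=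
  ∀ h : H, IsUnit h → (h : A) ∈ sums A →
    (∀ m : Ideal H, m.IsMaximal → Ideal.Quotient.mk m h ∈ sumSq (H ⧸ m) k) →
    (h : A) ∈ sumSq A k

/-- A function field in one variable over `K`: a finitely generated field
extension of transcendence degree 1, equivalently a finite extension of a
subfield `K(x)` with `x` transcendental over `K`. -/
def IsFunctionFieldOneVar (K F : Type*) [Field K] [Field F] [Algebra K F] : Prop :=
  ∃ x : F, Transcendental K x ∧ FiniteDimensional (IntermediateField.adjoin K {x}) F

/-- A `𝒫ₙ`-field: `p(K(X)) ≤ 2^{n+1}` and every function field in one variable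
over `K` with Pythagoras number `> 2^{n+1}` is `(n+1)`-effective. -/
def IsPnField (n : ℕ) (K : Type u) [Field K] : Prop :=
  pyth (RatFunc K) ≤ ((2 ^ (n + 1) : ℕ) : ℕ∞) ∧
  ∀ (F : Type u) [Field F] [Algebra K F], IsFunctionFieldOneVar K F →
    ((2 ^ (n + 1) : ℕ) : ℕ∞) < pyth F → IsNEffective (n + 1) F

section

section Complete

/-- `M` is `x`-torsion free, `x`-adically separated and `x`-adically complete. -/
structure XComplete {R : Type*} [CommRing R] (x : R) (M : Type*) [AddCommGroup M] [Module R M] :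
    Prop where
  regular : ∀ m : M, x • m = 0 → m = 0
  separated : ∀ m : M, (∀ k : ℕ, ∃ e : M, m = x ^ k • e) → m = 0
  complete : ∀ d : ℕ → M, ∃ l : M, ∀ k : ℕ, ∃ e : M,
    l = ∑ i ∈ Finset.range k, x ^ i • d i + x ^ k • e

variable {R : Type*} [CommRing R] {x : R}

namespace XComplete

variable {M : Type*} [AddCommGroup M] [Module R M]

lemma regular_pow (h : XComplete x M) (k : ℕ) (m : M) (hm : x ^ k • m = 0) : m = 0 := by
  induction k with
  | zero => simpa using hm
  | succ k ih =>
    rw [pow_succ', mul_smul] at hm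
    exact ih (h.regular _ hm)

lemma cancel (h : XComplete x M) (k : ℕ) {m m' : M} (hm : x ^ k • m = x ^ k • m') : m = m' := by
  rw [← sub_eq_zero] at hm ⊢
  rw [← smul_sub] at hm
  exact h.regular_pow k _ hm

lemma eq_of_congr (h : XComplete x M) {m m' : M} (hm : ∀ k : ℕ, ∃ e : M, m = m' + x ^ k • e) :
    m = m' := by
  rw [← sub_eq_zero]
  refine h.separated _ fun k => ?_
  obtain ⟨e, he⟩ := hm k
  exact ⟨e, by rw [he]; abel⟩

lemma exists_limit (h : XComplete x M) (s : ℕ → M)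
    (hs : ∀ k, ∃ e : M, s (k + 1) = s k + x ^ k • e) :
    ∃ l : M, ∀ k, ∃ e : M, l = s k + x ^ k • e := by
  choose d hd using hs
  obtain ⟨l, hl⟩ := h.complete d
  refine ⟨s 0 + l, fun k => ?_⟩
  obtain ⟨e, he⟩ := hl k
  refine ⟨e, ?_⟩
  have : s k = s 0 + ∑ i ∈ Finset.range k, x ^ i • d i := by
    clear he
    induction k with
    | zero => simp
    | succ k ih =>
      obtain ⟨e', he'⟩ := hl k
      rw [hd, ih, Finset.sum_range_succ, add_assoc]
  rw [he, this, add_assoc]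

lemma of_equiv {M' : Type*} [AddCommGroup M'] [Module R M'] (h : XComplete x M)
    (f : M ≃ₗ[R] M') : XComplete x M' where
  regular m hm := by
    have := h.regular (f.symm m) (by rw [← map_smul, hm, map_zero])
    simpa using this
  separated m hm := by
    have := h.separated (f.symm m) fun k => by
      obtain ⟨e, rfl⟩ := hm k
      exact ⟨f.symm e, by simp⟩
    simpa using this
  complete d := by
    obtain ⟨l, hl⟩ := h.complete fun i => f.symm (d i)
    refine ⟨f l, fun k => ?_⟩
    obtain ⟨e, he⟩ := hl k
    exact ⟨f e, by rw [he]; simp⟩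

lemma pi {ι : Type*} (h : XComplete x M) : XComplete x (ι → M) where
  regular m hm := funext fun i => h.regular _ (congrFun hm i)
  separated m hm := funext fun i => h.separated _ fun k => by
    obtain ⟨e, he⟩ := hm k
    exact ⟨e i, congrFun he i⟩
  complete d := by
    choose l hl using fun i => h.complete fun k => d k i
    refine ⟨l, fun k => ?_⟩
    choose e he using fun i => hl i k
    exact ⟨e, funext fun i => by simp [he i]⟩

lemma matrix {ι κ : Type*} (h : XComplete x M) : XComplete x (Matrix ι κ M) :=
  (h.pi (ι := κ)).pi (ι := ι)

end XComplete

variable {A : Type*} [Ring A] [Algebra R A]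

namespace XComplete

lemma exists_mul_one_add (h : XComplete x A) (y : A) :
    ∃ z : A, (1 + x • y) * (1 + x • z) = 1 ∧ (1 + x • z) * (1 + x • y) = 1 := by
  obtain ⟨l, hl⟩ := h.complete fun i => (-y) ^ i
  have hsum (k : ℕ) : ∑ i ∈ Finset.range k, x ^ i • (-y) ^ i
      = ∑ i ∈ Finset.range k, (-(x • y)) ^ i := by
    refine Finset.sum_congr rfl fun i _ => ?_
    rw [← smul_neg, smul_pow]
  have h1 : (1 + x • y) * l = 1 := by
    refine h.eq_of_congr fun k => ?_
    obtain ⟨e, he⟩ := hl k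
    have := mul_neg_geom_sum (-(x • y)) k
    rw [sub_neg_eq_add] at this
    rw [he, hsum, mul_add, this]
    refine ⟨(1 + x • y) * e - (-y) ^ k, ?_⟩
    rw [← smul_neg, smul_pow, smul_sub, mul_smul_comm]
    abel
  have h2 : l * (1 + x • y) = 1 := by
    refine h.eq_of_congr fun k => ?_
    obtain ⟨e, he⟩ := hl k
    have := geom_sum_mul_neg (-(x • y)) k
    rw [sub_neg_eq_add] at this
    rw [he, hsum, add_mul, this]
    refine ⟨e * (1 + x • y) - (-y) ^ k, ?_⟩
    rw [← smul_neg, smul_pow, smul_sub, smul_mul_assoc]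
    abel
  obtain ⟨e, he⟩ := hl 1
  have hle : l = 1 + x • e := by simpa using he
  exact ⟨e, by rwa [← hle], by rwa [← hle]⟩

/-- Square roots of elements congruent to `1`; they are fixed by every linear
anti-endomorphism fixing the element. -/
lemma exists_sq (h : XComplete x A) (hR : ∃ r : R, r * 2 = 1) (y : A) :
    ∃ z : A, (1 + x • z) * (1 + x • z) = 1 + x • y ∧
      ∀ σ : A →ₗ[R] A, σ 1 = 1 → (∀ a b, σ (a * b) = σ b * σ a) → σ y = y → σ z = z := by
  obtain ⟨r, hr⟩ := hR
  set u := 1 + x • y with hu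
  let s : ℕ → A := fun k => Nat.rec 1 (fun _ a => a - r • (a * a - u)) k
  have hs0 : s 0 = 1 := rfl
  have hs (k : ℕ) : s (k + 1) = s k - r • (s k * s k - u) := rfl
  have hcomm (k : ℕ) : Commute (s k) u := by
    induction k with
    | zero => rw [hs0]; exact Commute.one_left _
    | succ k ih =>
      rw [hs]
      exact ih.sub_left (((ih.mul_left ih).sub_left (Commute.refl _)).smul_left r)
  have key (k : ℕ) : ∃ e : A, s k * s k - u = x ^ (k + 1) • e ∧ ∃ z, s k = 1 + x • z := by
    induction k with
    | zero => exact ⟨-y, by rw [hs0, hu]; simp, 0, by simp [hs0]⟩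
    | succ k ih =>
      obtain ⟨e, he, z, hz⟩ := ih
      have hce : s k * e = e * s k := by
        refine h.cancel (k + 1) ?_
        rw [← mul_smul_comm, ← smul_mul_assoc, ← he]
        exact (((Commute.refl (s k)).mul_right (Commute.refl _)).sub_right (hcomm k)).eq
      refine ⟨-(z * e) + x ^ k • (r * r) • (e * e), ?_, z - r • x ^ k • e, ?_⟩
      · have hz' : s k * e = e + x • (z * e) := by rw [hz, add_mul, one_mul, smul_mul_assoc]
        have hss : s k * s k = u + x ^ (k + 1) • e := by rw [← he]; abel
        have hrr (a : A) : a = r • a + r • a := by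
          rw [← add_smul, ← mul_two, hr, one_smul]
        rw [hs, he]
        calc (s k - r • x ^ (k + 1) • e) * (s k - r • x ^ (k + 1) • e) - u
            = s k * s k - u - (r • x ^ (k + 1) • (s k * e) + r • x ^ (k + 1) • (e * s k))
              + r • x ^ (k + 1) • r • x ^ (k + 1) • (e * e) := by
              simp only [sub_mul, mul_sub, smul_mul_assoc, mul_smul_comm, smul_sub]
              abel
          _ = x ^ (k + 1) • e - x ^ (k + 1) • (s k * e)
              + r • x ^ (k + 1) • r • x ^ (k + 1) • (e * e) := by
              rw [he, ← hce, ← hrr]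
          _ = _ := by
              rw [hz']
              have : r • x ^ (k + 1) • r • x ^ (k + 1) • (e * e)
                  = x ^ (k + 2) • x ^ k • (r * r) • (e * e) := by
                simp only [smul_smul]; congr 1; ring
              rw [this, smul_add, smul_add, smul_neg, smul_smul (x ^ (k + 1)), ← pow_succ]
              abel
      · rw [hs, he, hz, smul_sub, smul_comm x r, smul_smul x, ← pow_succ']
        abel
  obtain ⟨l, hl⟩ := h.exists_limit s fun k => by
    obtain ⟨e, he, -⟩ := key k
    exact ⟨-(x • r • e), by rw [hs, he, pow_succ, mul_smul, smul_neg, smul_comm x r,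
      smul_comm r, smul_comm r, sub_eq_add_neg]⟩
  have hl2 : l * l = u := by
    refine h.eq_of_congr fun k => ?_
    obtain ⟨e, he⟩ := hl k
    obtain ⟨e', he', -⟩ := key k
    have : s k * s k = u + x ^ (k + 1) • e' := by rw [← he']; abel
    refine ⟨x • e' + s k * e + e * s k + x ^ k • (e * e), ?_⟩
    rw [he]
    simp only [mul_add, add_mul, smul_mul_assoc, mul_smul_comm, this, smul_add, pow_succ, mul_smul]
    abel
  obtain ⟨e1, he1⟩ := hl 1
  obtain ⟨-, -, z1, hz1⟩ := key 1
  have hl1 : l = 1 + x • (z1 + e1) := by rw [he1, hz1, pow_one, smul_add, add_assoc]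
  refine ⟨z1 + e1, by rw [← hl1, hl2], fun σ σ1 σm σy => ?_⟩
  have σu : σ u = u := by rw [hu, map_add, σ1, map_smul, σy]
  have σs (k : ℕ) : σ (s k) = s k := by
    induction k with
    | zero => rw [hs0, σ1]
    | succ k ih => rw [hs, map_sub, map_smul, map_sub, σm, ih, σu]
  have σl : σ l = l := by
    refine h.eq_of_congr fun k => ?_
    obtain ⟨e, he⟩ := hl k
    exact ⟨σ e - e, by conv_lhs => rw [he]
                       conv_rhs => rw [he]
                       rw [map_add, map_smul, σs, smul_sub]; abel⟩
  rw [hl1, map_add, σ1, map_smul] at σl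
  exact h.cancel 1 (by simpa using σl)

end XComplete

/-- Newton iteration: an element congruent to `1` factors along an additive decomposition. -/
lemma exists_factor {A₁ A₂ A₀ : Type*} [Ring A₁] [Ring A₂] [Ring A₀] [Algebra R A₁] [Algebra R A₂]
    [Algebra R A₀] (h₁ : XComplete x A₁) (h₂ : XComplete x A₂) (h₀ : XComplete x A₀)
    (i₁ : A₁ →ₐ[R] A₀) (i₂ : A₂ →ₐ[R] A₀) (hadd : ∀ y, ∃ a b, y = i₁ a + i₂ b) (y : A₀) :
    ∃ a b, 1 + x • y = i₁ (1 + x • a) * i₂ (1 + x • b) := by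
  set G := 1 + x • y with hG
  let P : ℕ → A₁ × A₂ → Prop := fun k p => ∃ Y, i₁ p.1 * G * i₂ p.2 = 1 + x ^ (k + 1) • Y
  have step (k : ℕ) (p : A₁ × A₂) (hp : P k p) : ∃ p' : A₁ × A₂, P (k + 1) p' ∧
      (∃ e, p'.1 = p.1 + x ^ (k + 1) • e) ∧ ∃ e, p'.2 = p.2 + x ^ (k + 1) • e := by
    obtain ⟨Y, hY⟩ := hp
    obtain ⟨a, b, hab⟩ := hadd Y
    refine ⟨((1 - x ^ (k + 1) • a) * p.1, p.2 * (1 - x ^ (k + 1) • b)),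
      ⟨x ^ k • (i₁ a * i₂ b - i₁ a * Y - Y * i₂ b) + x ^ (2 * k + 1) • (i₁ a * Y * i₂ b), ?_⟩,
      ⟨-(a * p.1), ?_⟩, ⟨-(p.2 * b), ?_⟩⟩
    · have : i₁ ((1 - x ^ (k + 1) • a) * p.1) * G * i₂ (p.2 * (1 - x ^ (k + 1) • b))
          = (1 - x ^ (k + 1) • i₁ a) * (i₁ p.1 * G * i₂ p.2) * (1 - x ^ (k + 1) • i₂ b) := by
        simp only [map_mul, map_sub, map_one, map_smul, mul_assoc]
      dsimp only
      rw [this, hY]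
      have h1 : x ^ (k + 1) • Y = x ^ (k + 1) • i₁ a + x ^ (k + 1) • i₂ b := by
        rw [← smul_add, hab]
      have h2 : (1 - x ^ (k + 1) • i₁ a) * (1 + x ^ (k + 1) • Y) * (1 - x ^ (k + 1) • i₂ b)
          = 1 + x ^ (k + 1) • Y - x ^ (k + 1) • i₁ a - x ^ (k + 1) • i₂ b
            + (x ^ (k + 1) • x ^ (k + 1) • (i₁ a * i₂ b) - x ^ (k + 1) • x ^ (k + 1) • (i₁ a * Y)
            - x ^ (k + 1) • x ^ (k + 1) • (Y * i₂ b)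
            + x ^ (k + 1) • x ^ (k + 1) • x ^ (k + 1) • (i₁ a * Y * i₂ b)) := by
        simp only [mul_add, add_mul, mul_sub, sub_mul, smul_mul_assoc, mul_smul_comm, one_mul,
          mul_one, smul_add, smul_sub]
        abel
      rw [h2, h1]
      simp only [smul_add, smul_sub, smul_smul, ← pow_add]
      rw [show k + 1 + (k + 1) = k + 1 + 1 + k by ring,
        show k + 1 + (k + 1 + 1 + k) = k + 1 + 1 + (2 * k + 1) by ring]
      abel
    · dsimp only
      rw [sub_mul, one_mul, smul_mul_assoc, smul_neg, sub_eq_add_neg]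
    · dsimp only
      rw [mul_sub, mul_one, mul_smul_comm, smul_neg, sub_eq_add_neg]
  choose! f hf using step
  let p : ℕ → A₁ × A₂ := fun k => Nat.rec (1, 1) f k
  have hp0 : p 0 = (1, 1) := rfl
  have hps (k : ℕ) : p (k + 1) = f k (p k) := rfl
  have hP (k : ℕ) : P k (p k) := by
    induction k with
    | zero => exact ⟨y, by simp [hp0, hG]⟩
    | succ k ih => exact (hf k _ ih).1
  obtain ⟨l₁, hl₁⟩ := h₁.exists_limit (fun k => (p k).1) fun k => by
    obtain ⟨e, he⟩ := (hf k _ (hP k)).2.1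
    exact ⟨x • e, by rw [hps, he, smul_smul, ← pow_succ]⟩
  obtain ⟨l₂, hl₂⟩ := h₂.exists_limit (fun k => (p k).2) fun k => by
    obtain ⟨e, he⟩ := (hf k _ (hP k)).2.2
    exact ⟨x • e, by rw [hps, he, smul_smul, ← pow_succ]⟩
  have hl : i₁ l₁ * G * i₂ l₂ = 1 := by
    refine h₀.eq_of_congr fun k => ?_
    obtain ⟨e₁, he₁⟩ := hl₁ k
    obtain ⟨e₂, he₂⟩ := hl₂ k
    obtain ⟨Y, hY⟩ := hP k
    refine ⟨x • Y + i₁ e₁ * G * i₂ l₂ + i₁ (p k).1 * G * i₂ e₂, ?_⟩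
    calc i₁ l₁ * G * i₂ l₂ = i₁ (p k).1 * G * i₂ (p k).2 + x ^ k • (i₁ e₁ * G * i₂ l₂)
          + x ^ k • (i₁ (p k).1 * G * i₂ e₂) := by
          conv_lhs => rw [he₁, map_add, map_smul, add_mul, add_mul, smul_mul_assoc, smul_mul_assoc]
          conv_lhs => enter [1]; rw [he₂]
          rw [map_add, map_smul, mul_add, mul_smul_comm]
          abel
      _ = _ := by
          rw [hY, smul_add, smul_add, smul_smul, ← pow_succ]
          abel
  have e₁ : ∃ e, l₁ = 1 + x • e := by
    obtain ⟨e, he⟩ := hl₁ 1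
    obtain ⟨e', he'⟩ := (hf 0 _ (hP 0)).2.1
    exact ⟨e' + e, by rw [he, show p 1 = f 0 (p 0) from rfl, he', hp0]; simp [add_assoc]⟩
  have e₂ : ∃ e, l₂ = 1 + x • e := by
    obtain ⟨e, he⟩ := hl₂ 1
    obtain ⟨e', he'⟩ := (hf 0 _ (hP 0)).2.2
    exact ⟨e' + e, by rw [he, show p 1 = f 0 (p 0) from rfl, he', hp0]; simp [add_assoc]⟩
  obtain ⟨e₁, rfl⟩ := e₁
  obtain ⟨e₂, rfl⟩ := e₂
  obtain ⟨a, -, ha⟩ := h₁.exists_mul_one_add e₁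
  obtain ⟨b, hb, -⟩ := h₂.exists_mul_one_add e₂
  refine ⟨a, b, ?_⟩
  have h3 : i₁ (1 + x • a) * (i₁ (1 + x • e₁) * G * i₂ (1 + x • e₂)) * i₂ (1 + x • b) = G := by
    rw [show i₁ (1 + x • a) * (i₁ (1 + x • e₁) * G * i₂ (1 + x • e₂)) * i₂ (1 + x • b)
      = (i₁ (1 + x • a) * i₁ (1 + x • e₁)) * G * (i₂ (1 + x • e₂) * i₂ (1 + x • b)) by
        simp only [mul_assoc], ← map_mul, ← map_mul, ha, hb]
    simp
  rw [← h3, hl, mul_one]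

end Complete

end

section

open Matrix

/-- A cartesian square of `x`-adically complete algebras in which every element of the big
algebra is a sum of elements of the two middle ones. -/
structure Patch {R : Type*} [CommRing R] (x : R) {A A₁ A₂ A₀ : Type*} [Ring A] [Ring A₁] [Ring A₂]
    [Ring A₀] [Algebra R A] [Algebra R A₁] [Algebra R A₂] [Algebra R A₀]
    (j₁ : A →ₐ[R] A₁) (j₂ : A →ₐ[R] A₂) (i₁ : A₁ →ₐ[R] A₀) (i₂ : A₂ →ₐ[R] A₀) : Prop where
  comm : ∀ a, i₁ (j₁ a) = i₂ (j₂ a)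
  inj₁ : Function.Injective i₁
  inj₂ : Function.Injective i₂
  injj₁ : Function.Injective j₁
  injj₂ : Function.Injective j₂
  pull : ∀ a b, i₁ a = i₂ b → ∃ c, j₁ c = a ∧ j₂ c = b
  add : ∀ y, ∃ a b, y = i₁ a + i₂ b
  complete : XComplete x A
  complete₁ : XComplete x A₁
  complete₂ : XComplete x A₂
  complete₀ : XComplete x A₀

namespace Patch

variable {R : Type*} [CommRing R] {x : R}

section

variable {A A₁ A₂ A₀ : Type*} [Ring A] [Ring A₁] [Ring A₂]
    [Ring A₀] [Algebra R A] [Algebra R A₁] [Algebra R A₂] [Algebra R A₀]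
    {j₁ : A →ₐ[R] A₁} {j₂ : A →ₐ[R] A₂} {i₁ : A₁ →ₐ[R] A₀} {i₂ : A₂ →ₐ[R] A₀}

lemma matrix (h : Patch x j₁ j₂ i₁ i₂) (ι : Type*) [Fintype ι] [DecidableEq ι] :
    Patch x (j₁.mapMatrix (m := ι)) j₂.mapMatrix i₁.mapMatrix i₂.mapMatrix where
  comm a := by ext i j; simp [h.comm]
  inj₁ := Matrix.map_injective h.inj₁
  inj₂ := Matrix.map_injective h.inj₂
  injj₁ := Matrix.map_injective h.injj₁
  injj₂ := Matrix.map_injective h.injj₂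
  pull a b hab := by
    have (i j : ι) : i₁ (a i j) = i₂ (b i j) := by
      simpa using congrFun (congrFun hab i) j
    choose c hc using fun i j => h.pull _ _ (this i j)
    exact ⟨Matrix.of c, by ext i j; simp [(hc i j).1], by ext i j; simp [(hc i j).2]⟩
  add y := by
    choose a b hab using fun i j => h.add (y i j)
    exact ⟨Matrix.of a, Matrix.of b, by ext i j; simp [hab i j]⟩
  complete := h.complete.matrix
  complete₁ := h.complete₁.matrix
  complete₂ := h.complete₂.matrix
  complete₀ := h.complete₀.matrix

end

variable {A A₁ A₂ A₀ : Type*} [CommRing A] [CommRing A₁] [CommRing A₂]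
    [CommRing A₀] [Algebra R A] [Algebra R A₁] [Algebra R A₂] [Algebra R A₀]
    {j₁ : A →ₐ[R] A₁} {j₂ : A →ₐ[R] A₂} {i₁ : A₁ →ₐ[R] A₀} {i₂ : A₂ →ₐ[R] A₀}

lemma exists_orthogonal (h : Patch x j₁ j₂ i₁ i₂) (hR : ∃ r : R, r * 2 = 1) {ι : Type*} [Fintype ι]
    [DecidableEq ι] (Y : Matrix ι ι A₀) (hY : (1 + x • Y)ᵀ * (1 + x • Y) = 1) :
    ∃ (a : Matrix ι ι A₁) (b : Matrix ι ι A₂), aᵀ * a = 1 ∧ bᵀ * b = 1 ∧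
      1 + x • Y = i₁.mapMatrix a * i₂.mapMatrix b := by
  have hM := h.matrix ι
  obtain ⟨a, b, hab⟩ := exists_factor hM.complete₁ hM.complete₂ hM.complete₀ _ _ hM.add Y
  obtain ⟨b', hb1, hb2⟩ := hM.complete₂.exists_mul_one_add b
  set G := 1 + x • Y
  set P := 1 + x • a with hP
  set Q := 1 + x • b with hQ
  set Q' := 1 + x • b' with hQ'
  have tr₁ (m : Matrix ι ι A₁) : (i₁.mapMatrix m)ᵀ = i₁.mapMatrix mᵀ := by ext; simp
  have tr₂ (m : Matrix ι ι A₂) : (i₂.mapMatrix m)ᵀ = i₂.mapMatrix mᵀ := by ext; simp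
  have trj (m : Matrix ι ι A) : (j₁.mapMatrix m)ᵀ = j₁.mapMatrix mᵀ := by ext; simp
  have trj₂ (m : Matrix ι ι A) : (j₂.mapMatrix m)ᵀ = j₂.mapMatrix mᵀ := by ext; simp
  have hPP : i₁.mapMatrix (Pᵀ * P) = i₂.mapMatrix (Q'ᵀ * Q') := by
    have hq : i₂.mapMatrix Q * i₂.mapMatrix Q' = 1 := by rw [← map_mul, hb1, map_one]
    have hGP : i₁.mapMatrix P = G * i₂.mapMatrix Q' := by
      rw [hab, Matrix.mul_assoc, hq, Matrix.mul_one]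
    rw [map_mul, ← tr₁, hGP, transpose_mul, Matrix.mul_assoc, ← Matrix.mul_assoc Gᵀ, hY,
      Matrix.one_mul, tr₂, map_mul]
  have e1 : Pᵀ * P = 1 + x • (a + aᵀ + x • (aᵀ * a)) := by
    rw [hP]
    simp only [transpose_add, transpose_one, transpose_smul, add_mul, mul_add, one_mul, mul_one,
      smul_mul_assoc, mul_smul_comm, smul_add]
    abel
  have e2 : Q'ᵀ * Q' = 1 + x • (b' + b'ᵀ + x • (b'ᵀ * b')) := by
    rw [hQ']
    simp only [transpose_add, transpose_one, transpose_smul, add_mul, mul_add, one_mul, mul_one,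
      smul_mul_assoc, mul_smul_comm, smul_add]
    abel
  obtain ⟨S, hS1, hS2⟩ := hM.pull (a + aᵀ + x • (aᵀ * a)) (b' + b'ᵀ + x • (b'ᵀ * b')) (by
    rw [e1, e2, map_add, map_add, map_one, map_one, map_smul, map_smul] at hPP
    exact hM.complete₀.cancel 1 (by simpa using hPP))
  have hSt : Sᵀ = S := by
    apply hM.injj₁
    rw [← trj, hS1]
    simp only [transpose_add, transpose_smul, transpose_mul, transpose_transpose]
    abel
  obtain ⟨Z, hZ, hZs⟩ := hM.complete.exists_sq hR S
  have hZt : Zᵀ = Z := hZs (Matrix.transposeLinearEquiv ι ι R A).toLinearMap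
    (by simp) (fun u v => by simp [Matrix.transpose_mul]) (by simpa using hSt)
  obtain ⟨Z', hZ1, hZ2⟩ := hM.complete.exists_mul_one_add Z
  set C := 1 + x • Z with hC
  set C' := 1 + x • Z' with hC'
  have hCt : Cᵀ = C := by rw [hC, transpose_add, transpose_one, transpose_smul, hZt]
  have hCt' : C'ᵀ = C' := by
    have : C'ᵀ * C = 1 := by rw [← hCt, ← transpose_mul, hZ1, transpose_one]
    calc C'ᵀ = C'ᵀ * (C * C') := by rw [hZ1, mul_one]
      _ = C' := by rw [← mul_assoc, this, one_mul]
  have hP2 : Pᵀ * P = j₁.mapMatrix (C * C) := by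
    rw [hZ, e1, ← hS1, map_add, map_one, map_smul]
  have hQ2 : Q'ᵀ * Q' = j₂.mapMatrix (C * C) := by
    rw [hZ, e2, ← hS2, map_add, map_one, map_smul]
  refine ⟨P * j₁.mapMatrix C', j₂.mapMatrix C * Q, ?_, ?_, ?_⟩
  · rw [transpose_mul, trj, hCt', mul_assoc, ← mul_assoc Pᵀ, hP2, ← map_mul, ← map_mul, mul_assoc,
      hZ1, mul_one, hZ2, map_one]
  · have hQt : Q'ᵀ * Qᵀ = 1 := by rw [← transpose_mul, hb1, transpose_one]
    have hQt' : Qᵀ * Q'ᵀ = 1 := by rw [← transpose_mul, hb2, transpose_one]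
    rw [transpose_mul, trj₂, hCt, mul_assoc, ← mul_assoc (j₂.mapMatrix C), ← map_mul, ← hQ2,
      mul_assoc, hb2, mul_one, hQt']
  · rw [hab, map_mul, map_mul, ← hM.comm, mul_assoc, ← mul_assoc (i₁.mapMatrix (j₁.mapMatrix C')),
      ← map_mul, ← map_mul, hZ2, map_one, map_one, one_mul]

end Patch

end

section

open Matrix

section

variable {R : Type*} [CommRing R] {x : R} {A : Type*} [CommRing A] [Algebra R A]
  {ι : Type*} [Fintype ι] [DecidableEq ι]

lemma smul_vecMulVec_mul_self (ε : R) (h : A) (v : ι → A) (hv : (v ⬝ᵥ v) * h = algebraMap R A ε) :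
    (h • vecMulVec v v) * (h • vecMulVec v v) = ε • (h • vecMulVec v v) := by
  rw [smul_mul_assoc, mul_smul_comm, vecMulVec_mul_vecMulVec, ← algebraMap_smul A ε, ← hv,
    vecMulVec_smul, smul_smul, smul_smul, smul_smul]
  congr 1
  ring

lemma reflection_mul_self (ε : R) (P : Matrix ι ι A) (hP : P * P = ε • P) :
    (ε • 1 - (2 : R) • P) * (ε • 1 - (2 : R) • P) = (ε * ε) • (1 : Matrix ι ι A) := by
  simp only [sub_mul, mul_sub, smul_mul_assoc, mul_smul_comm, one_mul, mul_one, hP, smul_smul]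
  module

end

namespace Patch

variable {R : Type*} [CommRing R] {x : R}

variable {A A₁ A₂ A₀ : Type*} [CommRing A] [CommRing A₁] [CommRing A₂]
    [CommRing A₀] [Algebra R A] [Algebra R A₁] [Algebra R A₂] [Algebra R A₀]
    {j₁ : A →ₐ[R] A₁} {j₂ : A →ₐ[R] A₂} {i₁ : A₁ →ₐ[R] A₀} {i₂ : A₂ →ₐ[R] A₀}

/-- Two vectors of the same length over `A₀` whose difference is anisotropic, coming from `A₁` and
`A₂`, can be moved to each other by isometries defined over `A₁` and `A₂`. -/
lemma exists_common_vector (h : Patch x j₁ j₂ i₁ i₂) (hR : ∃ r : R, r * 2 = 1) {ι : Type*}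
    [Fintype ι] [DecidableEq ι] (W₁ : ι → A₁) (W₂ : ι → A₂) (γ₁ : A₁) (γ₂ : A₂) (η : A₀) (e : ℕ)
    (hQ : (i₂ γ₂ • (i₁ ∘ W₁)) ⬝ᵥ (i₂ γ₂ • (i₁ ∘ W₁)) = (i₁ γ₁ • (i₂ ∘ W₂)) ⬝ᵥ (i₁ γ₁ • (i₂ ∘ W₂)))
    (hη : ((i₂ γ₂ • (i₁ ∘ W₁) - i₁ γ₁ • (i₂ ∘ W₂)) ⬝ᵥ (i₂ γ₂ • (i₁ ∘ W₁) - i₁ γ₁ • (i₂ ∘ W₂))) * η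
      = algebraMap R A₀ (x ^ e))
    (hdense : ∀ (v : ι → A₀) (k : ℕ), ∃ (p p' : A₀) (c : ι → A₂) (w : ι → A₀), p * p' = 1 ∧
      i₂ ∘ c = p • (v + x ^ k • w)) :
    ∃ (U₁ : ι → A₁) (U₂ : ι → A₂) (δ : A₂) (δ' : A₀), i₂ δ * δ' = algebraMap R A₀ (x ^ e) ∧
      U₁ ⬝ᵥ U₁ = W₁ ⬝ᵥ W₁ ∧ i₂ (δ * γ₂) • (i₁ ∘ U₁) = i₁ γ₁ • (i₂ ∘ U₂) := by
  set V₁ := i₂ γ₂ • (i₁ ∘ W₁) with hV₁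
  set V₂ := i₁ γ₁ • (i₂ ∘ W₂) with hV₂
  set β := V₁ - V₂ with hβ
  obtain ⟨r, hr⟩ := hR
  have hR : ∃ r : R, r * 2 = 1 := ⟨r, hr⟩
  obtain ⟨p, p', c, w, hpp, hc⟩ := hdense β (3 * e + 1)
  set θ : A₀ := β ⬝ᵥ w + w ⬝ᵥ β + x ^ (3 * e + 1) • (w ⬝ᵥ w) with hθ
  have hcc : (i₂ ∘ c) ⬝ᵥ (i₂ ∘ c) = p * p * (β ⬝ᵥ β + x ^ (3 * e + 1) • θ) := by
    rw [hc, hθ]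
    simp only [smul_dotProduct, dotProduct_smul, add_dotProduct, dotProduct_add, smul_eq_mul]
    simp only [Algebra.smul_def]
    ring
  clear_value θ
  obtain ⟨m, hm, -⟩ := h.complete₀.exists_mul_one_add (x ^ (2 * e) • (θ * η))
  set ν := 1 + x • m with hν
  have hμ : ν + x ^ (2 * e + 1) • (θ * η * ν) = 1 := by
    rw [← hm]
    simp only [Algebra.smul_def, map_pow]
    ring
  set η' := p' * p' * (η * ν) with hη'
  have hη'c : ((i₂ ∘ c) ⬝ᵥ (i₂ ∘ c)) * η' = algebraMap R A₀ (x ^ e) := by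
    rw [hcc, hη']
    calc p * p * (β ⬝ᵥ β + x ^ (3 * e + 1) • θ) * (p' * p' * (η * ν))
        = (p * p') * (p * p') * ((β ⬝ᵥ β * η) * ν + x ^ (3 * e + 1) • (θ * η * ν)) := by
          simp only [Algebra.smul_def]; ring
      _ = algebraMap R A₀ (x ^ e) * (ν + x ^ (2 * e + 1) • (θ * η * ν)) := by
          rw [hpp, hη]
          simp only [Algebra.smul_def, map_pow]
          ring
      _ = _ := by rw [hμ, mul_one]
  set P := η • vecMulVec β β with hP
  set P' := η' • vecMulVec (i₂ ∘ c) (i₂ ∘ c) with hP'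
  have hPP : P * P = x ^ e • P := smul_vecMulVec_mul_self _ _ _ hη
  have hPP' : P' * P' = x ^ e • P' := smul_vecMulVec_mul_self _ _ _ hη'c
  have hPt : Pᵀ = P := by rw [hP, transpose_smul, transpose_vecMulVec]
  have hPt' : P'ᵀ = P' := by rw [hP', transpose_smul, transpose_vecMulVec]
  obtain ⟨D, hD⟩ : ∃ D, P' = P + x ^ (2 * e + 1) • D := by
    refine ⟨-((θ * η * ν) • P) + x ^ e • (η * ν) •
      (vecMulVec β w + vecMulVec w β + x ^ (3 * e + 1) • vecMulVec w w), ?_⟩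
    have h1 : P' = (η * ν) • vecMulVec (β + x ^ (3 * e + 1) • w) (β + x ^ (3 * e + 1) • w) := by
      rw [hP', hc, hη', vecMulVec_smul, smul_vecMulVec, smul_smul, smul_smul]
      congr 1
      calc _ = (p * p') * (p * p') * (η * ν) := by ring
        _ = _ := by rw [hpp]; ring
    rw [h1, hP]
    have hν' : ν = 1 - x ^ (2 * e + 1) • (θ * η * ν) := eq_sub_of_add_eq hμ
    clear_value ν
    ext i j
    simp only [vecMulVec_apply, Matrix.smul_apply, Matrix.add_apply, Matrix.neg_apply, smul_eq_mul,
      Pi.add_apply, Pi.smul_apply] at hν' ⊢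
    simp only [Algebra.smul_def, map_pow] at hν' ⊢
    linear_combination (η * (β i * β j)) * hν'
  clear_value P P'
  set S := x ^ e • (1 : Matrix ι ι A₀) - (2 : R) • P with hS
  set S' := x ^ e • (1 : Matrix ι ι A₀) - (2 : R) • P' with hS'
  have hSS : S * S = (x ^ e * x ^ e) • (1 : Matrix ι ι A₀) := reflection_mul_self _ _ hPP
  have hSS' : S' * S' = (x ^ e * x ^ e) • (1 : Matrix ι ι A₀) := reflection_mul_self _ _ hPP'
  have hSt : Sᵀ = S := by
    rw [hS, transpose_sub, transpose_smul, transpose_one, transpose_smul, hPt]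
  have hSt' : S'ᵀ = S' := by
    rw [hS', transpose_sub, transpose_smul, transpose_one, transpose_smul, hPt']
  set Y := (4 : R) • (P * D) - (2 * x ^ e) • D with hY
  set G := 1 + x • Y with hG
  have hSG : S * S' = (x ^ e * x ^ e) • G := by
    have h1 : P * P' = x ^ e • P + x ^ (2 * e + 1) • (P * D) := by
      rw [hD, mul_add, hPP, mul_smul_comm]
    rw [hG, hY, hS, hS']
    simp only [sub_mul, mul_sub, smul_mul_assoc, mul_smul_comm, one_mul, mul_one, h1]
    rw [hD]
    simp only [smul_add, smul_sub, smul_smul]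
    module
  have hcM := h.complete₀.matrix (ι := ι) (κ := ι)
  have hcV := h.complete₀.pi (ι := ι)
  have hGG : Gᵀ * G = 1 := by
    refine hcM.cancel (4 * e) ?_
    have : (x ^ e * x ^ e) • (x ^ e * x ^ e) • (Gᵀ * G) = (S * S')ᵀ * (S * S') := by
      rw [hSG, transpose_smul, smul_mul_assoc, mul_smul_comm]
    rw [transpose_mul, hSt, hSt', mul_assoc, ← mul_assoc S S, hSS, smul_mul_assoc, mul_smul_comm,
      one_mul, hSS', smul_smul, smul_smul] at this
    convert this using 2 <;> ring
  obtain ⟨a, b, ha, hb, hab⟩ := h.exists_orthogonal hR Y hGG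
  have hSV : S *ᵥ V₂ = x ^ e • V₁ := by
    have h2 : (2 : R) • (β ⬝ᵥ V₂) = - (β ⬝ᵥ β) := by
      rw [hβ]
      simp only [sub_dotProduct, dotProduct_sub, hQ, dotProduct_comm V₂ V₁]
      module
    have h3 : (2 : R) • P *ᵥ V₂ = - (x ^ e • β) := by
      rw [hP, smul_mulVec, vecMulVec_mulVec]
      ext i
      simp only [Pi.smul_apply, Pi.neg_apply, MulOpposite.smul_eq_mul_unop, MulOpposite.unop_op,
        smul_eq_mul]
      simp only [Algebra.smul_def, map_ofNat] at h2 ⊢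
      linear_combination (η * β i) * h2 - β i * hη
    rw [hS, sub_mulVec, smul_mulVec, smul_mulVec, one_mulVec, h3, hβ, smul_sub]
    abel
  have hGV : G *ᵥ (S' *ᵥ V₂) = x ^ e • V₁ := by
    refine hcV.cancel (2 * e) ?_
    have h4 : (x ^ e * x ^ e) • G *ᵥ (S' *ᵥ V₂) = (S * S') *ᵥ (S' *ᵥ V₂) := by
      rw [hSG, smul_mulVec]
    have h5 : (S * S') *ᵥ (S' *ᵥ V₂) = (x ^ e * x ^ e) • x ^ e • V₁ := by
      rw [mulVec_mulVec, mul_assoc, hSS', mul_smul_comm, mul_one, smul_mulVec, hSV]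
    rw [h5] at h4
    convert h4 using 2 <;> ring
  have hV : i₂.mapMatrix b *ᵥ (S' *ᵥ V₂) = x ^ e • (i₁.mapMatrix aᵀ *ᵥ V₁) := by
    rw [← mulVec_smul, ← hGV, show G = _ from hab, mulVec_mulVec, mulVec_mulVec, mulVec_mulVec, ← mul_assoc,
      ← map_mul, ha, map_one, one_mul]
  set Z : ι → A₂ := (c ⬝ᵥ c) • W₂ - (2 * (c ⬝ᵥ W₂)) • c with hZ
  have hi₂c : i₂ (c ⬝ᵥ c) = (i₂ ∘ c) ⬝ᵥ (i₂ ∘ c) := RingHom.map_dotProduct i₂.toRingHom c c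
  have hi₂W : i₂ (c ⬝ᵥ W₂) = (i₂ ∘ c) ⬝ᵥ (i₂ ∘ W₂) := RingHom.map_dotProduct i₂.toRingHom c W₂
  have hZS : i₂ (c ⬝ᵥ c) • (S' *ᵥ V₂) = x ^ e • i₁ γ₁ • (i₂ ∘ Z) := by
    rw [hS', sub_mulVec, smul_mulVec, smul_mulVec, one_mulVec, hP', smul_mulVec, vecMulVec_mulVec]
    ext i
    rw [← hi₂c] at hη'c
    simp only [hZ, hV₂, Pi.smul_apply, Pi.sub_apply, MulOpposite.smul_eq_mul_unop,
      MulOpposite.unop_op, smul_eq_mul, Function.comp_apply, map_sub, map_mul, hi₂W,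
      dotProduct_smul]
    simp only [Algebra.smul_def, map_ofNat]
    linear_combination (-2 * i₂ (c i) * (i₁ γ₁ * (i₂ ∘ c) ⬝ᵥ (i₂ ∘ W₂))) * hη'c
  refine ⟨aᵀ *ᵥ W₁, b *ᵥ Z, c ⬝ᵥ c, η', by rw [hi₂c, hη'c], ?_, ?_⟩
  · have haa : a * aᵀ = 1 := mul_eq_one_comm.mp ha
    rw [dotProduct_mulVec, vecMul_transpose, mulVec_mulVec, haa, one_mulVec]
  · refine hcV.cancel e ?_
    have e1 : i₁ ∘ (aᵀ *ᵥ W₁) = i₁.mapMatrix aᵀ *ᵥ (i₁ ∘ W₁) := by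
      ext i; exact RingHom.map_mulVec i₁.toRingHom aᵀ W₁ i
    have e2 : i₂ ∘ (b *ᵥ Z) = i₂.mapMatrix b *ᵥ (i₂ ∘ Z) := by
      ext i; exact RingHom.map_mulVec i₂.toRingHom b Z i
    rw [e1, e2, map_mul, mul_smul, ← mulVec_smul (i₁.mapMatrix aᵀ), ← hV₁, smul_comm, ← hV,
      ← mulVec_smul, hZS, mulVec_smul, mulVec_smul]

end Patch

end

section

open Matrix Polynomial

section Coord

/-- Coordinates on `AdjoinRoot G` with respect to the powers of the root. -/
noncomputable def coord {S : Type*} [CommRing S] (G : S[X]) (hG : G.Monic) (d : ℕ)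
    (hd : G.natDegree = d) : AdjoinRoot G ≃ₗ[S] (Fin d → S) :=
  (AdjoinRoot.powerBasisAux' hG).equivFun ≪≫ₗ LinearEquiv.funCongrLeft S S (finCongr hd.symm)

lemma coord_apply {S : Type*} [CommRing S] {G : S[X]} (hG : G.Monic) {d : ℕ}
    (hd : G.natDegree = d) (z : AdjoinRoot G) (i : Fin d) :
    coord G hG d hd z i = (AdjoinRoot.modByMonicHom hG z).coeff i := by
  simp [coord, LinearEquiv.funCongrLeft_apply, LinearMap.funLeft_apply,
    AdjoinRoot.powerBasisAux'_repr_apply_to_fun]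

lemma coord_map {S S' : Type*} [CommRing S] [CommRing S'] (φ : S →+* S') {G : S[X]} (hG : G.Monic)
    {G' : S'[X]} (hG' : G'.Monic) (h : G' = G.map φ) (hdvd : G' ∣ G.map φ) {d : ℕ}
    (hd : G.natDegree = d) (hd' : G'.natDegree = d) (z : AdjoinRoot G) (i : Fin d) :
    coord G' hG' d hd' (AdjoinRoot.map φ G G' hdvd z) i = φ (coord G hG d hd z i) := by
  subst h
  induction z using AdjoinRoot.induction_on with
  | ih p =>
    rw [coord_apply, coord_apply, AdjoinRoot.map, AdjoinRoot.lift_mk, AdjoinRoot.modByMonicHom_mk]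
    have : p.eval₂ ((AdjoinRoot.of (G.map φ)).comp φ) (AdjoinRoot.root (G.map φ)) =
        AdjoinRoot.mk (G.map φ) (p.map φ) := by
      rw [← AdjoinRoot.aeval_eq, aeval_def, eval₂_map]; rfl
    rw [this, AdjoinRoot.modByMonicHom_mk, ← map_modByMonic φ hG, coeff_map]

end Coord

section

variable {R : Type*} [CommRing R]

lemma XComplete.adjoinRoot {x : R} {S : Type*} [CommRing S] [Algebra R S] (h : XComplete x S)
    {G : S[X]} (hG : G.Monic) : XComplete x (AdjoinRoot G) :=
  (h.pi (ι := Fin G.natDegree)).of_equiv ((coord G hG _ rfl).symm.restrictScalars R)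

/-- The `S`-algebra with the equation `g`. -/
abbrev Root (g : R[X]) (S : Type*) [CommRing S] [Algebra R S] : Type _ :=
  AdjoinRoot (g.map (algebraMap R S))

/-- Functoriality of `Root`. -/
noncomputable def rootMap (g : R[X]) {S S' : Type*} [CommRing S] [CommRing S'] [Algebra R S]
    [Algebra R S'] (φ : S →ₐ[R] S') : Root g S →ₐ[R] Root g S' :=
  AdjoinRoot.mapAlgHom φ _ _ (by rw [Polynomial.map_map, AlgHom.comp_algebraMap])

lemma rootMap_mk (g : R[X]) {S S' : Type*} [CommRing S] [CommRing S'] [Algebra R S]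
    [Algebra R S'] (φ : S →ₐ[R] S') (p : S[X]) :
    rootMap g φ (AdjoinRoot.mk _ p) = AdjoinRoot.mk _ (p.map φ.toRingHom) := by
  rw [rootMap, AdjoinRoot.coe_mapAlgHom, AdjoinRoot.map, AdjoinRoot.lift_mk,
    ← AdjoinRoot.aeval_eq, aeval_def, eval₂_map]
  rfl

lemma rootMap_of (g : R[X]) {S S' : Type*} [CommRing S] [CommRing S'] [Algebra R S]
    [Algebra R S'] (φ : S →ₐ[R] S') (a : S) :
    rootMap g φ (AdjoinRoot.of _ a) = AdjoinRoot.of _ (φ a) := by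
  rw [← AdjoinRoot.mk_C, rootMap_mk, Polynomial.map_C, AdjoinRoot.mk_C]; rfl

/-- Coordinates on `Root g S`. -/
noncomputable def rootCoord {g : R[X]} (hg : g.Monic) (S : Type*) [CommRing S] [Nontrivial S]
    [Algebra R S] : Root g S ≃ₗ[S] (Fin g.natDegree → S) :=
  coord _ (hg.map _) _ (hg.natDegree_map _)

lemma rootCoord_map {g : R[X]} (hg : g.Monic) {S S' : Type*} [CommRing S] [CommRing S']
    [Nontrivial S] [Nontrivial S'] [Algebra R S] [Algebra R S'] (φ : S →ₐ[R] S') (z : Root g S)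
    (i : Fin g.natDegree) : rootCoord hg S' (rootMap g φ z) i = φ (rootCoord hg S z i) :=
  coord_map φ.toRingHom (hg.map _) (hg.map _)
    (by rw [Polynomial.map_map, AlgHom.toRingHom_eq_coe, AlgHom.comp_algebraMap])
    (by rw [Polynomial.map_map, AlgHom.toRingHom_eq_coe, AlgHom.comp_algebraMap]) _ _ _ _

lemma rootMap_injective {g : R[X]} (hg : g.Monic) {S S' : Type*} [CommRing S] [CommRing S']
    [Nontrivial S] [Nontrivial S'] [Algebra R S] [Algebra R S'] (φ : S →ₐ[R] S')
    (hφ : Function.Injective φ) : Function.Injective (rootMap g φ) := by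
  intro a b hab
  apply (rootCoord hg S).injective
  ext i
  apply hφ
  rw [← rootCoord_map, ← rootCoord_map, hab]

lemma exists_rootMap {g : R[X]} (hg : g.Monic) {S S' : Type*} [CommRing S] [CommRing S']
    [Nontrivial S] [Nontrivial S'] [Algebra R S] [Algebra R S'] (φ : S →ₐ[R] S') (z : Root g S')
    (c : Fin g.natDegree → S) (hc : ∀ i, rootCoord hg S' z i = φ (c i)) :
    rootMap g φ ((rootCoord hg S).symm c) = z := by
  apply (rootCoord hg S').injective
  ext i
  rw [rootCoord_map, LinearEquiv.apply_symm_apply, hc]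

namespace Patch

variable {x : R} {A A₁ A₂ A₀ : Type*} [CommRing A] [CommRing A₁] [CommRing A₂] [CommRing A₀]
    [Nontrivial A] [Nontrivial A₁] [Nontrivial A₂] [Nontrivial A₀]
    [Algebra R A] [Algebra R A₁] [Algebra R A₂] [Algebra R A₀]
    {j₁ : A →ₐ[R] A₁} {j₂ : A →ₐ[R] A₂} {i₁ : A₁ →ₐ[R] A₀} {i₂ : A₂ →ₐ[R] A₀}

lemma root (h : Patch x j₁ j₂ i₁ i₂) {g : R[X]} (hg : g.Monic) :
    Patch x (rootMap g j₁) (rootMap g j₂) (rootMap g i₁) (rootMap g i₂) where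
  comm a := by
    apply (rootCoord hg A₀).injective
    ext i
    simp only [rootCoord_map, h.comm]
  inj₁ := rootMap_injective hg _ h.inj₁
  inj₂ := rootMap_injective hg _ h.inj₂
  injj₁ := rootMap_injective hg _ h.injj₁
  injj₂ := rootMap_injective hg _ h.injj₂
  pull a b hab := by
    have (i : Fin g.natDegree) : i₁ (rootCoord hg A₁ a i) = i₂ (rootCoord hg A₂ b i) := by
      rw [← rootCoord_map, ← rootCoord_map, hab]
    choose c hc1 hc2 using fun i => h.pull _ _ (this i)
    exact ⟨(rootCoord hg A).symm c, exists_rootMap hg _ _ _ fun i => (hc1 i).symm,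
      exists_rootMap hg _ _ _ fun i => (hc2 i).symm⟩
  add y := by
    choose a b hab using fun i => h.add (rootCoord hg A₀ y i)
    refine ⟨(rootCoord hg A₁).symm a, (rootCoord hg A₂).symm b, ?_⟩
    apply (rootCoord hg A₀).injective
    ext i
    rw [map_add, Pi.add_apply, rootCoord_map, rootCoord_map, LinearEquiv.apply_symm_apply,
      LinearEquiv.apply_symm_apply, hab]
  complete := h.complete.adjoinRoot (hg.map _)
  complete₁ := h.complete₁.adjoinRoot (hg.map _)
  complete₂ := h.complete₂.adjoinRoot (hg.map _)
  complete₀ := h.complete₀.adjoinRoot (hg.map _)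

end Patch

end

end

section

open Matrix

lemma exists_anisotropic_reflection {k : Type*} [Field k] [CharZero k] {N : ℕ} (hN : 3 ≤ N) (C : k)
    (V W : Fin N → k) (h : C + V ⬝ᵥ W ≠ 0) :
    ∃ a : Fin N → ℕ, ((fun i => (a i : k)) ⬝ᵥ (fun i => (a i : k))) * C +
      2 * ((fun i => (a i : k)) ⬝ᵥ V) * ((fun i => (a i : k)) ⬝ᵥ W) ≠ 0 := by
  by_contra! hall
  have h1 (i : Fin N) : C + 2 * V i * W i = 0 := by
    have := hall (Pi.single i 1)
    have e : (fun j => ((Pi.single i 1 : Fin N → ℕ) j : k)) = Pi.single i 1 := by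
      ext j; by_cases hj : j = i
      · subst hj; simp
      · simp [hj]
    rw [e] at this
    simpa using this
  have h2 (i j : Fin N) (hij : i ≠ j) : 2 * C + 2 * (V i + V j) * (W i + W j) = 0 := by
    have := hall (Pi.single i 1 + Pi.single j 1)
    have e : (fun l => ((Pi.single i 1 + Pi.single j 1 : Fin N → ℕ) l : k)) =
        Pi.single i 1 + Pi.single j 1 := by
      ext l
      simp only [Pi.add_apply, Nat.cast_add, Pi.single_apply, Nat.cast_ite, Nat.cast_one,
        Nat.cast_zero]
    rw [e] at this
    simp only [add_dotProduct, single_dotProduct, one_mul, Pi.add_apply, Pi.single_apply, if_true,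
      if_neg hij, if_neg hij.symm] at this
    linear_combination this
  have h3 (i j : Fin N) (hij : i ≠ j) : V i * W j + V j * W i = 0 := by
    have : (2 : k) * (V i * W j + V j * W i) = 0 := by
      linear_combination h2 i j hij - h1 i - h1 j
    simpa using this
  by_cases hC : C = 0
  · apply h
    rw [hC, zero_add, dotProduct]
    refine Finset.sum_eq_zero fun i _ => ?_
    have := h1 i
    rw [hC, zero_add, mul_assoc] at this
    simpa using this
  · have hne (i) : V i ≠ 0 ∧ W i ≠ 0 := by
      constructor <;> intro h0 <;> exact hC (by simpa [h0] using h1 i)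
    have i0 : Fin N := ⟨0, by omega⟩
    obtain ⟨a, b, c, hab, hac, hbc⟩ : ∃ a b c : Fin N, a ≠ b ∧ a ≠ c ∧ b ≠ c :=
      ⟨⟨0, by omega⟩, ⟨1, by omega⟩, ⟨2, by omega⟩, by simp, by simp, by simp⟩
    have e1 := h3 a b hab
    have e2 := h3 a c hac
    have e3 := h3 b c hbc
    have : (2 : k) * (V a * W b * W c * W a) = 0 := by
      linear_combination W a * W c * e1 + W a * W b * e2 - W a * W a * e3
    simp [hne] at this

lemma exists_nat_quadratic_ne_zero {ι : Type*} (s : Finset ι) (k : ι → Type*) [∀ i, Field (k i)]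
    [∀ i, CharZero (k i)] (u v w : ∀ i, k i) (h : ∀ i ∈ s, u i ≠ 0 ∨ w i ≠ 0) :
    ∃ n : ℕ, 0 < n ∧ ∀ i ∈ s, u i + n * v i + n ^ 2 * w i ≠ 0 := by
  classical
  have hfin : ∀ i ∈ s, {n : ℕ | u i + n * v i + n ^ 2 * w i = 0}.Finite := by
    intro i hi
    set p : Polynomial (k i) := .C (u i) + .X * .C (v i) + .X ^ 2 * .C (w i) with hp
    have hp0 : p ≠ 0 := by
      intro h0
      rcases h i hi with h1 | h1
      · apply h1
        have := congrArg (fun q => Polynomial.coeff q 0) h0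
        simpa [hp] using this
      · apply h1
        have := congrArg (fun q => Polynomial.coeff q 2) h0
        simpa [hp, Polynomial.coeff_X, Polynomial.coeff_C] using this
    refine Set.Finite.of_finite_image (f := fun n : ℕ => (n : k i))
      ((Polynomial.finite_setOfPred_isRoot hp0).subset ?_) (Nat.cast_injective.injOn)
    rintro _ ⟨n, hn, rfl⟩
    have hn' : u i + n * v i + n ^ 2 * w i = 0 := hn
    have : p.eval (n : k i) = 0 := by
      simp [hp]
      linear_combination hn'
    exact this
  have hF : (⋃ i ∈ s, {n : ℕ | u i + n * v i + n ^ 2 * w i = 0}).Finite :=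
    s.finite_toSet.biUnion hfin
  obtain ⟨n, hn1, hn⟩ := (Set.Ioi_infinite (0 : ℕ)).exists_notMem_finite hF
  refine ⟨n, hn1, fun i hi h0 => hn ?_⟩
  simp only [Set.mem_iUnion]
  exact ⟨i, hi, h0⟩

lemma exists_anisotropic_reflections {ι : Type*} (s : Finset ι) (k : ι → Type*) [∀ i, Field (k i)]
    [∀ i, CharZero (k i)] {N : ℕ} (hN : 3 ≤ N) (C : ∀ i, k i)
    (V W : ∀ i, Fin N → k i) (h : ∀ i, C i + V i ⬝ᵥ W i ≠ 0) :
    ∃ a : Fin N → ℕ, a ≠ 0 ∧ ∀ i ∈ s,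
      ((fun j => (a j : k i)) ⬝ᵥ (fun j => (a j : k i))) * C i +
      2 * ((fun j => (a j : k i)) ⬝ᵥ V i) * ((fun j => (a j : k i)) ⬝ᵥ W i) ≠ 0 := by
  classical
  induction s using Finset.induction_on with
  | empty => exact ⟨fun _ => 1, fun h0 => by simpa using congrFun h0 ⟨0, by omega⟩, by simp⟩
  | insert l s hl ih =>
    obtain ⟨a, ha0, ha⟩ := ih
    obtain ⟨b, hb⟩ := exists_anisotropic_reflection hN (C l) (V l) (W l) (h l)
    set A : ∀ i, Fin N → k i := fun i j => (a j : k i)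
    set B : ∀ i, Fin N → k i := fun i j => (b j : k i)
    obtain ⟨n, hn0, hn⟩ := exists_nat_quadratic_ne_zero (insert l s) k
      (fun i => (A i ⬝ᵥ A i) * C i + 2 * (A i ⬝ᵥ V i) * (A i ⬝ᵥ W i))
      (fun i => 2 * (A i ⬝ᵥ B i) * C i + 2 * (A i ⬝ᵥ V i) * (B i ⬝ᵥ W i) +
        2 * (B i ⬝ᵥ V i) * (A i ⬝ᵥ W i))
      (fun i => (B i ⬝ᵥ B i) * C i + 2 * (B i ⬝ᵥ V i) * (B i ⬝ᵥ W i)) (by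
        intro i hi
        rcases Finset.mem_insert.mp hi with rfl | hi
        · exact Or.inr hb
        · exact Or.inl (ha i hi))
    refine ⟨a + n • b, fun h0 => ha0 ?_, fun i hi => ?_⟩
    · ext j
      have := congrFun h0 j
      simp only [Pi.add_apply, Pi.zero_apply] at this ⊢
      omega
    · have e : (fun j => (((a + n • b) j : ℕ) : k i)) = A i + (n : k i) • B i := by
        ext j; simp [A, B]
      rw [e]
      convert hn i hi using 1
      simp only [add_dotProduct, dotProduct_add, smul_dotProduct, dotProduct_smul, smul_eq_mul,
        dotProduct_comm (B i) (A i)]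
      ring

end

section

open Matrix Polynomial

lemma exists_unit_reflection (k : Type*) {E : Type*} [Field k] [CharZero k] [CommRing E] [Algebra k E]
    [IsArtinianRing E] {N : ℕ} (hN : 3 ≤ N) (C : E) (V W : Fin N → E) (h : IsUnit (C + V ⬝ᵥ W)) :
    ∃ a : Fin N → ℕ, a ≠ 0 ∧ IsUnit (((fun i => (a i : E)) ⬝ᵥ (fun i => (a i : E))) * C +
      2 * ((fun i => (a i : E)) ⬝ᵥ V) * ((fun i => (a i : E)) ⬝ᵥ W)) := by
  classical
  let (i : MaximalSpectrum E) : Field (E ⧸ i.asIdeal) := Ideal.Quotient.field _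
  have (i : MaximalSpectrum E) : CharZero (E ⧸ i.asIdeal) :=
    charZero_of_injective_algebraMap (algebraMap k (E ⧸ i.asIdeal)).injective
  let := Fintype.ofFinite (MaximalSpectrum E)
  have hmk (i : MaximalSpectrum E) (v w : Fin N → E) : Ideal.Quotient.mk i.asIdeal (v ⬝ᵥ w) =
      (fun j => Ideal.Quotient.mk i.asIdeal (v j)) ⬝ᵥ fun j => Ideal.Quotient.mk i.asIdeal (w j) :=
    RingHom.map_dotProduct _ _ _
  obtain ⟨a, ha, hu⟩ := exists_anisotropic_reflections (Finset.univ : Finset (MaximalSpectrum E))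
    (fun i => E ⧸ i.asIdeal) hN (fun i => Ideal.Quotient.mk _ C)
    (fun i j => Ideal.Quotient.mk _ (V j)) (fun i j => Ideal.Quotient.mk _ (W j)) (by
      intro i
      have := h.map (Ideal.Quotient.mk i.asIdeal)
      rw [map_add, hmk] at this
      exact this.ne_zero)
  refine ⟨a, ha, ?_⟩
  by_contra hn
  obtain ⟨M, hM, hmem⟩ := exists_max_ideal_of_mem_nonunits hn
  apply hu ⟨M, hM⟩ (Finset.mem_univ _)
  rw [← Ideal.Quotient.eq_zero_iff_mem] at hmem
  rw [← hmem]
  simp only [map_add, map_mul, map_ofNat, hmk ⟨M, hM⟩, map_natCast]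

/-- The polynomial `f` becomes a sum of `N` squares in the total ring of fractions of
`S[X] / (g)`. -/
def Good (N : ℕ) {S : Type*} [CommRing S] (g f : S[X]) : Prop :=
  ∃ c : S, c ≠ 0 ∧ ∃ v : Fin N → S[X], g ∣ ∑ i, v i ^ 2 - C (c ^ 2) * f

lemma Good.map {N : ℕ} {S S' : Type*} [CommRing S] [CommRing S'] {g f : S[X]} (h : Good N g f)
    (φ : S →+* S') (hφ : Function.Injective φ) : Good N (g.map φ) (f.map φ) := by
  obtain ⟨c, hc, v, hv⟩ := h
  refine ⟨φ c, (map_ne_zero_iff φ hφ).mpr hc, fun i => (v i).map φ, ?_⟩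
  have := Polynomial.map_dvd φ hv
  simpa [Polynomial.map_sub, Polynomial.map_sum] using this

lemma good_iff {N : ℕ} {S : Type*} [CommRing S] {g f : S[X]} :
    Good N g f ↔ ∃ c : S, c ≠ 0 ∧ ∃ v : Fin N → AdjoinRoot g,
      v ⬝ᵥ v = AdjoinRoot.of g c ^ 2 * AdjoinRoot.mk g f := by
  constructor
  · rintro ⟨c, hc, v, hv⟩
    refine ⟨c, hc, fun i => AdjoinRoot.mk g (v i), ?_⟩
    rw [← AdjoinRoot.mk_eq_mk] at hv
    simpa [dotProduct, pow_two, map_sum] using hv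
  · rintro ⟨c, hc, v, hv⟩
    choose w hw using fun i => AdjoinRoot.mk_surjective (v i)
    refine ⟨c, hc, w, ?_⟩
    rw [← AdjoinRoot.mk_eq_mk]
    simp only [map_sum, map_pow, hw, map_mul, AdjoinRoot.mk_C]
    rw [← hv]
    simp [dotProduct, pow_two]

end

section

open Matrix Polynomial

lemma exists_dvd_of_mem_nonZeroDivisors {Ω : Type*} [CommRing Ω] [IsDomain Ω] {G : Polynomial Ω}
    (hG : G.Monic) {z : AdjoinRoot G} (hz : z ∈ nonZeroDivisors (AdjoinRoot G)) :
    ∃ d : Ω, d ≠ 0 ∧ z ∣ AdjoinRoot.of G d := by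
  have := hG.finite_adjoinRoot
  exact (Algebra.IsIntegral.isIntegral (R := Ω) z).isAlgebraic.exists_nonzero_dvd hz

lemma of_mul_eq_smul {S : Type*} [CommRing S] {G : S[X]} (a : S) (z : AdjoinRoot G) :
    AdjoinRoot.of G a * z = a • z := by
  rw [Algebra.smul_def]; rfl

lemma adjoinRoot_map_injective {S S' : Type*} [CommRing S] [Nontrivial S] [CommRing S']
    [Nontrivial S'] (φ : S →+* S') (hφ : Function.Injective φ) {G : S[X]} (hG : G.Monic) :
    Function.Injective (AdjoinRoot.map φ G (G.map φ) dvd_rfl) := by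
  intro a b hab
  apply (coord G hG _ rfl).injective
  ext i
  apply hφ
  rw [← coord_map φ hG (hG.map φ) rfl dvd_rfl rfl (hG.natDegree_map φ),
    ← coord_map φ hG (hG.map φ) rfl dvd_rfl rfl (hG.natDegree_map φ), hab]

lemma mem_nonZeroDivisors_of_injective {A B : Type*} [CommRing A] [CommRing B] (φ : A →+* B)
    (hφ : Function.Injective φ) {a : A} (ha : φ a ∈ nonZeroDivisors B) : a ∈ nonZeroDivisors A := by
  rw [mem_nonZeroDivisors_iff_right] at ha ⊢
  intro y hy
  exact hφ (by rw [map_zero]; exact ha _ (by rw [← map_mul, hy, map_zero]))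

namespace Patch

variable {R : Type*} [CommRing R] {x : R} {R₁ R₂ Ω : Type*} [CommRing R₁] [CommRing R₂]
    [CommRing Ω] [Algebra R R₁] [Algebra R R₂] [Algebra R Ω] {i₁ : R₁ →ₐ[R] Ω} {i₂ : R₂ →ₐ[R] Ω}

lemma root_dense [Nontrivial R₂] [Nontrivial Ω] {g : R[X]} (hg : g.Monic)
    (hdense : ∃ (π : R₂) (π' : Ω), i₂ π * π' = 1 ∧ ∀ (ω : Ω) (k : ℕ), ∃ l₀ : ℕ, ∀ l ≥ l₀,
      ∃ (ρ : R₂) (ω' : Ω), i₂ ρ = i₂ π ^ l * (ω + x ^ k • ω')) {ι : Type*} [Fintype ι]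
    (v : ι → Root g Ω) (k : ℕ) :
    ∃ (p p' : Root g Ω) (c : ι → Root g R₂) (w : ι → Root g Ω), p * p' = 1 ∧
      rootMap g i₂ ∘ c = p • (v + x ^ k • w) := by
  obtain ⟨π, π', hππ, hd⟩ := hdense
  choose l₀ hl₀ using fun (i : ι) (j : Fin g.natDegree) => hd (rootCoord hg Ω (v i) j) k
  obtain ⟨l, hl⟩ : ∃ l, ∀ i j, l₀ i j ≤ l :=
    ⟨∑ i, ∑ j, l₀ i j, fun i j => (Finset.single_le_sum (f := fun j => l₀ i j)
      (fun _ _ => Nat.zero_le _) (Finset.mem_univ j)).trans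
      (Finset.single_le_sum (f := fun i => ∑ j, l₀ i j) (fun _ _ => Nat.zero_le _)
        (Finset.mem_univ i))⟩
  choose ρ ω' hρ using fun i j => hl₀ i j l (hl i j)
  refine ⟨AdjoinRoot.of _ (i₂ π ^ l), AdjoinRoot.of _ (π' ^ l),
    fun i => (rootCoord hg R₂).symm (ρ i), fun i => (rootCoord hg Ω).symm (ω' i), ?_, ?_⟩
  · rw [← map_mul, ← mul_pow, hππ, one_pow, map_one]
  · ext i
    apply (rootCoord hg Ω).injective
    ext j
    have e : x ^ k • (rootCoord hg Ω).symm (ω' i) = (rootCoord hg Ω).symm (x ^ k • ω' i) := by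
      rw [← algebraMap_smul Ω, ← map_smul, algebraMap_smul Ω]
    rw [Function.comp_apply, rootCoord_map, LinearEquiv.apply_symm_apply, hρ, Pi.smul_apply,
      smul_eq_mul, of_mul_eq_smul, map_smul, Pi.smul_apply, Pi.add_apply, Pi.smul_apply, e, map_add,
      LinearEquiv.apply_symm_apply]
    simp

end Patch

end

section

open Matrix Polynomial

namespace Patch

variable {R : Type*} [CommRing R] {x : R} {R₁ R₂ Ω : Type*} [CommRing R₁] [CommRing R₂]
    [CommRing Ω] [Algebra R R₁] [Algebra R R₂] [Algebra R Ω] {i₁ : R₁ →ₐ[R] Ω} {i₂ : R₂ →ₐ[R] Ω}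

lemma rootMap_mk_map (g f : R[X]) {S S' : Type*} [CommRing S] [CommRing S'] [Algebra R S]
    [Algebra R S'] (φ : S →ₐ[R] S') :
    rootMap g φ (AdjoinRoot.mk _ (f.map (algebraMap R S))) =
      AdjoinRoot.mk _ (f.map (algebraMap R S')) := by
  rw [rootMap_mk, Polynomial.map_map, AlgHom.toRingHom_eq_coe, AlgHom.comp_algebraMap]

lemma rootMap_dotProduct (g : R[X]) {S S' : Type*} [CommRing S] [CommRing S'] [Algebra R S]
    [Algebra R S'] (φ : S →ₐ[R] S') {ι : Type*} [Fintype ι] (v w : ι → Root g S) :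
    rootMap g φ (v ⬝ᵥ w) = (rootMap g φ ∘ v) ⬝ᵥ (rootMap g φ ∘ w) :=
  RingHom.map_dotProduct (rootMap g φ).toRingHom v w

/-- Representability of `f` by a sum of `N ≥ 3` squares can be patched. -/
theorem good [IsDomain R] [IsDomain R₁] [IsDomain R₂] [IsDomain Ω] [CharZero Ω]
    (h : Patch x (Algebra.ofId R R₁) (Algebra.ofId R R₂) i₁ i₂) (hR : ∃ r : R, r * 2 = 1)
    (hΩ : ∀ ω : Ω, ω ≠ 0 → ∃ (e : ℕ) (ω' : Ω), ω * ω' = algebraMap R Ω (x ^ e))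
    (hdense : ∃ (π : R₂) (π' : Ω), i₂ π * π' = 1 ∧ ∀ (ω : Ω) (k : ℕ), ∃ l₀ : ℕ, ∀ l ≥ l₀,
      ∃ (ρ : R₂) (ω' : Ω), i₂ ρ = i₂ π ^ l * (ω + x ^ k • ω'))
    (hD₁ : ∀ c : R₁, c ≠ 0 → ∃ (ρ : R₁) (r : R), r ≠ 0 ∧ c * ρ = algebraMap R R₁ r)
    (hD₂ : ∀ c : R₂, c ≠ 0 → ∃ (ρ : R₂) (r : R), r ≠ 0 ∧ c * ρ = algebraMap R R₂ r)
    {g f : R[X]} (hg : g.Monic) (hf : ∃ r : R, r ≠ 0 ∧ ∃ f' : R[X], g ∣ f * f' - C r)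
    {N : ℕ} (hN : 3 ≤ N) (h₁ : Good N (g.map (algebraMap R R₁)) (f.map (algebraMap R R₁)))
    (h₂ : Good N (g.map (algebraMap R R₂)) (f.map (algebraMap R R₂))) : Good N g f := by
  obtain ⟨c₁, hc₁, W₁, hW₁⟩ := good_iff.mp h₁
  obtain ⟨c₂, hc₂, W₂, hW₂⟩ := good_iff.mp h₂
  have hP := h.root hg
  have hinj : Function.Injective (algebraMap R Ω) := by
    rw [← i₁.comp_algebraMap]
    exact h.inj₁.comp h.injj₁
  set I₁ := rootMap g i₁ with hI₁
  set I₂ := rootMap g i₂ with hI₂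
  set G := g.map (algebraMap R Ω) with hG
  have hGm : G.Monic := hg.map _
  set fΩ : Root g Ω := AdjoinRoot.mk G (f.map (algebraMap R Ω)) with hfΩ
  have hf₁ : I₁ (AdjoinRoot.mk _ (f.map (algebraMap R R₁))) = fΩ := rootMap_mk_map g f i₁
  have hf₂ : I₂ (AdjoinRoot.mk _ (f.map (algebraMap R R₂))) = fΩ := rootMap_mk_map g f i₂
  set K := FractionRing Ω
  set κ := AdjoinRoot.map (algebraMap Ω K) G (G.map _) dvd_rfl with hκ
  have hκi : Function.Injective κ :=
    adjoinRoot_map_injective _ (IsFractionRing.injective Ω K) hGm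
  have : Module.Finite K (AdjoinRoot (G.map (algebraMap Ω K))) := (hGm.map _).finite_adjoinRoot
  have : IsArtinianRing (AdjoinRoot (G.map (algebraMap Ω K))) := IsArtinianRing.of_finite K _
  have : CharZero K := charZero_of_injective_algebraMap (IsFractionRing.injective Ω K)
  have hκof (ω : Ω) (hω : ω ≠ 0) : IsUnit (κ (AdjoinRoot.of G ω)) := by
    rw [hκ, AdjoinRoot.map_of]
    exact (IsUnit.mk0 _ ((map_ne_zero_iff _ (IsFractionRing.injective Ω K)).mpr hω)).map
      (AdjoinRoot.of _)
  have hfu : IsUnit (κ fΩ) := by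
    obtain ⟨r, hr, f', hdvd⟩ := hf
    have h1 := Polynomial.map_dvd (algebraMap R Ω) hdvd
    rw [Polynomial.map_sub, Polynomial.map_mul, ← AdjoinRoot.mk_eq_mk, map_mul, Polynomial.map_C,
      AdjoinRoot.mk_C] at h1
    have h2 := hκof _ ((map_ne_zero_iff _ hinj).mpr hr)
    rw [← h1, map_mul] at h2
    exact isUnit_of_mul_isUnit_left h2
  have hc₁' : i₁ c₁ ≠ 0 := (map_ne_zero_iff _ h.inj₁).mpr hc₁
  have hc₂' : i₂ c₂ ≠ 0 := (map_ne_zero_iff _ h.inj₂).mpr hc₂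
  set D : Root g Ω := AdjoinRoot.of G (i₁ c₁) * AdjoinRoot.of G (i₂ c₂) * fΩ -
    (I₁ ∘ W₁) ⬝ᵥ (I₂ ∘ W₂) with hD
  have hκd (v w : Fin N → Root g Ω) : κ (v ⬝ᵥ w) = (κ ∘ v) ⬝ᵥ (κ ∘ w) :=
    RingHom.map_dotProduct _ _ _
  obtain ⟨a, ha, hau⟩ := exists_unit_reflection K hN (κ D) (κ ∘ I₁ ∘ W₁) (κ ∘ I₂ ∘ W₂) (by
    rw [← hκd, ← map_add, hD, sub_add_cancel, map_mul, map_mul]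
    exact ((hκof _ hc₁').mul (hκof _ hc₂')).mul hfu)
  set q : ℕ := ∑ i, a i ^ 2 with hq
  have hq0 : q ≠ 0 := by
    intro h0
    apply ha
    ext i
    have := (Finset.sum_eq_zero_iff.mp h0) i (Finset.mem_univ i)
    simpa using this
  set α : Fin N → Root g Ω := fun i => (a i : Root g Ω) with hα
  set α₂ : Fin N → Root g R₂ := fun i => (a i : Root g R₂) with hα₂
  have hIα : I₂ ∘ α₂ = α := by ext i; simp [hα, hα₂]
  have hαα : α ⬝ᵥ α = (q : Root g Ω) := by simp [hα, hq, dotProduct, pow_two]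
  have hαα₂ : α₂ ⬝ᵥ α₂ = (q : Root g R₂) := by simp [hα₂, hq, dotProduct, pow_two]
  set H : Root g Ω := (q : Root g Ω) * D + 2 * (α ⬝ᵥ (I₁ ∘ W₁)) * (α ⬝ᵥ (I₂ ∘ W₂)) with hH
  have hκα : κ ∘ α = fun i => (a i : AdjoinRoot (G.map (algebraMap Ω K))) := by
    ext i; simp [hα]
  have hHu : IsUnit (κ H) := by
    rw [hH, ← hαα]
    simp only [map_add, map_mul, hκd, map_ofNat, hκα]
    exact hau
  set W₂' : Fin N → Root g R₂ := (q : Root g R₂) • W₂ - (2 * (α₂ ⬝ᵥ W₂)) • α₂ with hW₂'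
  have hW₂'Q : W₂' ⬝ᵥ W₂' = (q : Root g R₂) ^ 2 * (W₂ ⬝ᵥ W₂) := by
    rw [hW₂']
    simp only [sub_dotProduct, dotProduct_sub, smul_dotProduct, dotProduct_smul, smul_eq_mul,
      hαα₂, dotProduct_comm W₂ α₂]
    ring
  set γ₁ : Root g R₁ := AdjoinRoot.of _ c₁ with hγ₁
  set γ₂ : Root g R₂ := AdjoinRoot.of _ (q * c₂) with hγ₂
  have hIγ₁ : I₁ γ₁ = AdjoinRoot.of G (i₁ c₁) := rootMap_of _ _ _
  have hIγ₂ : I₂ γ₂ = (q : Root g Ω) * AdjoinRoot.of G (i₂ c₂) := by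
    rw [hI₂, hγ₂, rootMap_of, map_mul, map_mul, map_natCast, map_natCast]
  have hQ₁ : (I₁ ∘ W₁) ⬝ᵥ (I₁ ∘ W₁) = AdjoinRoot.of G (i₁ c₁) ^ 2 * fΩ := by
    rw [hI₁, ← rootMap_dotProduct, hW₁, map_mul, map_pow, rootMap_of, ← hI₁, hf₁]
  have hQ₂ : (I₂ ∘ W₂) ⬝ᵥ (I₂ ∘ W₂) = AdjoinRoot.of G (i₂ c₂) ^ 2 * fΩ := by
    rw [hI₂, ← rootMap_dotProduct, hW₂, map_mul, map_pow, rootMap_of, ← hI₂, hf₂]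
  have hQ₂' : (I₂ ∘ W₂') ⬝ᵥ (I₂ ∘ W₂') = (q : Root g Ω) ^ 2 * AdjoinRoot.of G (i₂ c₂) ^ 2 * fΩ := by
    rw [hI₂, ← rootMap_dotProduct, hW₂'Q, map_mul, map_pow, map_natCast, rootMap_dotProduct, ← hI₂,
      hQ₂, mul_assoc]
  have hIW₂' : I₂ ∘ W₂' = (q : Root g Ω) • (I₂ ∘ W₂) - (2 * (α ⬝ᵥ (I₂ ∘ W₂))) • α := by
    ext i
    rw [← hIα, hI₂, ← rootMap_dotProduct]
    have h2 : rootMap g i₂ 2 = 2 := map_ofNat _ 2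
    simp [hW₂', h2]
  set V₁ := I₂ γ₂ • (I₁ ∘ W₁) with hV₁
  set V₂ := I₁ γ₁ • (I₂ ∘ W₂') with hV₂
  have hQ : V₁ ⬝ᵥ V₁ = V₂ ⬝ᵥ V₂ := by
    rw [hV₁, hV₂]
    simp only [smul_dotProduct, dotProduct_smul, smul_eq_mul, hQ₁, hQ₂', hIγ₁, hIγ₂]
    ring
  have hβ : (V₁ - V₂) ⬝ᵥ (V₁ - V₂) =
      2 * q * AdjoinRoot.of G (i₁ c₁) * AdjoinRoot.of G (i₂ c₂) * H := by
    rw [sub_dotProduct, dotProduct_sub, dotProduct_sub, ← hQ, dotProduct_comm V₂ V₁, hV₁, hV₂, hIW₂']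
    simp only [smul_dotProduct, dotProduct_smul, dotProduct_sub, smul_eq_mul, hQ₁, hIγ₁, hIγ₂,
      dotProduct_comm _ α]
    rw [hH, hD]
    ring
  have hnat (m : ℕ) (hm : m ≠ 0) : IsUnit (κ (m : Root g Ω)) := by
    have := hκof (m : Ω) (by exact_mod_cast hm)
    rwa [map_natCast] at this
  have hβu : IsUnit (κ ((V₁ - V₂) ⬝ᵥ (V₁ - V₂))) := by
    rw [hβ]
    simp only [map_mul]
    exact ((((hnat 2 two_ne_zero).mul (hnat q hq0)).mul (hκof _ hc₁')).mul (hκof _ hc₂')).mul hHu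
  obtain ⟨d, hd, η, hη⟩ := exists_dvd_of_mem_nonZeroDivisors hGm
    (mem_nonZeroDivisors_of_injective κ hκi hβu.mem_nonZeroDivisors)
  obtain ⟨e, ω', hω'⟩ := hΩ d hd
  obtain ⟨U₁, U₂, δ, δ', hδ, hU₁, hU⟩ := hP.exists_common_vector hR W₁ W₂' γ₁ γ₂
    (η * AdjoinRoot.of G ω') e hQ (by
      rw [← mul_assoc, ← hη, ← map_mul, hω']; rfl) (root_dense hg hdense)
  have hδn : δ ∈ nonZeroDivisors (Root g R₂) := by
    refine mem_nonZeroDivisors_of_injective I₂.toRingHom hP.inj₂ ?_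
    rw [mem_nonZeroDivisors_iff_right]
    intro y hy
    refine hP.complete₀.regular_pow e y ?_
    rw [Algebra.smul_def, ← hδ, mul_comm, ← mul_assoc]
    exact mul_eq_zero_of_left hy _
  obtain ⟨d₂, hd₂, h₂, hh₂⟩ := exists_dvd_of_mem_nonZeroDivisors (hg.map _) hδn
  have hq₂ : (q : R₂) ≠ 0 := by
    intro h0
    have := congrArg i₂ h0
    rw [map_natCast, map_zero] at this
    exact hq0 (by exact_mod_cast this)
  obtain ⟨ρ₁, r₁, hr₁, hρ₁⟩ := hD₁ c₁ hc₁
  obtain ⟨ρ₂, r₂, hr₂, hρ₂⟩ := hD₂ (d₂ * (q * c₂)) (mul_ne_zero hd₂ (mul_ne_zero hq₂ hc₂))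
  have hpull (i : Fin N) : I₁ (AdjoinRoot.of _ (algebraMap R R₁ r₂ * ρ₁) * U₁ i) =
      I₂ (AdjoinRoot.of _ (algebraMap R R₂ r₁ * ρ₂) * h₂ * U₂ i) := by
    have e0 := congrFun hU i
    simp only [Pi.smul_apply, smul_eq_mul, Function.comp_apply, hIγ₁, map_mul, hIγ₂] at e0
    have e1 := congrArg (fun z => I₂ z) hh₂
    simp only [hI₂, rootMap_of, map_mul] at e1
    have e2 := congrArg (fun z => AdjoinRoot.of G (i₁ z)) hρ₁
    have e3 := congrArg (fun z => AdjoinRoot.of G (i₂ z)) hρ₂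
    simp only [map_mul, AlgHom.commutes, map_natCast] at e2 e3
    simp only [map_mul, hI₁, hI₂, rootMap_of, AlgHom.commutes] at e0 ⊢
    rw [← e2, ← e3]
    linear_combination (AdjoinRoot.of G (i₁ ρ₁) * AdjoinRoot.of G (i₂ ρ₂) * rootMap g i₂ h₂) * e0 +
      (AdjoinRoot.of G (i₁ ρ₁) * AdjoinRoot.of G (i₂ ρ₂) * q * AdjoinRoot.of G (i₂ c₂) *
        rootMap g i₁ (U₁ i)) * e1
  choose ζ hζ₁ hζ₂ using fun i => hP.pull _ _ (hpull i)
  have key : Good N (g.map (algebraMap R R)) (f.map (algebraMap R R)) := by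
    refine good_iff.mpr ⟨r₁ * r₂, mul_ne_zero hr₁ hr₂, ζ, hP.injj₁ ?_⟩
    have e1 : rootMap g (Algebra.ofId R R₁) ∘ ζ =
        fun i => (AdjoinRoot.of (g.map (algebraMap R R₁)) (algebraMap R R₁ r₂ * ρ₁) : Root g R₁) * U₁ i :=
      funext fun i => hζ₁ i
    rw [rootMap_dotProduct, e1, map_mul (rootMap g _), map_pow (rootMap g _), rootMap_of,
      rootMap_mk_map]
    trans (AdjoinRoot.of (g.map (algebraMap R R₁)) (algebraMap R R₁ r₂ * ρ₁)) ^ 2 * (U₁ ⬝ᵥ U₁)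
    · simp only [dotProduct, Finset.mul_sum]
      exact Finset.sum_congr rfl fun i _ => by ring
    · simp only [hU₁, hW₁, Algebra.ofId_apply, map_mul, ← hρ₁]
      ring
  simpa [Algebra.algebraMap_self] using key

end Patch

end

section

open Polynomial

/-- Modules of power series with coefficients in an increasing sequence of subgroups are
`X`-adically complete. -/
lemma XComplete.of_coeff {K : Type*} [CommRing K] {R : Type*} [CommRing R] {x : R} {M : Type*}
    [AddCommGroup M] [Module R M] (A : ℕ → AddSubgroup K) (hA : Monotone A)
    (φ : M →+ PowerSeries K) (hφ : Function.Injective φ)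
    (hx : ∀ m, φ (x • m) = PowerSeries.X * φ m)
    (hr : ∀ p, (∃ m, φ m = p) ↔ ∀ n, PowerSeries.coeff n p ∈ A n) : XComplete x M := by
  have hxk (k : ℕ) (m : M) : φ (x ^ k • m) = PowerSeries.X ^ k * φ m := by
    induction k with
    | zero => simp
    | succ k ih => rw [pow_succ', mul_smul, hx, ih, pow_succ', mul_assoc]
  refine ⟨fun m hm => ?_, fun m hm => ?_, fun d => ?_⟩
  · have := congrArg φ hm
    rw [hx, map_zero] at this
    exact hφ (by rw [map_zero]; exact PowerSeries.X_mul_cancel (by rw [this, mul_zero]))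
  · apply hφ
    ext n
    obtain ⟨e, he⟩ := hm (n + 1)
    rw [he, hxk, PowerSeries.coeff_X_pow_mul', if_neg (by omega)]
    simp
  · have hd (i n : ℕ) : PowerSeries.coeff n (φ (d i)) ∈ A n := (hr _).mp ⟨_, rfl⟩ n
    obtain ⟨l, hl⟩ := (hr (PowerSeries.mk fun n =>
      ∑ i ∈ Finset.range (n + 1), PowerSeries.coeff (n - i) (φ (d i)))).mpr fun n => by
        rw [PowerSeries.coeff_mk]
        exact sum_mem fun i _ => hA (Nat.sub_le n i) (hd _ _)
    refine ⟨l, fun k => ?_⟩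
    obtain ⟨e, he⟩ := (hr (PowerSeries.mk fun n =>
      ∑ i ∈ Finset.range (n + 1), PowerSeries.coeff (n - i) (φ (d (k + i))))).mpr fun n => by
        rw [PowerSeries.coeff_mk]
        exact sum_mem fun i _ => hA (Nat.sub_le n i) (hd _ _)
    refine ⟨e, hφ ?_⟩
    ext n
    simp only [hl, map_add, map_sum, hxk, he, PowerSeries.coeff_X_pow_mul', PowerSeries.coeff_mk]
    split_ifs with hkn
    · rw [show n + 1 = k + (n - k + 1) by omega, Finset.sum_range_add]
      congr 1
      · refine Finset.sum_congr rfl fun i hi => ?_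
        rw [Finset.mem_range] at hi
        rw [if_pos (by omega)]
      · refine Finset.sum_congr rfl fun i _ => ?_
        rw [Nat.sub_add_eq]
    · rw [add_zero, ← Finset.sum_subset (Finset.range_mono (by omega : n + 1 ≤ k))]
      · refine Finset.sum_congr rfl fun i hi => ?_
        rw [Finset.mem_range] at hi
        rw [if_pos (by omega)]
      · intro i _ hi
        rw [Finset.mem_range] at hi
        rw [if_neg (by omega)]

/-- A multiplicative increasing filtration of a subring of a field by additive subgroups. -/
structure Filt (K : Type*) [Field K] where
  /-- The steps of the filtration. -/
  A : ℕ → AddSubgroup K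
  one_mem : (1 : K) ∈ A 0
  one_mem' : (1 : K) ∈ A 1
  mul_mem : ∀ {i j a b}, a ∈ A i → b ∈ A j → a * b ∈ A (i + j)

namespace Filt

variable {K : Type*} [Field K]

lemma mono (A : Filt K) : Monotone A.A :=
  monotone_nat_of_le_succ fun n a ha => by simpa using A.mul_mem ha A.one_mem'

/-- The completed Rees ring of a filtration. -/
def rees (A : Filt K) : Subring (PowerSeries K) where
  carrier := {p | ∀ n, PowerSeries.coeff n p ∈ A.A n}
  zero_mem' n := by simp
  one_mem' n := by
    rw [PowerSeries.coeff_one]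
    split_ifs with h
    · exact h ▸ A.one_mem
    · exact zero_mem _
  add_mem' ha hb n := by rw [map_add]; exact add_mem (ha n) (hb n)
  neg_mem' ha n := by rw [map_neg]; exact neg_mem (ha n)
  mul_mem' {a b} ha hb n := by
    rw [PowerSeries.coeff_mul]
    refine sum_mem fun p hp => ?_
    rw [← Finset.HasAntidiagonal.mem_antidiagonal.mp hp]
    exact A.mul_mem (ha _) (hb _)

lemma X_mem (A : Filt K) : PowerSeries.X ∈ A.rees := fun n => by
  rw [PowerSeries.coeff_X]
  split_ifs with h
  · exact h ▸ A.one_mem'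
  · exact zero_mem _

lemma monomial_mem {A : Filt K} {n : ℕ} {a : K} (ha : a ∈ A.A n) :
    PowerSeries.monomial n a ∈ A.rees := fun m => by
  rw [PowerSeries.coeff_monomial]
  split_ifs with h
  · exact h ▸ ha
  · exact zero_mem _

/-- The intersection of two filtrations. -/
def inf (A C : Filt K) : Filt K where
  A n := A.A n ⊓ C.A n
  one_mem := ⟨A.one_mem, C.one_mem⟩
  one_mem' := ⟨A.one_mem', C.one_mem'⟩
  mul_mem ha hb := ⟨A.mul_mem ha.1 hb.1, C.mul_mem ha.2 hb.2⟩

lemma inf_le_left (A C : Filt K) : (A.inf C).rees ≤ A.rees := fun _ h n => (h n).1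

lemma inf_le_right (A C : Filt K) : (A.inf C).rees ≤ C.rees := fun _ h n => (h n).2

end Filt

end

section

open Polynomial

namespace Filt

variable {K : Type*} [Field K]

lemma exists_order (c : PowerSeries K) (hc : c ≠ 0) :
    ∃ (m : ℕ) (c' : PowerSeries K), c = PowerSeries.X ^ m * c' ∧ PowerSeries.coeff 0 c' ≠ 0 ∧
      PowerSeries.coeff 0 c' = PowerSeries.coeff m c := by
  obtain ⟨c', hc'⟩ := PowerSeries.X_pow_order_dvd (φ := c)
  have h : PowerSeries.coeff 0 c' = PowerSeries.coeff c.order.toNat c := by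
    generalize c.order.toNat = m at hc' ⊢
    rw [hc', PowerSeries.coeff_X_pow_mul', if_pos le_rfl, Nat.sub_self]
  exact ⟨_, c', hc', h ▸ PowerSeries.coeff_order hc, h⟩

lemma XComplete_rees (A C : Filt K) (h : A.rees ≤ C.rees) [Algebra A.rees C.rees]
    (hh : algebraMap A.rees C.rees = Subring.inclusion h) :
    XComplete (⟨PowerSeries.X, A.X_mem⟩ : A.rees) C.rees :=
  XComplete.of_coeff C.A C.mono C.rees.subtype.toAddMonoidHom Subtype.val_injective
    (fun m => by
      rw [Algebra.smul_def, hh]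
      rfl)
    fun p => ⟨by rintro ⟨m, rfl⟩; exact m.2, fun hp => ⟨⟨p, hp⟩, rfl⟩⟩

lemma XComplete_powerSeries (A : Filt K) :
    XComplete (⟨PowerSeries.X, A.X_mem⟩ : A.rees) (PowerSeries K) :=
  XComplete.of_coeff (fun _ => ⊤) (fun _ _ _ => le_rfl) (AddMonoidHom.id _) Function.injective_id
    (fun m => rfl) fun p => ⟨by simp, fun _ => ⟨p, rfl⟩⟩

/-- Representations by sums of squares over two completed Rees rings glue. -/
theorem good_rees [CharZero K] (A C : Filt K) (hA : (2⁻¹ : K) ∈ A.A 0) (hC : (2⁻¹ : K) ∈ C.A 0)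
    (hadd : ∀ n y, ∃ a ∈ A.A n, ∃ b ∈ C.A n, y = a + b)
    (hπ : ∃ π ∈ C.A 0, π ≠ 0 ∧ ∀ ω, ∃ l₀ : ℕ, ∀ l ≥ l₀, π ^ l * ω ∈ C.A 0)
    (hDA : ∀ m, ∀ a ∈ A.A m, a ≠ 0 → ∃ n, ∃ ρ ∈ A.A n, ρ ≠ 0 ∧ a * ρ ∈ C.A (m + n))
    (hDC : ∀ m, ∀ a ∈ C.A m, a ≠ 0 → ∃ n, ∃ ρ ∈ C.A n, ρ ≠ 0 ∧ a * ρ ∈ A.A (m + n))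
    {g f : (A.inf C).rees[X]} (hg : g.Monic) (hf : ∃ r, r ≠ 0 ∧ ∃ f', g ∣ f * f' - Polynomial.C r)
    {N : ℕ} (hN : 3 ≤ N)
    (h₁ : Good N (g.map (Subring.inclusion (inf_le_left A C)))
      (f.map (Subring.inclusion (inf_le_left A C))))
    (h₂ : Good N (g.map (Subring.inclusion (inf_le_right A C)))
      (f.map (Subring.inclusion (inf_le_right A C)))) : Good N g f := by
  let _ : Algebra (A.inf C).rees A.rees := (Subring.inclusion (inf_le_left A C)).toAlgebra
  let _ : Algebra (A.inf C).rees C.rees := (Subring.inclusion (inf_le_right A C)).toAlgebra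
  let i₁ : A.rees →ₐ[(A.inf C).rees] PowerSeries K := { A.rees.subtype with commutes' := fun _ => rfl }
  let i₂ : C.rees →ₐ[(A.inf C).rees] PowerSeries K := { C.rees.subtype with commutes' := fun _ => rfl }
  have : CharZero (PowerSeries K) := charZero_of_injective_ringHom PowerSeries.C_injective
  let x : (A.inf C).rees := ⟨PowerSeries.X, (A.inf C).X_mem⟩
  have c₁ : XComplete x A.rees := XComplete_rees (A.inf C) A (inf_le_left A C) rfl
  have c₂ : XComplete x C.rees := XComplete_rees (A.inf C) C (inf_le_right A C) rfl
  have c₀ : XComplete x (PowerSeries K) := XComplete_powerSeries (A.inf C)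
  have hsmul (p : PowerSeries K) : x • p = PowerSeries.X * p := rfl
  have hP : Patch x (Algebra.ofId _ A.rees) (Algebra.ofId _ C.rees) i₁ i₂ :=
    { comm := fun _ => rfl
      inj₁ := Subtype.val_injective
      inj₂ := Subtype.val_injective
      injj₁ := Subring.inclusion_injective (inf_le_left A C)
      injj₂ := Subring.inclusion_injective (inf_le_right A C)
      pull := fun a b hab => by
        have hab : (a : PowerSeries K) = b := hab
        exact ⟨⟨a, fun n => ⟨a.2 n, hab ▸ b.2 n⟩⟩, Subtype.ext rfl, Subtype.ext hab⟩
      add := fun y => by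
        choose a ha b hb hab using fun n => hadd n (PowerSeries.coeff n y)
        exact ⟨⟨PowerSeries.mk a, fun n => by rw [PowerSeries.coeff_mk]; exact ha n⟩,
          ⟨PowerSeries.mk b, fun n => by rw [PowerSeries.coeff_mk]; exact hb n⟩,
          PowerSeries.ext fun n => by
            change _ = PowerSeries.coeff n (PowerSeries.mk a + PowerSeries.mk b)
            rw [map_add, PowerSeries.coeff_mk, PowerSeries.coeff_mk, hab]⟩
      complete := XComplete_rees (A.inf C) (A.inf C) le_rfl rfl
      complete₁ := c₁
      complete₂ := c₂
      complete₀ := c₀ }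
  -- leading coefficients reduce divisibility to the graded pieces
  have fac (m n : ℕ) (c : PowerSeries K) (ρ : K) (hc : PowerSeries.coeff 0 c ≠ 0) (hρ : ρ ≠ 0) :
      ∃ (a a' : A.rees) (b b' : C.rees), a * a' = 1 ∧ b * b' = 1 ∧
        PowerSeries.X ^ m * c * PowerSeries.monomial n ρ =
          PowerSeries.monomial (m + n) (PowerSeries.coeff 0 c * ρ) *
            ((a : PowerSeries K) * (b : PowerSeries K)) := by
    obtain ⟨ω, hω⟩ : PowerSeries.X ∣
        PowerSeries.C (PowerSeries.coeff 0 c)⁻¹ * c - 1 := by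
      rw [PowerSeries.X_dvd_iff, map_sub, map_mul]
      simp only [PowerSeries.constantCoeff_C, map_one]
      rw [← PowerSeries.coeff_zero_eq_constantCoeff_apply, inv_mul_cancel₀ hc, sub_self]
    obtain ⟨a, b, hab⟩ := exists_factor c₁ c₂ c₀ i₁ i₂ hP.add ω
    obtain ⟨a', ha'⟩ := c₁.exists_mul_one_add a
    obtain ⟨b', hb'⟩ := c₂.exists_mul_one_add b
    refine ⟨1 + x • a, 1 + x • a', 1 + x • b, 1 + x • b', ?_, ?_, ?_⟩
    · exact ha'.1
    · exact hb'.1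
    · have e : ((1 + x • a : A.rees) : PowerSeries K) * (1 + x • b : C.rees) =
          PowerSeries.C (PowerSeries.coeff 0 c)⁻¹ * c := by
        rw [sub_eq_iff_eq_add'] at hω
        rw [hω, ← hsmul, hab]
        rfl
      rw [e]
      have e1 : PowerSeries.C (PowerSeries.coeff 0 c)⁻¹ * PowerSeries.C (PowerSeries.coeff 0 c) = 1 := by
        rw [← map_mul, inv_mul_cancel₀ hc, map_one]
      have e2 (n : ℕ) (a : K) : PowerSeries.monomial n a = PowerSeries.C a * PowerSeries.X ^ n := by
        rw [PowerSeries.X_pow_eq, ← PowerSeries.monomial_zero_eq_C_apply,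
          PowerSeries.monomial_mul_monomial, zero_add, mul_one]
      rw [e2, e2, map_mul, pow_add]
      linear_combination (-PowerSeries.X ^ m * c * PowerSeries.C ρ * PowerSeries.X ^ n) * e1
  refine hP.good ⟨⟨PowerSeries.C 2⁻¹, fun n => ?_⟩, ?_⟩ ?_ ?_ ?_ ?_ hg hf hN h₁ h₂
  · rw [PowerSeries.coeff_C]
    split_ifs with h
    · subst h; exact ⟨hA, hC⟩
    · exact zero_mem _
  · apply Subtype.ext
    change PowerSeries.C (2⁻¹ : K) * 2 = 1
    rw [← map_ofNat (PowerSeries.C (R := K)) 2, ← map_mul, inv_mul_cancel₀ two_ne_zero, map_one]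
  · intro ω hω
    obtain ⟨m, c', hc, h0, -⟩ := exists_order ω hω
    have hu : IsUnit c' := by
      rw [PowerSeries.isUnit_iff_constantCoeff, ← PowerSeries.coeff_zero_eq_constantCoeff_apply]
      exact h0.isUnit
    obtain ⟨u, rfl⟩ := hu
    refine ⟨m, (u⁻¹ : (PowerSeries K)ˣ), ?_⟩
    rw [hc, mul_assoc, Units.mul_inv, mul_one]
    rfl
  · obtain ⟨π, hπC, hπ0, hπ⟩ := hπ
    refine ⟨⟨PowerSeries.C π, fun n => ?_⟩, PowerSeries.C π⁻¹, ?_, fun ω k => ?_⟩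
    · rw [PowerSeries.coeff_C]
      split_ifs with h
      · exact h ▸ hπC
      · exact zero_mem _
    · change PowerSeries.C π * PowerSeries.C π⁻¹ = 1
      rw [← map_mul, mul_inv_cancel₀ hπ0, map_one]
    · choose l hl using fun n => hπ (PowerSeries.coeff n ω)
      refine ⟨∑ i ∈ Finset.range k, l i, fun l' hl' => ?_⟩
      obtain ⟨ω', hω'⟩ : PowerSeries.X ^ k ∣ (PowerSeries.trunc k ω : PowerSeries K) - ω := by
        rw [PowerSeries.X_pow_dvd_iff]
        intro m hm
        rw [map_sub, Polynomial.coeff_coe, PowerSeries.coeff_trunc, if_pos hm, sub_self]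
      refine ⟨⟨PowerSeries.C (π ^ l') * (PowerSeries.trunc k ω : PowerSeries K), fun n => ?_⟩, ω', ?_⟩
      · rw [PowerSeries.coeff_C_mul, Polynomial.coeff_coe, PowerSeries.coeff_trunc]
        split_ifs with hn
        · refine C.mono (Nat.zero_le n) (hl n _ (le_trans ?_ hl'))
          exact Finset.single_le_sum (f := l) (fun _ _ => Nat.zero_le _) (Finset.mem_range.mpr hn)
        · rw [mul_zero]; exact zero_mem _
      · change PowerSeries.C (π ^ l') * (PowerSeries.trunc k ω : PowerSeries K) =
          PowerSeries.C π ^ l' * (ω + PowerSeries.X ^ k * ω')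
        rw [← hω', map_pow]
        ring
  · rintro ⟨c, hcA⟩ hc
    obtain ⟨m, c', hcc, h0, h1⟩ := exists_order c (fun h => hc (Subtype.ext h))
    obtain ⟨n, ρ, hρ, hρ0, hρC⟩ := hDA m _ (hcA m) (h1 ▸ h0)
    obtain ⟨a, a', b, b', ha, hb, hab⟩ := fac m n c' ρ h0 hρ0
    rw [← hcc] at hab
    rw [← h1] at hρC
    have hz : i₁ (⟨c, hcA⟩ * ⟨PowerSeries.monomial n ρ, monomial_mem hρ⟩ * a') =
        i₂ (⟨PowerSeries.monomial (m + n) (PowerSeries.coeff 0 c' * ρ), monomial_mem hρC⟩ * b) := by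
      change c * PowerSeries.monomial n ρ * (a' : PowerSeries K) =
        PowerSeries.monomial (m + n) (PowerSeries.coeff 0 c' * ρ) * (b : PowerSeries K)
      have ha : (a : PowerSeries K) * a' = 1 := congrArg Subtype.val ha
      rw [hab]
      linear_combination (PowerSeries.monomial (m + n) (PowerSeries.coeff 0 c' * ρ) * (b : PowerSeries K)) * ha
    obtain ⟨r, hr1, -⟩ := hP.pull _ _ hz
    refine ⟨⟨PowerSeries.monomial n ρ, monomial_mem hρ⟩ * a', r, ?_, by rw [← mul_assoc]; exact hr1.symm⟩
    rintro rfl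
    rw [map_zero] at hr1
    rcases mul_eq_zero.mp hr1.symm with h | h
    · rcases mul_eq_zero.mp h with h | h
      · exact hc h
      · have : PowerSeries.monomial n ρ = 0 := congrArg Subtype.val h
        have := congrArg (PowerSeries.coeff n) this
        rw [PowerSeries.coeff_monomial_same, map_zero] at this
        exact hρ0 this
    · rw [h, mul_zero] at ha
      exact zero_ne_one ha
  · rintro ⟨c, hcA⟩ hc
    obtain ⟨m, c', hcc, h0, h1⟩ := exists_order c (fun h => hc (Subtype.ext h))
    obtain ⟨n, ρ, hρ, hρ0, hρC⟩ := hDC m _ (hcA m) (h1 ▸ h0)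
    obtain ⟨a, a', b, b', ha, hb, hab⟩ := fac m n c' ρ h0 hρ0
    rw [← hcc] at hab
    rw [← h1] at hρC
    have hz : i₁ (⟨PowerSeries.monomial (m + n) (PowerSeries.coeff 0 c' * ρ), monomial_mem hρC⟩ * a) =
        i₂ (⟨c, hcA⟩ * ⟨PowerSeries.monomial n ρ, monomial_mem hρ⟩ * b') := by
      change PowerSeries.monomial (m + n) (PowerSeries.coeff 0 c' * ρ) * (a : PowerSeries K) =
        c * PowerSeries.monomial n ρ * (b' : PowerSeries K)
      have hb : (b : PowerSeries K) * b' = 1 := congrArg Subtype.val hb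
      rw [hab]
      linear_combination (-PowerSeries.monomial (m + n) (PowerSeries.coeff 0 c' * ρ) * (a : PowerSeries K)) * hb
    obtain ⟨r, -, hr1⟩ := hP.pull _ _ hz
    refine ⟨⟨PowerSeries.monomial n ρ, monomial_mem hρ⟩ * b', r, ?_, by rw [← mul_assoc]; exact hr1.symm⟩
    rintro rfl
    rw [map_zero] at hr1
    rcases mul_eq_zero.mp hr1.symm with h | h
    · rcases mul_eq_zero.mp h with h | h
      · exact hc h
      · have : PowerSeries.monomial n ρ = 0 := congrArg Subtype.val h
        have := congrArg (PowerSeries.coeff n) this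
        rw [PowerSeries.coeff_monomial_same, map_zero] at this
        exact hρ0 this
    · rw [h, mul_zero] at hb
      exact zero_ne_one hb

end Filt

end

section

section SumSq

variable {A : Type*} [CommRing A]

lemma mem_sumSq_of_fintype {ι : Type*} [Fintype ι] {k : ℕ} (h : Fintype.card ι = k) (f : ι → A) :
    ∑ i, f i ^ 2 ∈ sumSq A k :=
  ⟨f ∘ (Fintype.equivFinOfCardEq h).symm,
    ((Fintype.equivFinOfCardEq h).symm.sum_comp fun i => f i ^ 2).symm⟩

lemma zero_mem_sumSq (k : ℕ) : (0 : A) ∈ sumSq A k := ⟨0, by simp⟩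

lemma sq_mem_sumSq (a : A) : a ^ 2 ∈ sumSq A 1 := ⟨fun _ => a, by simp⟩

lemma add_mem_sumSq {a b : A} {k l : ℕ} (ha : a ∈ sumSq A k) (hb : b ∈ sumSq A l) :
    a + b ∈ sumSq A (k + l) := by
  obtain ⟨f, rfl⟩ := ha
  obtain ⟨g, rfl⟩ := hb
  exact ⟨Fin.append f g, by simp [Fin.sum_univ_add]⟩

lemma sumSq_mono {k l : ℕ} (h : k ≤ l) : sumSq A k ⊆ sumSq A l := by
  obtain ⟨m, rfl⟩ := Nat.exists_eq_add_of_le h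
  intro a ha
  simpa using add_mem_sumSq ha (zero_mem_sumSq m)

lemma sq_mul_mem_sumSq {a : A} {k : ℕ} (c : A) (ha : a ∈ sumSq A k) : c ^ 2 * a ∈ sumSq A k := by
  obtain ⟨f, rfl⟩ := ha
  exact ⟨fun i => c * f i, by simp [Finset.mul_sum, mul_pow]⟩

lemma map_mem_sumSq {B : Type*} [CommRing B] (φ : A →+* B) {a : A} {k : ℕ} (ha : a ∈ sumSq A k) :
    φ a ∈ sumSq B k := by
  obtain ⟨f, rfl⟩ := ha
  exact ⟨fun i => φ (f i), by simp⟩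

lemma exists_add_of_mem_sumSq {a : A} {k l : ℕ} (ha : a ∈ sumSq A (k + l)) :
    ∃ b ∈ sumSq A k, ∃ c ∈ sumSq A l, a = b + c := by
  obtain ⟨f, rfl⟩ := ha
  exact ⟨_, ⟨fun i => f (Fin.castAdd l i), rfl⟩, _, ⟨fun i => f (Fin.natAdd k i), rfl⟩,
    Fin.sum_univ_add _⟩

lemma mem_sums {a : A} : a ∈ sums A ↔ ∃ k, a ∈ sumSq A k := Set.mem_iUnion

lemma sum_mem_sums {ι : Type*} [Fintype ι] (f : ι → A) : ∑ i, f i ^ 2 ∈ sums A :=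
  mem_sums.mpr ⟨_, mem_sumSq_of_fintype rfl f⟩

lemma map_mem_sums {B : Type*} [CommRing B] (φ : A →+* B) {a : A} (ha : a ∈ sums A) :
    φ a ∈ sums B := by
  obtain ⟨k, hk⟩ := mem_sums.mp ha
  exact mem_sums.mpr ⟨k, map_mem_sumSq φ hk⟩

lemma sInf_image_le_iff {P : ℕ → Prop} (hP : ∀ k l, k ≤ l → P k → P l) (m : ℕ) :
    sInf ((fun k : ℕ => (k : ℕ∞)) '' {k | P k}) ≤ (m : ℕ∞) ↔ P m := by
  refine ⟨fun h => ?_, fun h => sInf_le ⟨m, h, rfl⟩⟩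
  by_contra hm
  have : ((m + 1 : ℕ) : ℕ∞) ≤ sInf ((fun k : ℕ => (k : ℕ∞)) '' {k | P k}) := by
    refine le_sInf ?_
    rintro _ ⟨k, hk, rfl⟩
    have : m + 1 ≤ k := by
      by_contra hlt
      exact hm (hP k m (by omega) hk)
    exact Nat.cast_le.mpr this
  have h2 := this.trans h
  rw [Nat.cast_le] at h2
  omega

lemma pyth_le_iff (m : ℕ) : pyth A ≤ m ↔ sums A ⊆ sumSq A m :=
  sInf_image_le_iff (fun _ _ hkl h => h.trans (sumSq_mono hkl)) m

lemma pstar_le_iff (H : Subring A) (m : ℕ) : pstar H ≤ m ↔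
    ∀ h : H, IsUnit h → (h : A) ∈ sums A → (h : A) ∈ sumSq A m :=
  sInf_image_le_iff (P := fun m => ∀ h : H, IsUnit h → (h : A) ∈ sums A → (h : A) ∈ sumSq A m)
    (fun _ _ hkl h x hx hs => sumSq_mono hkl (h x hx hs)) m

end SumSq

section Field

variable {E : Type*} [Field E]

/-- Pfister's theorem: sums of `2 ^ k` squares are multiplicative. -/
theorem mul_mem_sumSq_two_pow (k : ℕ) {a b : E} (ha : a ∈ sumSq E (2 ^ k)) (hb : b ∈ sumSq E (2 ^ k)) :
    a * b ∈ sumSq E (2 ^ k) := by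
  induction k generalizing a b with
  | zero =>
    obtain ⟨f, rfl⟩ := ha
    simpa using sq_mul_mem_sumSq (f 0) hb
  | succ k ih =>
    rw [pow_succ, mul_two] at ha hb ⊢
    obtain ⟨a, ha', b, hb', rfl⟩ := exists_add_of_mem_sumSq ha
    obtain ⟨c, hc, d, hd, rfl⟩ := exists_add_of_mem_sumSq hb
    by_cases ha0 : a = 0
    · have := add_mem_sumSq (ih hb' hc) (ih hb' hd)
      rwa [ha0, zero_add, mul_add]
    by_cases hb0 : b = 0
    · have := add_mem_sumSq (ih ha' hc) (ih ha' hd)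
      rwa [hb0, add_zero, mul_add]
    have hy := sq_mul_mem_sumSq (a * b)⁻¹ (ih hd (ih ha' hb'))
    obtain ⟨X, rfl⟩ := hc
    obtain ⟨Y, hY⟩ := hy
    have h1 := add_mem_sumSq (ih ha' ⟨fun i => X i - b * Y i, rfl⟩)
      (ih hb' ⟨fun i => X i + a * Y i, rfl⟩)
    convert h1 using 1
    have hd : d = a * b * ∑ i, Y i ^ 2 := by
      rw [← hY]; field_simp
    have e1 : ∑ i, (X i - b * Y i) ^ 2 = ∑ i, X i ^ 2 - 2 * b * ∑ i, X i * Y i + b ^ 2 * ∑ i, Y i ^ 2 := by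
      simp only [Finset.mul_sum, ← Finset.sum_sub_distrib, ← Finset.sum_add_distrib]
      exact Finset.sum_congr rfl fun i _ => by ring
    have e2 : ∑ i, (X i + a * Y i) ^ 2 = ∑ i, X i ^ 2 + 2 * a * ∑ i, X i * Y i + a ^ 2 * ∑ i, Y i ^ 2 := by
      simp only [Finset.mul_sum, ← Finset.sum_add_distrib]
      exact Finset.sum_congr rfl fun i _ => by ring
    rw [hd, e1, e2]
    ring

/-- The level of a field, if finite, is a power of two. -/
lemma neg_one_mem_sumSq_of_succ {k : ℕ} (hk : 1 ≤ k) (h : (-1 : E) ∈ sumSq E (2 ^ k + 1)) :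
    (-1 : E) ∈ sumSq E (2 ^ k) := by
  have hq : 2 ≤ 2 ^ k := by simpa using Nat.pow_le_pow_right two_pos hk
  obtain ⟨r, hr⟩ := Nat.exists_eq_add_of_le hq
  rw [show 2 ^ k + 1 = (r + 1) + 2 by omega] at h
  obtain ⟨a, ha, b, hb, hab⟩ := exists_add_of_mem_sumSq h
  have hA : 1 + a ∈ sumSq E (2 ^ k) := by
    have := add_mem_sumSq (sq_mem_sumSq (1 : E)) ha
    rwa [one_pow, show 1 + (r + 1) = 2 ^ k by omega] at this
  by_cases h0 : 1 + a = 0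
  · have : a = -1 := by linear_combination h0
    exact this ▸ sumSq_mono (by omega) ha
  · have := sq_mul_mem_sumSq (1 + a)⁻¹ (mul_mem_sumSq_two_pow k hA (sumSq_mono hq hb))
    convert this using 1
    have : b = -(1 + a) := by linear_combination -hab
    rw [this]
    field_simp

lemma mem_sumSq_of_neg_one_mem {q : ℕ} (h2 : (2 : E) ≠ 0) (h : (-1 : E) ∈ sumSq E q) (x : E) :
    x ∈ sumSq E (q + 1) := by
  have h1 := add_mem_sumSq (sq_mul_mem_sumSq ((x - 1) / 2) h) (sq_mem_sumSq ((x + 1) / 2))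
  convert h1 using 1
  field_simp
  ring

end Field

end

section

open Matrix

lemma exists_residue_reflection {κ : Type*} [Field κ] (h2 : (2 : κ) ≠ 0) {M : ℕ} {i₀ i₁ : Fin M}
    (hi : i₀ ≠ i₁) (v : Fin M → κ) (hv : v ≠ 0) :
    ∃ p : Fin M → κ, p ⬝ᵥ p ≠ 0 ∧
      ((p ⬝ᵥ p) * v i₀ - 2 * (p ⬝ᵥ v) * p i₀) ^ 2 ≠ (p ⬝ᵥ p) ^ 2 * (v ⬝ᵥ v) := by
  by_cases hall : ∀ j, v j ^ 2 = v ⬝ᵥ v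
  · have h0 : v ⬝ᵥ v ≠ 0 := by
      intro h
      exact hv (funext fun j => by simpa using (hall j).trans h)
    have hM : (M : κ) = 1 := by
      have : v ⬝ᵥ v = M * (v ⬝ᵥ v) := by
        conv_lhs => rw [dotProduct]
        simp_rw [← pow_two, hall]
        simp
      have := mul_right_cancel₀ h0 ((one_mul _).trans this)
      exact this.symm
    set s := v i₀ with hs
    have hs0 : s ≠ 0 := fun h => h0 (by rw [← hall i₀, ← hs, h]; ring)
    set p : Fin M → κ := Function.update v i₁ (-v i₁) with hp
    have hp0 : p i₀ = s := by rw [hp, Function.update_of_ne hi]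
    have hpp : p ⬝ᵥ p = v ⬝ᵥ v := by
      rw [dotProduct, dotProduct]
      refine Finset.sum_congr rfl fun j _ => ?_
      by_cases hj : j = i₁
      · subst hj; simp [hp]
      · rw [hp, Function.update_of_ne hj]
    have hpv : p ⬝ᵥ v = v ⬝ᵥ v - 2 * v i₁ ^ 2 := by
      have : p = v - Pi.single i₁ (2 * v i₁) := by
        ext j
        by_cases hj : j = i₁
        · subst hj; simp [hp]; ring
        · simp [hp, hj]
      rw [this, sub_dotProduct, single_dotProduct]
      ring
    refine ⟨p, hpp ▸ h0, ?_⟩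
    rw [hpp, hpv, hp0, hall, ← hall i₀, ← hs]
    intro h
    have : (2 : κ) ^ 3 * s ^ 6 = 0 := by linear_combination h
    exact mul_ne_zero (pow_ne_zero _ h2) (pow_ne_zero _ hs0) this
  push Not at hall
  obtain ⟨j, hj⟩ := hall
  by_cases h00 : v i₀ ^ 2 = v ⬝ᵥ v
  · have hji : j ≠ i₀ := by rintro rfl; exact hj h00
    have e0 : (Pi.single i₀ 1 - Pi.single j 1 : Fin M → κ) i₀ = 1 := by simp [hji.symm]
    have e1 : (Pi.single i₀ 1 - Pi.single j 1 : Fin M → κ) ⬝ᵥ (Pi.single i₀ 1 - Pi.single j 1) = 2 := by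
      simp [hji, hji.symm]; norm_num
    have e2 : (Pi.single i₀ 1 - Pi.single j 1 : Fin M → κ) ⬝ᵥ v = v i₀ - v j := by
      simp [sub_dotProduct]
    refine ⟨Pi.single i₀ 1 - Pi.single j 1, by rw [e1]; exact h2, ?_⟩
    rw [e0, e1, e2]
    intro h
    apply hj
    have : (2 : κ) ^ 2 ≠ 0 := pow_ne_zero _ h2
    apply mul_left_cancel₀ this
    linear_combination h
  · refine ⟨Pi.single i₀ 1, by simp, ?_⟩
    simp only [single_dotProduct, Pi.single_eq_same, one_mul]
    intro h
    apply h00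
    linear_combination h

/-- Over a field which is effective of order `n + 1`, every sum of squares is a sum of
`2 ^ (n + 1) + 1` squares. -/
theorem IsNEffective.sums_subset {n : ℕ} {E : Type*} [Field E] (h : IsNEffective (n + 1) E) :
    sums E ⊆ sumSq E (2 ^ (n + 1) + 1) := by
  obtain ⟨H, hfrac, hsemi, hbez, ⟨hunit, -⟩, hp⟩ := h
  rw [pstar_le_iff] at hp
  set q := 2 ^ (n + 1) with hq
  have hq2 : 2 ≤ q := by
    rw [hq, pow_succ]
    have := Nat.one_le_two_pow (n := n)
    omega
  have h2 : IsUnit (2 : H) := by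
    have := hunit 1 (sumSq_mono (k := 1) (by omega) (by simpa using sq_mem_sumSq (1 : H)))
    rwa [one_add_one_eq_two] at this
  intro F hF
  obtain ⟨k, f, rfl⟩ := mem_sums.mp hF
  obtain ⟨M, hM, f, hf⟩ : ∃ M, 2 ≤ M ∧ ∑ i, f i ^ 2 ∈ sumSq E M :=
    ⟨k + 2, by omega, sumSq_mono (by omega) ⟨f, rfl⟩⟩
  rw [hf]
  by_cases hf0 : ∀ j, f j = 0
  · simp [hf0, zero_mem_sumSq]
  -- common denominators and primitive part
  choose a b hb hab using fun j => hfrac (f j)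
  obtain ⟨j₀, hj₀⟩ := not_forall.mp hf0
  set B : H := ∏ j, b j with hB
  have hB0 : B ≠ 0 := Finset.prod_ne_zero_iff.mpr fun j _ => hb j
  choose c hc using fun j => (Finset.dvd_prod_of_mem b (Finset.mem_univ j) : b j ∣ B)
  have hfB (j : Fin M) : f j * B = (a j * c j : H) := by
    have : (B : E) = (b j * c j : H) := congrArg Subtype.val (hc j)
    rw [this]
    push_cast
    rw [← mul_assoc, hab]
  obtain ⟨d, hd⟩ := (hbez.isPrincipal_of_FG (Ideal.span (Set.range fun j => a j * c j))
    (Submodule.fg_span (Set.finite_range _))).principal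
  have hdv (j : Fin M) : ∃ w, a j * c j = d * w := by
    have : a j * c j ∈ Ideal.span (Set.range fun j => a j * c j) := Ideal.subset_span ⟨j, rfl⟩
    rw [hd] at this
    obtain ⟨w, hw⟩ := Ideal.mem_span_singleton'.mp this
    exact ⟨w, by rw [← hw, mul_comm]⟩
  choose v hv using hdv
  have hd0 : d ≠ 0 := by
    rintro rfl
    have := hfB j₀
    rw [hv, zero_mul] at this
    exact (mul_ne_zero hj₀ (Subtype.coe_ne_coe.mpr hB0)) this
  obtain ⟨w, hw⟩ : ∃ w : Fin M → H, w ⬝ᵥ v = 1 := by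
    have : d ∈ Ideal.span (Set.range fun j => a j * c j) := by
      rw [hd]; exact Ideal.mem_span_singleton_self d
    obtain ⟨w, hw⟩ := Ideal.mem_span_range_iff_exists_fun.mp this
    refine ⟨w, mul_left_cancel₀ hd0 ?_⟩
    rw [mul_one, ← hw, dotProduct, Finset.mul_sum]
    exact Finset.sum_congr rfl fun j _ => by rw [hv]; simp only [← hw]; ring
  have hfv (j : Fin M) : f j = (d / B : E) * v j := by
    have hB' : (B : E) ≠ 0 := by simpa using hB0
    field_simp
    rw [hfB, hv]
    push_cast
    ring
  have hsum : ∑ j, f j ^ 2 = (d / B : E) ^ 2 * ((v ⬝ᵥ v : H) : E) := by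
    simp only [hfv, dotProduct, AddSubmonoidClass.coe_finsetSum, Finset.mul_sum]
    exact Finset.sum_congr rfl fun j _ => by push_cast; ring
  rw [hsum]
  refine sq_mul_mem_sumSq _ ?_
  -- a reflection making the complement of the first coordinate a unit
  set i₀ : Fin M := ⟨0, by omega⟩
  set i₁ : Fin M := ⟨1, by omega⟩
  have : Finite {I : Ideal H | I.IsMaximal} := hsemi
  have res (I : {I : Ideal H | I.IsMaximal}) : ∃ p : Fin M → H, p ⬝ᵥ p ∉ I.1 ∧
      ((p ⬝ᵥ p) * v i₀ - 2 * (p ⬝ᵥ v) * p i₀) ^ 2 - (p ⬝ᵥ p) ^ 2 * (v ⬝ᵥ v) ∉ I.1 := by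
    have hI : I.1.IsMaximal := I.2
    let _ : Field (H ⧸ I.1) := Ideal.Quotient.field I.1
    set π := Ideal.Quotient.mk I.1
    have h2I : (2 : H ⧸ I.1) ≠ 0 := by
      have := (h2.map π).ne_zero
      rwa [map_ofNat] at this
    have hvI : π ∘ v ≠ 0 := by
      intro h0
      have := congrArg π hw
      rw [RingHom.map_dotProduct, h0, dotProduct_zero, map_one] at this
      exact zero_ne_one this
    obtain ⟨p, hp1, hp2⟩ := exists_residue_reflection h2I (i₀ := i₀) (i₁ := i₁)
      (by simp [i₀, i₁, Fin.ext_iff]) _ hvI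
    choose P hP using fun j => Ideal.Quotient.mk_surjective (I := I.1) (p j)
    obtain rfl : π ∘ P = p := funext hP
    refine ⟨P, ?_, ?_⟩
    · rw [← Ideal.Quotient.eq_zero_iff_mem, RingHom.map_dotProduct]
      exact hp1
    · rw [← Ideal.Quotient.eq_zero_iff_mem, map_sub, sub_eq_zero]
      simp only [map_pow, map_sub, map_mul, RingHom.map_dotProduct, map_ofNat]
      exact hp2
  choose P hP1 hP2 using res
  have hcop : Pairwise fun I J : {I : Ideal H | I.IsMaximal} => IsCoprime I.1 J.1 := fun I J hIJ =>
    have : J.1.IsMaximal := J.2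
    have : I.1.IsMaximal := I.2
    Ideal.isCoprime_of_isMaximal fun h => hIJ (Subtype.ext h)
  have crt (j : Fin M) : ∃ p : H, ∀ I, p - P I j ∈ I.1 := by
    exact Ideal.exists_forall_sub_mem_ideal hcop fun I => P I j
  choose p hp' using crt
  have hpI (I : {I : Ideal H | I.IsMaximal}) : Ideal.Quotient.mk I.1 ∘ p = Ideal.Quotient.mk I.1 ∘ P I :=
    funext fun j => Ideal.Quotient.eq.mpr (hp' j I)
  have unit_of (z : H) (hz : ∀ I : Ideal H, I.IsMaximal → z ∉ I) : IsUnit z := by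
    by_contra hzu
    obtain ⟨I, hI, hzI⟩ := exists_max_ideal_of_mem_nonunits hzu
    exact hz I hI hzI
  have hQ : IsUnit (p ⬝ᵥ p) := by
    refine unit_of _ fun I hI hz => hP1 ⟨I, hI⟩ ?_
    rw [← Ideal.Quotient.eq_zero_iff_mem, RingHom.map_dotProduct] at hz ⊢
    rwa [← hpI ⟨I, hI⟩]
  have hD : IsUnit (((p ⬝ᵥ p) * v i₀ - 2 * (p ⬝ᵥ v) * p i₀) ^ 2 - (p ⬝ᵥ p) ^ 2 * (v ⬝ᵥ v)) := by
    refine unit_of _ fun I hI hz => hP2 ⟨I, hI⟩ ?_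
    rw [← Ideal.Quotient.eq_zero_iff_mem] at hz ⊢
    have e := congrFun (hpI ⟨I, hI⟩) i₀
    simp only [Function.comp_apply] at e
    simp only [map_sub, map_mul, map_pow, RingHom.map_dotProduct, ← hpI ⟨I, hI⟩, ← e] at hz ⊢
    exact hz
  set z : Fin M → H := (p ⬝ᵥ p) • v - (2 * (p ⬝ᵥ v)) • p with hz
  have hzz : z ⬝ᵥ z = (p ⬝ᵥ p) ^ 2 * (v ⬝ᵥ v) := by
    rw [hz]
    simp only [sub_dotProduct, dotProduct_sub, smul_dotProduct, dotProduct_smul, smul_eq_mul,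
      dotProduct_comm v p]
    ring
  have hzr : (p ⬝ᵥ p) ^ 2 * (v ⬝ᵥ v) - z i₀ ^ 2 = ∑ j : {j // j ≠ i₀}, z j ^ 2 := by
    rw [← hzz, dotProduct, ← Fintype.sum_subtype_add_sum_subtype (fun j => j ≠ i₀)]
    have : ∑ j : {j // ¬ (j ≠ i₀)}, z j * z j = z i₀ ^ 2 := by
      have : Unique {j // ¬ (j ≠ i₀)} := ⟨⟨i₀, by simp⟩, fun j => Subtype.ext (by simpa using j.2)⟩
      rw [Fintype.sum_unique]
      have hdef : (default : {j // ¬ (j ≠ i₀)}).1 = i₀ := by simpa using (default : {j // ¬ (j ≠ i₀)}).2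
      rw [hdef, pow_two]
    rw [this]
    simp [pow_two]
  have key := hp ((p ⬝ᵥ p) ^ 2 * (v ⬝ᵥ v) - z i₀ ^ 2) (by
    rw [← neg_sub]
    exact hD.neg) (by
    rw [hzr]
    exact map_mem_sums H.subtype (sum_mem_sums _))
  have hQ0 : ((p ⬝ᵥ p : H) : E) ≠ 0 := by simpa using hQ.ne_zero
  have := sq_mul_mem_sumSq ((p ⬝ᵥ p : H) : E)⁻¹ (add_mem_sumSq key (sq_mem_sumSq ((z i₀ : H) : E)))
  convert this using 1
  push_cast
  field_simp
  ring

end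

section

open IntermediateField

lemma isFunctionFieldOneVar_of_ratFunc (K E : Type*) [Field K] [Field E] [Algebra K E]
    [Algebra (RatFunc K) E] [IsScalarTower K (RatFunc K) E] [FiniteDimensional (RatFunc K) E] :
    IsFunctionFieldOneVar K E := by
  set x : E := algebraMap (RatFunc K) E RatFunc.X with hx
  have hmem (r : RatFunc K) : algebraMap (RatFunc K) E r ∈ adjoin K {x} := by
    have h : (adjoin K {(RatFunc.X : RatFunc K)}).map (IsScalarTower.toAlgHom K (RatFunc K) E) =
        adjoin K {x} := by
      rw [adjoin_map, Set.image_singleton]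
      rfl
    rw [← h, RatFunc.adjoin_X]
    exact ⟨r, trivial, rfl⟩
  refine ⟨x, ?_, ?_⟩
  · have := (transcendental_algebraMap_iff (R := K)
      (FaithfulSMul.algebraMap_injective (RatFunc K) E)).mpr (RatFunc.transcendental_X (K := K))
    exact this
  · let _ : Algebra (RatFunc K) (adjoin K {x}) :=
      ((algebraMap (RatFunc K) E).codRestrict (adjoin K {x}).toSubring hmem).toAlgebra
    have : IsScalarTower (RatFunc K) (adjoin K {x}) E := IsScalarTower.of_algebraMap_eq' rfl
    exact Module.Finite.of_restrictScalars_finite (RatFunc K) _ _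

lemma IsFunctionFieldOneVar.restrictScalars {L L' E : Type*} [Field L] [Field L'] [Field E]
    [Algebra L L'] [Algebra L' E] [Algebra L E] [IsScalarTower L L' E] [FiniteDimensional L L']
    (h : IsFunctionFieldOneVar L' E) : IsFunctionFieldOneVar L E := by
  obtain ⟨x, hx, hfin⟩ := h
  refine ⟨x, hx.restrictScalars (FaithfulSMul.algebraMap_injective L L'), ?_⟩
  set F := adjoin L {x}
  let b := Module.finBasis L L'
  set S : Set E := Set.range fun i => algebraMap L' E (b i)
  have : Finite S := Set.finite_range _
  set M := adjoin F S
  have hM : FiniteDimensional F M := finiteDimensional_adjoin fun y hy => by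
    obtain ⟨i, rfl⟩ := hy
    exact ((Algebra.IsIntegral.isIntegral (R := L) (b i)).map
      (IsScalarTower.toAlgHom L L' E)).tower_top
  have hL' (y : L') : algebraMap L' E y ∈ M := by
    rw [← b.sum_repr y, map_sum]
    refine sum_mem fun i _ => ?_
    rw [Algebra.smul_def, map_mul, ← IsScalarTower.algebraMap_apply]
    refine mul_mem ?_ (subset_adjoin _ _ ⟨i, rfl⟩)
    rw [IsScalarTower.algebraMap_apply L F E]
    exact M.algebraMap_mem _
  have hxM : x ∈ M := M.algebraMap_mem (⟨x, mem_adjoin_simple_self L x⟩ : F)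
  have hle (z : E) (hz : z ∈ adjoin L' {x}) : z ∈ M := by
    induction hz using adjoin_induction with
    | mem z hz => rw [Set.mem_singleton_iff.mp hz]; exact hxM
    | algebraMap z => exact hL' z
    | add _ _ _ _ h1 h2 => exact add_mem h1 h2
    | inv _ _ h1 => exact inv_mem h1
    | mul _ _ _ _ h1 h2 => exact mul_mem h1 h2
  let _ : Algebra (adjoin L' {x}) M :=
    ((algebraMap (adjoin L' {x}) E).codRestrict M.toSubring fun z => hle z z.2).toAlgebra
  have : IsScalarTower (adjoin L' {x}) M E := IsScalarTower.of_algebraMap_eq' rfl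
  have : Module.Finite M E := Module.Finite.of_restrictScalars_finite (adjoin L' {x}) M E
  exact Module.Finite.trans M E

/-- All sums of squares in finite extensions of `k` are sums of `N` squares. -/
def FinitePyth (N : ℕ) (k : Type u) [Field k] : Prop :=
  ∀ (E : Type u) [Field E] [Algebra k E] [FiniteDimensional k E], sums E ⊆ sumSq E N

/-- All sums of squares in function fields in one variable over `L` are sums of `N` squares. -/
def FunctionPyth (N : ℕ) (L : Type u) [Field L] : Prop :=
  ∀ (E : Type u) [Field E] [Algebra L E], IsFunctionFieldOneVar L E → sums E ⊆ sumSq E N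

lemma IsPnField.functionPyth {n : ℕ} {K : Type u} [Field K] (h : IsPnField n K) :
    FunctionPyth (2 ^ (n + 1) + 1) K := by
  intro E _ _ hE
  by_cases hlt : ((2 ^ (n + 1) : ℕ) : ℕ∞) < pyth E
  · exact (h.2 E hE hlt).sums_subset
  · exact ((pyth_le_iff _).mp (not_lt.mp hlt)).trans (sumSq_mono (Nat.le_succ _))

lemma FunctionPyth.of_finite {N : ℕ} {L L' : Type u} [Field L] [Field L'] [Algebra L L']
    [FiniteDimensional L L'] (h : FunctionPyth N L) : FunctionPyth N L' := by
  intro E _ _ hE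
  let _ : Algebra L E := ((algebraMap L' E).comp (algebraMap L L')).toAlgebra
  have : IsScalarTower L L' E := IsScalarTower.of_algebraMap_eq' rfl
  exact h E hE.restrictScalars

lemma FunctionPyth.ratFunc {N : ℕ} {L : Type u} [Field L] (h : FunctionPyth N L) :
    FinitePyth N (RatFunc L) := by
  intro E _ _ _
  let _ : Algebra L E := ((algebraMap (RatFunc L) E).comp (algebraMap L (RatFunc L))).toAlgebra
  have : IsScalarTower L (RatFunc L) E := IsScalarTower.of_algebraMap_eq' rfl
  exact h E (isFunctionFieldOneVar_of_ratFunc L E)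

/-- A sum of `N + 1` squares vanishing nontrivially makes `-1` a sum of `N` squares. -/
lemma neg_one_mem_sumSq_of_isotropic {E : Type*} [Field E] {N : ℕ} (a : Fin (N + 1) → E)
    (ha : a ≠ 0) (h : ∑ i, a i ^ 2 = 0) : (-1 : E) ∈ sumSq E N := by
  obtain ⟨i, hi⟩ := Function.ne_iff.mp ha
  rw [Fin.sum_univ_succAbove _ i] at h
  refine ⟨fun j => a (i.succAbove j) / a i, ?_⟩
  have hi : a i ≠ 0 := hi
  simp only [div_pow, ← Finset.sum_div]
  rw [eq_div_iff (pow_ne_zero 2 hi)]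
  linear_combination -h

open Polynomial in
lemma mem_sumSq_of_polynomial {E : Type*} [Field E] (h2 : (2 : E) ≠ 0) {N : ℕ} {c : E} {d : E[X]}
    (hd : d ≠ 0) (h : C c * d ^ 2 ∈ sumSq E[X] (N + 1)) : c ∈ sumSq E (N + 1) := by
  induction hn : d.natDegree using Nat.strong_induction_on generalizing d with
  | _ m ih =>
    obtain ⟨f, hf⟩ := h
    have h0 := congrArg (Polynomial.eval 0) hf
    simp only [eval_mul, eval_C, eval_pow, eval_finsetSum] at h0
    by_cases hd0 : d.eval 0 = 0
    · by_cases hf0 : (fun i => (f i).eval 0) = 0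
      · obtain ⟨d', rfl⟩ : X ∣ d := by rwa [X_dvd_iff, coeff_zero_eq_eval_zero]
        have hf' (i) : ∃ f', f i = X * f' := by
          have : X ∣ f i := by
            rw [X_dvd_iff, coeff_zero_eq_eval_zero]
            exact congrFun hf0 i
          exact this
        choose f' hf' using hf'
        have hd' : d' ≠ 0 := right_ne_zero_of_mul hd
        refine ih d'.natDegree ?_ hd' ⟨f', ?_⟩ rfl
        · rw [← hn, natDegree_X_mul hd']; omega
        · have hX : (X : E[X]) ^ 2 ≠ 0 := pow_ne_zero _ X_ne_zero
          apply mul_left_cancel₀ hX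
          rw [Finset.mul_sum]
          simp only [hf', mul_pow] at hf
          linear_combination hf
      · refine mem_sumSq_of_neg_one_mem h2 (neg_one_mem_sumSq_of_isotropic _ hf0 ?_) c
        rw [← h0, hd0]
        ring
    · refine ⟨fun i => (f i).eval 0 / d.eval 0, ?_⟩
      simp only [div_pow, ← Finset.sum_div]
      rw [← h0]
      field_simp

open Polynomial in
lemma FunctionPyth.finitePyth {N : ℕ} {L : Type u} [Field L] (h2 : (2 : L) ≠ 0)
    (h : FunctionPyth (N + 1) L) : FinitePyth (N + 1) L := by
  intro E _ _ _ c hc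
  have h2' : (2 : E) ≠ 0 := by
    have := (map_ne_zero_iff _ (FaithfulSMul.algebraMap_injective L E)).mpr h2
    rwa [map_ofNat] at this
  obtain ⟨f, hf⟩ := (FunctionPyth.of_finite (L' := E) h).ratFunc (RatFunc E)
    (map_mem_sums (RatFunc.C (K := E)) hc)
  obtain ⟨b, hb⟩ := IsLocalization.exist_integer_multiples_of_finite (nonZeroDivisors E[X]) f
  choose g hg using hb
  refine mem_sumSq_of_polynomial h2' (nonZeroDivisors.ne_zero b.2) ⟨g, ?_⟩
  apply IsFractionRing.injective E[X] (RatFunc E)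
  rw [map_sum, map_mul, map_pow]
  simp only [map_pow, hg, Algebra.smul_def, mul_pow, ← Finset.mul_sum]
  rw [← hf, RatFunc.algebraMap_C, mul_comm]

end

section

open Polynomial

/-- Every monic polynomial equation splits off, by an idempotent, the part on which the root is
a unit from a part on which `1` plus the root is a unit. -/
def Hens (S : Type*) [CommRing S] : Prop :=
  ∀ μ : S[X], μ.Monic → ∃ e : AdjoinRoot μ, e * e = e ∧ AdjoinRoot.root μ ∣ e ∧
    (1 + AdjoinRoot.root μ) ∣ (1 - e)

lemma Hens.of_field (k : Type*) [Field k] : Hens k := fun μ hμ => by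
  obtain ⟨ν, hν, hdvd⟩ := Polynomial.exists_eq_pow_rootMultiplicity_mul_and_not_dvd μ hμ.ne_zero 0
  set a := μ.rootMultiplicity 0
  rw [C_0, sub_zero] at hν hdvd
  have hcop : IsCoprime ((X : k[X]) ^ (a + 1)) ν :=
    IsCoprime.pow_left ((Polynomial.irreducible_X.coprime_iff_not_dvd).mpr hdvd)
  obtain ⟨u, v, huv⟩ := hcop
  set r := AdjoinRoot.root μ with hr
  set e : AdjoinRoot μ := AdjoinRoot.mk μ (u * X ^ (a + 1)) with he
  have h0 : (1 - e) * r ^ a = 0 := by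
    have : AdjoinRoot.mk μ (v * ν * X ^ a) = 0 := by
      rw [AdjoinRoot.mk_eq_zero, hν]
      exact ⟨v, by ring⟩
    rw [he, hr, ← AdjoinRoot.mk_X, ← map_one (AdjoinRoot.mk μ), ← map_sub, ← map_pow, ← map_mul,
      ← this]
    congr 1
    rw [← huv]
    ring
  have her : e = AdjoinRoot.mk μ u * r ^ (a + 1) := by rw [he, map_mul, map_pow, AdjoinRoot.mk_X]
  refine ⟨e, ?_, ?_, ?_⟩
  · have : (1 - e) * e = 0 := by
      nth_rewrite 2 [her]
      linear_combination (AdjoinRoot.mk μ u * r) * h0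
    linear_combination -this
  · exact ⟨AdjoinRoot.mk μ u * r ^ a, by rw [her]; ring⟩
  · refine ⟨(∑ i ∈ Finset.range a, (-r) ^ i) * (1 - e), ?_⟩
    have := mul_neg_geom_sum (-r) a
    rw [sub_neg_eq_add, neg_pow] at this
    linear_combination (-(1 - e)) * this + (-1) ^ a * h0

lemma xComplete_powerSeries (S : Type*) [CommRing S] :
    XComplete (PowerSeries.X : PowerSeries S) (PowerSeries S) :=
  XComplete.of_coeff (fun _ => ⊤) (fun _ _ _ => le_rfl) (AddMonoidHom.id _) Function.injective_id
    (fun _ => rfl) fun p => ⟨fun _ _ => trivial, fun _ => ⟨p, rfl⟩⟩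

lemma Hens.powerSeries {S : Type*} [CommRing S] (h : Hens S) (h2 : ∃ r : S, r * 2 = 1) :
    Hens (PowerSeries S) := fun μ hμ => by
  obtain ⟨r₀, hr₀⟩ := h2
  set x : PowerSeries S := PowerSeries.X with hx
  set cc : PowerSeries S →+* S := PowerSeries.constantCoeff with hcc
  have hccs : Function.Surjective cc := fun s => ⟨PowerSeries.C s, by simp [hcc]⟩
  have hA : XComplete x (AdjoinRoot μ) := (xComplete_powerSeries S).adjoinRoot hμ
  have hR : ∃ r : PowerSeries S, r * 2 = 1 :=
    ⟨PowerSeries.C r₀, by rw [← map_ofNat PowerSeries.C 2, ← map_mul, hr₀, map_one]⟩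
  let π : AdjoinRoot μ →+* AdjoinRoot (μ.map cc) := AdjoinRoot.map cc μ (μ.map cc) dvd_rfl
  have hπmk (p : Polynomial (PowerSeries S)) : π (AdjoinRoot.mk μ p) = AdjoinRoot.mk _ (p.map cc) := by
    simp only [π]
    rw [AdjoinRoot.map, AdjoinRoot.lift_mk, ← AdjoinRoot.aeval_eq, aeval_def, eval₂_map]
    rfl
  have hπs : Function.Surjective π := fun z => by
    obtain ⟨p, rfl⟩ := AdjoinRoot.mk_surjective z
    obtain ⟨p', rfl⟩ := Polynomial.map_surjective cc hccs p
    exact ⟨_, hπmk p'⟩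
  have hπk (z : AdjoinRoot μ) (hz : π z = 0) : ∃ y, z = x • y := by
    obtain ⟨p, rfl⟩ := AdjoinRoot.mk_surjective z
    rw [hπmk, AdjoinRoot.mk_eq_zero] at hz
    obtain ⟨q, hq⟩ := hz
    obtain ⟨q', rfl⟩ := Polynomial.map_surjective cc hccs q
    have : C x ∣ p - μ * q' := by
      rw [Polynomial.C_dvd_iff_dvd_coeff]
      intro i
      rw [hx, PowerSeries.X_dvd_iff]
      have := congrArg (coeff · i) hq
      simp only [← Polynomial.map_mul, coeff_map] at this
      rw [coeff_sub, map_sub, sub_eq_zero]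
      exact this
    obtain ⟨y, hy⟩ := this
    refine ⟨AdjoinRoot.mk μ y, ?_⟩
    rw [Algebra.smul_def, AdjoinRoot.algebraMap_eq, ← AdjoinRoot.mk_C, ← map_mul, ← hy, map_sub,
      map_mul, AdjoinRoot.mk_self, zero_mul, sub_zero]
  have hπr : π (AdjoinRoot.root μ) = AdjoinRoot.root (μ.map cc) := by
    rw [← AdjoinRoot.mk_X, hπmk, map_X, AdjoinRoot.mk_X]
  obtain ⟨e, hee, ⟨p, hp⟩, ⟨p₁, hp₁⟩⟩ := h (μ.map cc) (hμ.map cc)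
  obtain ⟨a, rfl⟩ := hπs e
  obtain ⟨p, rfl⟩ := hπs p
  obtain ⟨p₁, rfl⟩ := hπs p₁
  obtain ⟨η, hη⟩ := hπk (a * a - a) (by rw [map_sub, map_mul, hee, sub_self])
  obtain ⟨ξ, hξ⟩ := hπk (a - AdjoinRoot.root μ * p) (by
    rw [map_sub, map_mul, hπr, ← hp, sub_self])
  obtain ⟨ξ₁, hξ₁⟩ := hπk (1 - a - (1 + AdjoinRoot.root μ) * p₁) (by
    rw [map_sub, map_sub, map_mul, map_add, map_one, hπr, ← hp₁, sub_self])
  obtain ⟨z, hz, -⟩ := hA.exists_sq hR (4 * η)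
  obtain ⟨w, hw, -⟩ := hA.exists_mul_one_add z
  obtain ⟨r, hr⟩ := hR
  set ρ : AdjoinRoot μ := algebraMap _ _ r
  have hρ : ρ * 2 = 1 := by
    rw [← map_ofNat (algebraMap (PowerSeries S) (AdjoinRoot μ)) 2, ← map_mul, hr, map_one]
  simp only [Algebra.smul_def] at *
  set y : AdjoinRoot μ := algebraMap _ _ x
  set t := AdjoinRoot.root μ
  set f : AdjoinRoot μ := ρ * (1 + (2 * a - 1) * (1 + y * w)) with hf
  have huu : ((2 * a - 1) * (1 + y * w)) ^ 2 = 1 := by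
    linear_combination (4 * (1 + y * w) ^ 2) * hη - (1 + y * w) ^ 2 * hz +
      ((1 + y * z) * (1 + y * w) + 1) * hw
  have hff : f * f = f := by
    rw [hf]
    linear_combination ρ ^ 2 * huu + (ρ * (1 + (2 * a - 1) * (1 + y * w))) * hρ
  have hfa : f = a + y * (ρ * (2 * a - 1) * w) := by
    rw [hf]; linear_combination a * hρ
  have key (t p ζ f : AdjoinRoot μ) (hff : f * f = f) (hfp : f = t * p + y * ζ) : t ∣ f := by
    obtain ⟨v, hv, -⟩ := hA.exists_mul_one_add (-ζ)
    simp only [Algebra.smul_def] at hv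
    refine ⟨f * p * (1 + y * v), ?_⟩
    linear_combination (f * (1 + y * v)) * hfp - f * hv - (1 + y * v) * hff
  refine ⟨f, hff, key _ p (ξ + ρ * (2 * a - 1) * w) f hff ?_,
    key _ p₁ (ξ₁ - ρ * (2 * a - 1) * w) (1 - f) (by linear_combination hff) ?_⟩
  · rw [hfa]; linear_combination hξ
  · rw [hfa]; linear_combination hξ₁

end

section

open Polynomial

section

variable {Ω : Type*} [CommRing Ω]

lemma Hens.exists_inverse (h : Hens Ω) {E : Type*} [CommRing E] [IsDomain E] [Algebra Ω E] {α : E}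
    (hα : IsIntegral Ω α) : ∃ β : E, IsIntegral Ω β ∧ (α * β = 1 ∨ (1 + α) * β = 1) := by
  obtain ⟨μ, hμ, h0⟩ := hα
  obtain ⟨e, hee, ⟨p, hp⟩, ⟨q, hq⟩⟩ := h μ hμ
  have : Module.Finite Ω (AdjoinRoot μ) := hμ.finite_adjoinRoot
  let φ : AdjoinRoot μ →ₐ[Ω] E := AdjoinRoot.liftAlgHom μ (Algebra.ofId Ω E) α h0
  have hφr : φ (AdjoinRoot.root μ) = α := AdjoinRoot.liftAlgHom_root ..
  have hint (z : AdjoinRoot μ) : IsIntegral Ω (φ z) := (Algebra.IsIntegral.isIntegral z).map φ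
  have h1 : φ e = 0 ∨ φ e = 1 := by
    have := congrArg φ hee
    rw [map_mul] at this
    have : φ e * (φ e - 1) = 0 := by rw [mul_sub, this]; ring
    rcases mul_eq_zero.mp this with h | h
    · exact Or.inl h
    · exact Or.inr (sub_eq_zero.mp h)
  rcases h1 with h1 | h1
  · refine ⟨φ q, hint q, Or.inr ?_⟩
    have := congrArg φ hq
    rw [map_sub, map_one, h1, map_mul, map_add, map_one, hφr, sub_zero] at this
    exact this.symm
  · refine ⟨φ p, hint p, Or.inl ?_⟩
    have := congrArg φ hp
    rw [map_mul, h1, hφr] at this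
    exact this.symm

lemma Hens.isLocalRing (h : Hens Ω) {B : Type*} [CommRing B] [IsDomain B] [Algebra Ω B]
    [Algebra.IsIntegral Ω B] : IsLocalRing B := by
  refine IsLocalRing.of_isUnit_or_isUnit_one_sub_self fun a => ?_
  obtain ⟨β, -, hβ | hβ⟩ := h.exists_inverse (Algebra.IsIntegral.isIntegral (R := Ω) (-a))
  · exact Or.inl (isUnit_iff_exists_inv.mpr ⟨-β, by linear_combination hβ⟩)
  · exact Or.inr (isUnit_iff_exists_inv.mpr ⟨β, by linear_combination hβ⟩)

lemma Hens.isSquare_one_add (h : Hens Ω) (h2 : ∃ r : Ω, r * 2 = 1) {F : Type*} [Field F]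
    [Algebra Ω F] {m : F} (hm : IsIntegral Ω m) (hmu : ¬ ∃ β : F, IsIntegral Ω β ∧ m * β = 1) :
    IsSquare (1 + m) := by
  obtain ⟨r, hr⟩ := h2
  set ρ : F := algebraMap Ω F r with hρ
  have hρ2 : ρ * 2 = 1 := by
    rw [hρ, ← map_ofNat (algebraMap Ω F) 2, ← map_mul, hr, map_one]
  have hρi : IsIntegral Ω ρ := isIntegral_algebraMap
  have h20 : (2 : F) ≠ 0 := fun h => by simp [h] at hρ2
  set p : F[X] := X ^ 2 + X - C (ρ ^ 2 * m) with hp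
  have hpm : p.Monic := by rw [hp]; monicity!
  have hpd : p.natDegree = 2 := by rw [hp]; compute_degree!
  by_contra hsq
  have hroot (a : F) : p.eval a ≠ 0 := fun ha => hsq ⟨1 + 2 * a, by
    simp [hp] at ha
    linear_combination -4 * ha - (2 * ρ + 1) * m * hρ2⟩
  have hirr : Irreducible p := by
    rw [hpm.irreducible_iff_roots_eq_zero_of_degree_le_three (by omega) (by omega)]
    refine Multiset.eq_zero_of_forall_notMem fun a ha => hroot a ?_
    exact (mem_roots'.mp ha).2
  have : Fact (Irreducible p) := ⟨hirr⟩
  set α : AdjoinRoot p := AdjoinRoot.root p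
  have hα : α ^ 2 + α = algebraMap F _ (ρ ^ 2 * m) := by
    have : eval₂ (algebraMap F (AdjoinRoot p)) α p = 0 := AdjoinRoot.eval₂_root p
    simp only [hp, eval₂_sub, eval₂_add, eval₂_pow, eval₂_X, eval₂_C] at this
    exact sub_eq_zero.mp this
  have hαi : IsIntegral Ω α := by
    have h1 : IsIntegral Ω (α ^ 2 + α) := by
      rw [hα]
      exact ((hρi.pow 2).mul hm).algebraMap
    have h2 : IsIntegral Ω (2 * α + 1) := by
      refine IsIntegral.of_pow two_pos ?_
      rw [show (2 * α + 1) ^ 2 = (4 : ℕ) • (α ^ 2 + α) + 1 by simp; ring]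
      exact (h1.nsmul 4).add isIntegral_one
    have h3 : algebraMap F (AdjoinRoot p) ρ * 2 = 1 := by
      rw [← map_ofNat (algebraMap F (AdjoinRoot p)) 2, ← map_mul, hρ2, map_one]
    rw [show α = algebraMap F (AdjoinRoot p) ρ * (2 * α + 1 - 1) by linear_combination -α * h3]
    exact hρi.algebraMap.mul (h2.sub isIntegral_one)
  let σ : AdjoinRoot p →ₐ[F] AdjoinRoot p := AdjoinRoot.liftAlgHom p (Algebra.ofId _ _) (-1 - α) (by
    have : eval₂ (algebraMap F (AdjoinRoot p)) (-1 - α) p = 0 := by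
      simp only [hp, eval₂_sub, eval₂_add, eval₂_pow, eval₂_X, eval₂_C, ← hα]
      ring
    exact this)
  have hσα : σ α = -1 - α := AdjoinRoot.liftAlgHom_root ..
  have key (a b : AdjoinRoot p) (ha : IsIntegral Ω a) (hb : IsIntegral Ω b)
      (hab : (α ^ 2 + α) * (a * b) = 1) : False := by
    rw [hα] at hab
    have hm0 : m ≠ 0 := by
      rintro rfl
      simp at hab
    refine hmu ⟨m⁻¹, ?_, mul_inv_cancel₀ hm0⟩
    rw [← isIntegral_algebraMap_iff (algebraMap F (AdjoinRoot p)).injective]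
    have : algebraMap F (AdjoinRoot p) m⁻¹ = algebraMap F (AdjoinRoot p) (ρ ^ 2) * (a * b) := by
      have h1 : algebraMap F (AdjoinRoot p) m * algebraMap F (AdjoinRoot p) m⁻¹ = 1 := by
        rw [← map_mul, mul_inv_cancel₀ hm0, map_one]
      rw [map_mul] at hab
      linear_combination (-algebraMap F (AdjoinRoot p) m⁻¹) * hab +
        algebraMap F (AdjoinRoot p) (ρ ^ 2) * (a * b) * h1
    rw [this]
    exact (hρi.pow 2).algebraMap.mul (ha.mul hb)
  obtain ⟨β, hβi, hβ⟩ := h.exists_inverse hαi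
  have hσi : IsIntegral Ω (σ β) := hβi.map (σ.restrictScalars Ω)
  rcases hβ with hβ | hβ
  · have := congrArg σ hβ
    rw [map_mul, hσα, map_one] at this
    refine key β (-σ β) hβi hσi.neg ?_
    linear_combination this + (-1 - α) * σ β * hβ
  · have := congrArg σ hβ
    rw [map_mul, map_add, hσα, map_one] at this
    refine key β (-σ β) hβi hσi.neg ?_
    linear_combination this - α * σ β * hβ
end

end

section

open Polynomial

/-- In an integrally closed local domain, the root of an equation with a unit coefficient is an
element of the ring or the inverse of one. -/
lemma mem_or_inv_mem_of_relation {B F : Type*} [CommRing B] [IsLocalRing B] [Field F] [Algebra B F]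
    (hB : ∀ z : F, IsIntegral B z → ∃ b, algebraMap B F b = z) (z : F) (d : ℕ) :
    ∀ c : ℕ → B, ∑ i ∈ Finset.range (d + 1), algebraMap B F (c i) * z ^ i = 0 →
      (∃ i ≤ d, IsUnit (c i)) →
      (∃ b, algebraMap B F b = z) ∨ ∃ b, algebraMap B F b * z = 1 := by
  induction d with
  | zero =>
    rintro c hc ⟨i, hi, hu⟩
    obtain rfl : i = 0 := by omega
    rw [zero_add, Finset.sum_range_one, pow_zero, mul_one] at hc
    exact absurd hc (hu.map (algebraMap B F)).ne_zero
  | succ d ih =>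
    rintro c hc ⟨i, hi, hu⟩
    obtain ⟨b, hb⟩ : ∃ b, algebraMap B F b = algebraMap B F (c (d + 1)) * z := by
      by_cases h0 : c (d + 1) = 0
      · exact ⟨0, by rw [h0]; simp⟩
      refine hB _ ?_
      set p : B[X] := ∑ i ∈ Finset.range (d + 2), C (c i) * X ^ i with hp
      have hcoeff (j : ℕ) : p.coeff j = if j < d + 2 then c j else 0 := by
        simp [hp, coeff_C_mul, coeff_X_pow]
      have hdeg : p.natDegree = d + 1 := by
        refine natDegree_eq_of_le_of_coeff_ne_zero ?_ (by rw [hcoeff, if_pos (by omega)]; exact h0)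
        refine natDegree_le_iff_coeff_eq_zero.mpr fun j hj => ?_
        rw [hcoeff, if_neg (by omega)]
      have := isIntegral_leadingCoeff_smul p z (by
        rw [hp, map_sum, ← hc]
        simp)
      rwa [leadingCoeff, hdeg, hcoeff, if_pos (by omega), Algebra.smul_def] at this
    have hc' : ∑ i ∈ Finset.range (d + 1),
        algebraMap B F (if i = d then c d + b else c i) * z ^ i = 0 := by
      rw [Finset.sum_range_succ, Finset.sum_range_succ] at hc
      rw [Finset.sum_range_succ, if_pos rfl, map_add, hb, ← hc]
      rw [Finset.sum_congr rfl (g := fun i => algebraMap B F (c i) * z ^ i) fun i hi => by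
        rw [if_neg (Finset.mem_range.mp hi).ne]]
      ring
    have ih' := ih _ hc'
    rcases Nat.lt_or_ge i d with hid | hid
    · exact ih' ⟨i, hid.le, by rwa [if_neg hid.ne]⟩
    by_cases ha : IsUnit (c (d + 1))
    · obtain ⟨v, hv⟩ := ha.exists_left_inv
      refine Or.inl ⟨v * b, ?_⟩
      rw [map_mul, hb, ← mul_assoc, ← map_mul, hv, map_one, one_mul]
    obtain rfl : i = d := by
      rcases Nat.eq_or_lt_of_le hid with h | h
      · exact h.symm
      · obtain rfl : i = d + 1 := by omega
        exact absurd hu ha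
    by_cases hbu : IsUnit b
    · obtain ⟨v, hv⟩ := hbu.exists_left_inv
      refine Or.inr ⟨v * c (i + 1), ?_⟩
      rw [map_mul, mul_assoc, ← hb, ← map_mul, hv, map_one]
    · refine ih' ⟨i, le_rfl, ?_⟩
      rw [if_pos rfl]
      by_contra hcon
      have := IsLocalRing.nonunits_add hcon (b := -b) (by rwa [mem_nonunits_iff, IsUnit.neg_iff])
      rw [add_neg_cancel_right] at this
      exact this hu

lemma exists_dvd_of_relation {B F : Type*} [CommRing B] [IsLocalRing B] [Field F] [Algebra B F]
    (hB : ∀ z : F, IsIntegral B z → ∃ b, algebraMap B F b = z) (a b : F) (d : ℕ) (c : ℕ → B)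
    (hc : ∑ i ∈ Finset.range (d + 1), algebraMap B F (c i) * a ^ i * b ^ (d - i) = 0)
    (hu : ∃ i ≤ d, IsUnit (c i)) :
    (∃ r, a = algebraMap B F r * b) ∨ ∃ r, b = algebraMap B F r * a := by
  by_cases hb : b = 0
  · exact Or.inr ⟨0, by rw [hb]; simp⟩
  rcases mem_or_inv_mem_of_relation hB (a / b) d c (by
    have : ∀ i ∈ Finset.range (d + 1), algebraMap B F (c i) * (a / b) ^ i =
        (algebraMap B F (c i) * a ^ i * b ^ (d - i)) * (b ^ d)⁻¹ := fun i hi => by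
      rw [Finset.mem_range] at hi
      rw [div_pow]
      nth_rewrite 2 [← Nat.sub_add_cancel (show i ≤ d by omega)]
      rw [pow_add]
      field_simp
    rw [Finset.sum_congr rfl this, ← Finset.sum_mul, hc, zero_mul]) hu with ⟨r, hr⟩ | ⟨r, hr⟩
  · exact Or.inl ⟨r, by rw [hr]; field_simp⟩
  · refine Or.inr ⟨r, ?_⟩
    field_simp at hr
    exact hr.symm

lemma exists_common_divisor {B F : Type*} [CommRing B] [CommRing F] [Algebra B F] {M : ℕ}
    (hM : 0 < M) (f : Fin M → F) (h : ∀ i k, (∃ r, f i = algebraMap B F r * f k) ∨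
      ∃ r, f k = algebraMap B F r * f i) :
    ∃ k, ∃ c : Fin M → B, ∀ i, f i = algebraMap B F (c i) * f k := by
  have : Nonempty (Fin M) := ⟨⟨0, hM⟩⟩
  suffices ∃ k, ∀ i, ∃ r, f i = algebraMap B F r * f k by
    obtain ⟨k, hk⟩ := this
    choose c hc using hk
    exact ⟨k, c, hc⟩
  have : ∀ s : Finset (Fin M), s.Nonempty → ∃ k, ∀ i ∈ s, ∃ r, f i = algebraMap B F r * f k := by
    intro s hs
    induction hs using Finset.Nonempty.cons_induction with
    | singleton a => exact ⟨a, fun i hi => ⟨1, by rw [Finset.mem_singleton.mp hi]; simp⟩⟩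
    | cons a s ha hs ih =>
      obtain ⟨k, hk⟩ := ih
      rcases h a k with hr | ⟨r, hr⟩
      · exact ⟨k, fun i hi => by
          rcases Finset.mem_cons.mp hi with rfl | hi
          · exact hr
          · exact hk i hi⟩
      · refine ⟨a, fun i hi => ?_⟩
        rcases Finset.mem_cons.mp hi with rfl | hi
        · exact ⟨1, by simp⟩
        · obtain ⟨t, ht⟩ := hk i hi
          exact ⟨t * r, by rw [ht, hr, map_mul, mul_assoc]⟩
  obtain ⟨k, hk⟩ := this Finset.univ Finset.univ_nonempty
  exact ⟨k, fun i => hk i (Finset.mem_univ i)⟩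

theorem mem_sumSq_of_relations {k : ℕ} (hk : 1 ≤ k) {Ω : Type u} [CommRing Ω] [IsLocalRing Ω]
    (hΩ : Hens Ω) (h2 : ∃ r : Ω, r * 2 = 1)
    (hp : FinitePyth (2 ^ k + 1) (IsLocalRing.ResidueField Ω)) {F : Type u} [Field F] [Algebra Ω F]
    [FaithfulSMul Ω F] {M : ℕ} (f : Fin M → F)
    (hf : ∀ i j, ∃ (d : ℕ) (c : ℕ → Ω), (∃ e ≤ d, IsUnit (c e)) ∧
      ∑ e ∈ Finset.range (d + 1), algebraMap Ω F (c e) * f i ^ e * f j ^ (d - e) = 0) :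
    ∑ i, f i ^ 2 ∈ sumSq F (2 ^ k + 1) := by
  set N := 2 ^ k + 1 with hN
  let B := integralClosure Ω F
  have : IsLocalRing B := hΩ.isLocalRing
  have : FaithfulSMul Ω B := by
    rw [faithfulSMul_iff_algebraMap_injective]
    intro a b hab
    exact FaithfulSMul.algebraMap_injective Ω F (congrArg (algebraMap B F) hab)
  have hB (z : F) (hz : IsIntegral B z) : ∃ b, algebraMap B F b = z :=
    ⟨⟨z, isIntegral_trans (R := Ω) (A := B) z hz⟩, rfl⟩
  have hsq (m : B) (hm : ¬ IsUnit m) : IsSquare (1 + (m : F)) := by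
    refine hΩ.isSquare_one_add h2 m.2 ?_
    rintro ⟨β, hβ, h⟩
    exact hm (isUnit_iff_exists_inv.mpr ⟨⟨β, hβ⟩, Subtype.ext h⟩)
  have hF2 : (2 : F) ≠ 0 := by
    obtain ⟨r, hr⟩ := h2
    intro h
    have := congrArg (algebraMap Ω F) hr
    rw [map_mul, map_ofNat, h, mul_zero, map_one] at this
    exact zero_ne_one this
  have hlift (a : B) (ha : IsUnit a) (hr : IsLocalRing.residue B a ∈ sums _) :
      (a : F) ∈ sumSq F N := by
    obtain ⟨l, y, hy⟩ := mem_sums.mp hr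
    let κ := IsLocalRing.ResidueField Ω
    let E := IntermediateField.adjoin κ (Set.range y)
    have hfin : FiniteDimensional κ E := by
      refine IntermediateField.finiteDimensional_adjoin fun x _ => ?_
      obtain ⟨b, rfl⟩ := IsLocalRing.residue_surjective x
      have h1 : IsIntegral Ω (algebraMap B (IsLocalRing.ResidueField B) b) :=
        (Algebra.IsIntegral.isIntegral (R := Ω) b).algebraMap
      exact h1.tower_top
    have hmem (i : Fin l) : y i ∈ E := IntermediateField.subset_adjoin _ _ ⟨i, rfl⟩
    have h1 : ∑ i, (⟨y i, hmem i⟩ : E) ^ 2 ∈ sums E := sum_mem_sums _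
    obtain ⟨v, hv⟩ := hp E h1
    choose w hw using fun i => IsLocalRing.residue_surjective (v i : IsLocalRing.ResidueField B)
    have h2 : IsLocalRing.residue B a = IsLocalRing.residue B (∑ i, w i ^ 2) := by
      rw [hy, map_sum]
      have := congrArg (algebraMap E (IsLocalRing.ResidueField B)) hv
      simp only [map_sum, map_pow] at this ⊢
      simp only [hw]
      exact this
    obtain ⟨a', ha'⟩ := ha.exists_right_inv
    obtain ⟨s, hs⟩ := hsq (a' * (∑ i, w i ^ 2 - a)) (fun hu => by
      have := (IsLocalRing.residue_ne_zero_iff_isUnit _).mpr hu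
      rw [map_mul, map_sub, h2, sub_self, mul_zero] at this
      exact this rfl)
    have hs0 : s ≠ 0 := by
      rintro rfl
      have h3 : IsLocalRing.residue B (1 + a' * (∑ i, w i ^ 2 - a)) = 0 := by
        rw [← map_zero (IsLocalRing.residue B)]
        congr 1
        refine Subtype.ext ?_
        rw [mul_zero] at hs
        exact hs
      rw [map_add, map_one, map_mul, map_sub, h2, sub_self, mul_zero, add_zero] at h3
      exact one_ne_zero h3
    have ha1 : (a : F) * a' = 1 := congrArg (algebraMap B F) ha'
    have h3 : (a : F) = s⁻¹ ^ 2 * ∑ i, (w i : F) ^ 2 := by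
      have h4 : ((a' * (∑ i, w i ^ 2 - a) : B) : F) = a' * (∑ i, (w i : F) ^ 2 - a) := by
        push_cast
        rfl
      rw [h4] at hs
      field_simp
      linear_combination (∑ i, (w i : F) ^ 2 - a) * ha1 - (a : F) * hs
    rw [h3]
    exact sq_mul_mem_sumSq _ ⟨_, rfl⟩
  rcases Nat.eq_zero_or_pos M with rfl | hM
  · simpa using zero_mem_sumSq N
  obtain ⟨k₀, c, hc⟩ := exists_common_divisor (B := B) hM f fun i j => by
    obtain ⟨d, c, ⟨e, he, hu⟩, hr⟩ := hf i j
    exact exists_dvd_of_relation hB (f i) (f j) d (fun i => algebraMap Ω B (c i)) hr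
      ⟨e, he, hu.map _⟩
  have hsum : ∑ i, f i ^ 2 = f k₀ ^ 2 * ((∑ i, c i ^ 2 : B) : F) := by
    rw [show ((∑ i, c i ^ 2 : B) : F) = algebraMap B F (∑ i, c i ^ 2) from rfl, map_sum,
      Finset.mul_sum]
    refine Finset.sum_congr rfl fun i _ => ?_
    rw [hc i, map_pow]
    ring
  by_cases h0 : f k₀ = 0
  · rw [hsum, h0, zero_pow two_ne_zero, zero_mul]
    exact zero_mem_sumSq N
  by_cases hu : IsUnit (∑ i, c i ^ 2)
  · rw [hsum]
    refine sq_mul_mem_sumSq _ (hlift _ hu ?_)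
    rw [map_sum]
    simp only [map_pow]
    exact sum_mem_sums _
  · refine mem_sumSq_of_neg_one_mem hF2 (neg_one_mem_sumSq_of_succ hk ?_) _
    have hc1 : c k₀ = 1 := by
      have := hc k₀
      have h1 : algebraMap B F (c k₀) = 1 := by
        field_simp at this
        exact this.symm
      exact Subtype.ext h1
    have := hlift (-1) isUnit_one.neg (by
      have h1 : IsLocalRing.residue B (∑ i, c i ^ 2) = 0 := by
        rw [IsLocalRing.residue_eq_zero_iff]
        exact hu
      rw [← Finset.add_sum_erase _ _ (Finset.mem_univ k₀), hc1, one_pow, map_add, map_one, map_sum] at h1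
      have h2 : IsLocalRing.residue B (-1) = ∑ i ∈ Finset.univ.erase k₀, IsLocalRing.residue B (c i) ^ 2 := by
        rw [map_neg, map_one]
        simp only [map_pow] at h1
        linear_combination -h1
      rw [h2, ← Finset.sum_coe_sort]
      exact sum_mem_sums _)
    simpa using this

end

section

open Polynomial

/-- Sums of squares modulo coprime polynomials can be glued. -/
lemma exists_sum_sq_of_squarefree {K : Type*} [Field K] {N : ℕ} (h : K[X]) (G : K[X])
    (hG : Squarefree G)
    (hP : ∀ P, Irreducible P → P ∣ G → ∃ v : Fin N → K[X], P ∣ ∑ i, v i ^ 2 - h) :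
    ∃ v : Fin N → K[X], G ∣ ∑ i, v i ^ 2 - h := by
  induction G using WfDvdMonoid.induction_on_irreducible with
  | zero => exact absurd hG not_squarefree_zero
  | unit u hu => exact ⟨0, hu.dvd⟩
  | mul G P hG0 hPi ih =>
    obtain ⟨hrel, -, hGs⟩ := squarefree_mul_iff.mp hG
    obtain ⟨v, hv⟩ := hP P hPi (dvd_mul_right _ _)
    obtain ⟨w, hw⟩ := ih hGs fun Q hQ hQG => hP Q hQ (hQG.mul_left _)
    have hcop : IsCoprime P G := hrel.isCoprime
    obtain ⟨a, b, hab⟩ := id hcop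
    refine ⟨fun i => v i * (b * G) + w i * (a * P), hcop.mul_dvd ?_ ?_⟩
    · have (i : Fin N) : P ∣ (v i * (b * G) + w i * (a * P)) ^ 2 - v i ^ 2 := by
        refine (show P ∣ (v i * (b * G) + w i * (a * P)) - v i from ?_).trans
          (sub_dvd_pow_sub_pow _ _ 2)
        exact ⟨a * (w i - v i), by linear_combination v i * hab⟩
      have h1 := (Finset.dvd_sum fun i (_ : i ∈ Finset.univ) => this i).add hv
      rw [Finset.sum_sub_distrib] at h1
      simpa using h1
    · have (i : Fin N) : G ∣ (v i * (b * G) + w i * (a * P)) ^ 2 - w i ^ 2 := by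
        refine (show G ∣ (v i * (b * G) + w i * (a * P)) - w i from ?_).trans
          (sub_dvd_pow_sub_pow _ _ 2)
        exact ⟨b * (v i - w i), by linear_combination w i * hab⟩
      have h1 := (Finset.dvd_sum fun i (_ : i ∈ Finset.univ) => this i).add hw
      rw [Finset.sum_sub_distrib] at h1
      simpa using h1

lemma exists_common_denominator (Ω : Type*) {K : Type*} [CommRing Ω] [IsDomain Ω] [Field K]
    [Algebra Ω K] [IsFractionRing Ω K] {N : ℕ} (v : Fin N → K[X]) :
    ∃ d : Ω, d ≠ 0 ∧ ∃ w : Fin N → Polynomial Ω, ∀ i,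
      (w i).map (algebraMap Ω K) = C (algebraMap Ω K d) * v i := by
  have h (p : K[X]) : ∃ d : Ω, d ≠ 0 ∧ ∃ q : Polynomial Ω,
      q.map (algebraMap Ω K) = C (algebraMap Ω K d) * p := by
    obtain ⟨b, hb, hb'⟩ := IsLocalization.integerNormalization_spec (nonZeroDivisors Ω) p
    refine ⟨b, nonZeroDivisors.ne_zero hb, _, hb'.trans ?_⟩
    rw [← algebraMap_smul K b p, smul_eq_C_mul]
  choose d hd q hq using fun i => h (v i)
  refine ⟨∏ i, d i, Finset.prod_ne_zero_iff.mpr fun i _ => hd i,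
    fun i => C (∏ j ∈ Finset.univ.erase i, d j) * q i, fun i => ?_⟩
  rw [Polynomial.map_mul, hq, map_C, ← mul_assoc, ← C_mul, ← map_mul,
    Finset.prod_erase_mul _ _ (Finset.mem_univ i)]

lemma Monic.dvd_of_dvd_C_mul {Ω : Type*} [CommRing Ω] [IsDomain Ω] {g p : Polynomial Ω}
    (hg : g.Monic) {a : Ω} (ha : a ≠ 0) (h : g ∣ C a * p) : g ∣ p := by
  rw [← modByMonic_eq_zero_iff_dvd hg] at h ⊢
  rw [← smul_eq_C_mul, smul_modByMonic] at h
  exact (smul_eq_zero.mp h).resolve_left ha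

theorem good_of_relations {k : ℕ} (hk : 1 ≤ k) {Ω : Type u} [CommRing Ω] [IsDomain Ω]
    [IsLocalRing Ω] (hΩ : Hens Ω) (h2 : ∃ r : Ω, r * 2 = 1)
    (hp : FinitePyth (2 ^ k + 1) (IsLocalRing.ResidueField Ω)) {g f : Polynomial Ω} (hg : g.Monic)
    (hsep : ∃ r : Ω, r ≠ 0 ∧ ∃ a b, a * g + b * derivative g = C r)
    {M : ℕ} (F : Fin M → Polynomial Ω)
    (hF : ∃ c : Ω, c ≠ 0 ∧ g ∣ ∑ i, F i ^ 2 - C (c ^ 2) * f)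
    (hrel : ∀ i j, ∃ (d : ℕ) (c : ℕ → Ω), (∃ e ≤ d, IsUnit (c e)) ∧
      g ∣ ∑ e ∈ Finset.range (d + 1), C (c e) * F i ^ e * F j ^ (d - e)) :
    Good (2 ^ k + 1) g f := by
  set K := FractionRing Ω
  let ι := algebraMap Ω K
  have hι : Function.Injective ι := IsFractionRing.injective Ω K
  have hG : (g.map ι).Separable := by
    obtain ⟨r, hr, a, b, hab⟩ := hsep
    have h0 : ι r ≠ 0 := (map_ne_zero_iff ι hι).mpr hr
    refine ⟨C (ι r)⁻¹ * a.map ι, C (ι r)⁻¹ * b.map ι, ?_⟩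
    have := congrArg (Polynomial.map ι) hab
    rw [Polynomial.map_add, Polynomial.map_mul, Polynomial.map_mul, map_C, ← derivative_map] at this
    rw [mul_assoc, mul_assoc, ← mul_add, this, ← C_mul, inv_mul_cancel₀ h0, C_1]
  obtain ⟨v, hv⟩ := exists_sum_sq_of_squarefree (N := 2 ^ k + 1) ((∑ i, F i ^ 2).map ι) (g.map ι)
    hG.squarefree fun P hP hPg => by
      have : Fact (Irreducible P) := ⟨hP⟩
      let ψ : Polynomial Ω →+* AdjoinRoot P := (AdjoinRoot.mk P).comp (mapRingHom ι)
      have hψ (p : Polynomial Ω) (hp : g ∣ p) : ψ p = 0 := by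
        refine AdjoinRoot.mk_eq_zero.mpr (hPg.trans ?_)
        exact Polynomial.map_dvd ι hp
      have hψC (a : Ω) : ψ (C a) = algebraMap Ω (AdjoinRoot P) a := by
        simp [ψ]
        rfl
      have : FaithfulSMul Ω (AdjoinRoot P) := by
        rw [faithfulSMul_iff_algebraMap_injective, IsScalarTower.algebraMap_eq Ω K]
        exact (algebraMap K (AdjoinRoot P)).injective.comp hι
      obtain ⟨v, hv⟩ := mem_sumSq_of_relations hk hΩ h2 hp (fun i => ψ (F i)) fun i j => by
        obtain ⟨d, c, hu, hr⟩ := hrel i j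
        refine ⟨d, c, hu, ?_⟩
        have := hψ _ hr
        simpa only [map_sum, map_mul, map_pow, hψC] using this
      choose w hw using fun i => AdjoinRoot.mk_surjective (v i)
      refine ⟨w, ?_⟩
      rw [← AdjoinRoot.mk_eq_zero, map_sub, map_sum, sub_eq_zero]
      simp only [map_pow, hw]
      rw [← hv, ← coe_mapRingHom, ← RingHom.comp_apply, map_sum]
      simp only [map_pow]
      rfl
  obtain ⟨d, hd, w, hw⟩ := exists_common_denominator Ω v
  have h1 : g ∣ ∑ i, w i ^ 2 - C (d ^ 2) * ∑ i, F i ^ 2 := by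
    rw [← Polynomial.map_dvd_map ι hι hg]
    have : (∑ i, w i ^ 2 - C (d ^ 2) * ∑ i, F i ^ 2).map ι
        = C (ι d) ^ 2 * (∑ i, v i ^ 2 - (∑ i, F i ^ 2).map ι) := by
      simp only [Polynomial.map_sub, Polynomial.map_sum, Polynomial.map_pow, Polynomial.map_mul, hw,
        map_C, mul_pow, mul_sub, Finset.mul_sum, map_pow, ι]
    rw [this]
    exact hv.mul_left _
  obtain ⟨c, hc, h2⟩ := hF
  refine ⟨d * c, mul_ne_zero hd hc, w, ?_⟩
  convert h1.add (h2.mul_left (C (d ^ 2))) using 1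
  rw [mul_pow, C_mul]
  ring

/-- If a product of ideals in a local domain is principal, one of the generators of each factor
divides all the others. -/
lemma exists_dvd_of_mul_principal {Ω : Type*} [CommRing Ω] [IsDomain Ω] [IsLocalRing Ω]
    {S : Set Ω} {I : Ideal Ω} {γ : Ω} (hγ : γ ≠ 0) (h : Ideal.span S * I = Ideal.span {γ}) :
    ∃ a ∈ S, a ≠ 0 ∧ ∀ b ∈ S, a ∣ b := by
  have hdvd {a b : Ω} (ha : a ∈ S) (hb : b ∈ I) : γ ∣ a * b := by
    rw [← Ideal.mem_span_singleton, ← h]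
    exact Ideal.mul_mem_mul (Ideal.subset_span ha) hb
  obtain ⟨a, ha, b, hb, u, hu, hab⟩ : ∃ a ∈ S, ∃ b ∈ I, ∃ u, IsUnit u ∧ a * b = γ * u := by
    by_contra! hcon
    have hle : Ideal.span S * I ≤ Ideal.span {γ} * IsLocalRing.maximalIdeal Ω := by
      rw [← Ideal.span_eq I, Ideal.span_mul_span', Ideal.span_le]
      rintro _ ⟨a, ha, b, hb, rfl⟩
      obtain ⟨t, ht⟩ := hdvd ha hb
      rw [SetLike.mem_coe]
      dsimp only
      rw [ht]
      refine Ideal.mul_mem_mul (Ideal.mem_span_singleton_self γ) ?_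
      exact fun hu => hcon a ha b hb t hu ht
    have : γ ∈ Ideal.span {γ} * IsLocalRing.maximalIdeal Ω :=
      hle (h ▸ Ideal.mem_span_singleton_self γ)
    obtain ⟨t, ht, ht'⟩ := Ideal.mem_span_singleton_mul.mp this
    have : t = 1 := mul_left_cancel₀ hγ (by rw [ht', mul_one])
    exact (IsLocalRing.mem_maximalIdeal _).mp ht (this ▸ isUnit_one)
  have h0 : a * b ≠ 0 := hab ▸ mul_ne_zero hγ hu.ne_zero
  refine ⟨a, ha, left_ne_zero_of_mul h0, fun a' ha' => ?_⟩
  obtain ⟨t, ht⟩ := hdvd ha' hb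
  obtain ⟨w, hw⟩ := hu.exists_right_inv
  exact ⟨w * t, mul_right_cancel₀ (right_ne_zero_of_mul h0)
    (by linear_combination ht - γ * t * hw - w * t * hab)⟩

/-- A sum of squares in the algebra defined by a separable monic polynomial, with the algebraic
relations between the summands. -/
structure Datum (R : Type*) [CommRing R] where
  /-- The number of summands. -/
  M : ℕ
  /-- The polynomial defining the algebra. -/
  g : R[X]
  /-- The sum of squares. -/
  f : R[X]
  /-- The summands. -/
  F : Fin M → R[X]
  /-- The degrees of the relations. -/
  d : Fin M → Fin M → ℕ
  /-- The coefficients of the relations. -/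
  c : Fin M → Fin M → ℕ → R
  monic : g.Monic
  sep : ∃ r : R, r ≠ 0 ∧ ∃ a b, a * g + b * derivative g = C r
  inv : ∃ r : R, r ≠ 0 ∧ ∃ f', g ∣ f * f' - C r
  sum : ∃ a : R, a ≠ 0 ∧ g ∣ ∑ i, F i ^ 2 - C (a ^ 2) * f
  rel : ∀ i j, g ∣ ∑ e ∈ Finset.range (d i j + 1), C (c i j e) * F i ^ e * F j ^ (d i j - e)
  rel_ne : ∀ i j, ∃ e ≤ d i j, c i j e ≠ 0

/-- The product of the ideals of coefficients of the relations. -/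
def Datum.J {R : Type*} [CommRing R] (D : Datum R) : Ideal R :=
  ∏ p : Fin D.M × Fin D.M, Ideal.span (D.c p.1 p.2 '' Set.Iic (D.d p.1 p.2))

theorem Datum.good_of_principal {R : Type*} [CommRing R] (D : Datum R) {k : ℕ} (hk : 1 ≤ k)
    {Ω : Type u} [CommRing Ω] [IsDomain Ω]
    [IsLocalRing Ω] (hΩ : Hens Ω) (h2 : ∃ r : Ω, r * 2 = 1)
    (hp : FinitePyth (2 ^ k + 1) (IsLocalRing.ResidueField Ω)) (φ : R →+* Ω)
    (hφ : Function.Injective φ) (hJ : ∃ γ ≠ 0, D.J.map φ = Ideal.span {γ}) :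
    Good (2 ^ k + 1) (D.g.map φ) (D.f.map φ) := by
  obtain ⟨γ, hγ, hJ⟩ := hJ
  refine good_of_relations hk hΩ h2 hp (D.monic.map φ) ?_ (fun i => (D.F i).map φ) ?_ fun i j => ?_
  · obtain ⟨r, hr, a, b, hab⟩ := D.sep
    refine ⟨φ r, (map_ne_zero_iff φ hφ).mpr hr, a.map φ, b.map φ, ?_⟩
    rw [derivative_map, ← Polynomial.map_mul, ← Polynomial.map_mul, ← Polynomial.map_add, hab, map_C]
  · obtain ⟨a, ha, h⟩ := D.sum
    refine ⟨φ a, (map_ne_zero_iff φ hφ).mpr ha, ?_⟩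
    have := Polynomial.map_dvd φ h
    simpa only [Polynomial.map_sub, Polynomial.map_sum, Polynomial.map_pow, Polynomial.map_mul,
      map_C, map_pow] using this
  · rw [Datum.J, ← Ideal.mapHom_apply, map_prod, ← Finset.mul_prod_erase _ _ (Finset.mem_univ (i, j)),
      Ideal.mapHom_apply, Ideal.map_span] at hJ
    obtain ⟨_, ⟨_, ⟨e, he, rfl⟩, rfl⟩, h0, hdvd⟩ := exists_dvd_of_mul_principal hγ hJ
    have (e' : ℕ) : ∃ t, e' ∈ Set.Iic (D.d i j) → φ (D.c i j e') = φ (D.c i j e) * t := by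
      by_cases he' : e' ∈ Set.Iic (D.d i j)
      · obtain ⟨t, ht⟩ := hdvd _ ⟨_, ⟨e', he', rfl⟩, rfl⟩
        exact ⟨t, fun _ => ht⟩
      · exact ⟨0, fun h => absurd h he'⟩
    choose t ht using this
    refine ⟨D.d i j, t, ⟨e, he, ?_⟩, Monic.dvd_of_dvd_C_mul (D.monic.map φ) h0 ?_⟩
    · have : t e = 1 := mul_left_cancel₀ h0 (by rw [← ht e he, mul_one])
      rw [this]
      exact isUnit_one
    · have := Polynomial.map_dvd φ (D.rel i j)
      simp only [Polynomial.map_sum, Polynomial.map_pow, Polynomial.map_mul, map_C] at this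
      rw [Finset.mul_sum]
      convert this using 1
      refine Finset.sum_congr rfl fun e' he' => ?_
      rw [ht e' (Nat.lt_succ_iff.mp (Finset.mem_range.mp he')), C_mul]
      ring

end

section

open Polynomial

lemma FinitePyth.residueField {N : ℕ} {k : Type u} [Field k] (h : FinitePyth N k) {Ω : Type u}
    [CommRing Ω] [IsLocalRing Ω] (π : Ω →+* k) (hπ : Function.Surjective π) :
    FinitePyth N (IsLocalRing.ResidueField Ω) := by
  intro E _ _ _
  have hker : RingHom.ker π = IsLocalRing.maximalIdeal Ω :=
    IsLocalRing.eq_maximalIdeal (RingHom.ker_isMaximal_of_surjective π hπ)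
  let e : k ≃+* IsLocalRing.ResidueField Ω :=
    (RingHom.quotientKerEquivOfSurjective hπ).symm.trans (Ideal.quotEquivOfEq hker)
  let : Algebra k E := ((algebraMap (IsLocalRing.ResidueField Ω) E).comp e.toRingHom).toAlgebra
  let : Algebra k (IsLocalRing.ResidueField Ω) := e.toRingHom.toAlgebra
  have : IsScalarTower k (IsLocalRing.ResidueField Ω) E := IsScalarTower.of_algebraMap_eq' rfl
  have : Module.Finite k (IsLocalRing.ResidueField Ω) :=
    Module.Finite.of_surjective (Algebra.linearMap k _) e.surjective
  have : Module.Finite k E := Module.Finite.trans (IsLocalRing.ResidueField Ω) E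
  exact h E

lemma exists_half (k : Type*) [Field k] [CharZero k] : ∃ r : k, r * 2 = 1 :=
  ⟨2⁻¹, inv_mul_cancel₀ two_ne_zero⟩

lemma exists_half_powerSeries {S : Type*} [CommRing S] (h : ∃ r : S, r * 2 = 1) :
    ∃ r : PowerSeries S, r * 2 = 1 := by
  obtain ⟨r, hr⟩ := h
  exact ⟨PowerSeries.C r, by rw [← map_ofNat PowerSeries.C 2, ← map_mul, hr, map_one]⟩

namespace Datum

variable {R : Type*} [CommRing R] (D : Datum R) {k : ℕ} {L : Type u} [Field L] [CharZero L]

lemma J_ne_bot [IsDomain R] : D.J ≠ ⊥ := by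
  rw [J, ← Submodule.zero_eq_bot, Finset.prod_ne_zero_iff]
  rintro ⟨i, j⟩ - h
  obtain ⟨e, he, h0⟩ := D.rel_ne i j
  have : D.c i j e ∈ Ideal.span (D.c i j '' Set.Iic (D.d i j)) :=
    Ideal.subset_span ⟨e, he, rfl⟩
  rw [h] at this
  exact h0 (by simpa using this)

lemma map_J_ne_bot {Ω : Type*} [CommRing Ω] [IsDomain Ω] (φ : R →+* Ω)
    (hφ : Function.Injective φ) : D.J.map φ ≠ ⊥ := by
  have : IsDomain R := hφ.isDomain φ
  rw [Ne, Ideal.map_eq_bot_iff_of_injective hφ]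
  exact D.J_ne_bot

theorem good_powerSeries (hk : 1 ≤ k) (hp : FinitePyth (2 ^ k + 1) L)
    (φ : R →+* PowerSeries L) (hφ : Function.Injective φ) :
    Good (2 ^ k + 1) (D.g.map φ) (D.f.map φ) := by
  refine D.good_of_principal hk ((Hens.of_field L).powerSeries (exists_half L))
    (exists_half_powerSeries (exists_half L))
    (hp.residueField PowerSeries.constantCoeff fun s => ⟨PowerSeries.C s, by simp⟩) φ hφ ?_
  obtain ⟨γ, hγ⟩ := (IsPrincipalIdealRing.principal (D.J.map φ)).principal
  refine ⟨γ, ?_, hγ⟩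
  rintro rfl
  exact D.map_J_ne_bot φ hφ (by rw [hγ]; simp)

theorem good_powerSeries₂ (hk : 1 ≤ k) (hp : FinitePyth (2 ^ k + 1) L)
    (φ : R →+* PowerSeries (PowerSeries L)) (hφ : Function.Injective φ)
    (hJ : ∃ γ ≠ 0, D.J.map φ = Ideal.span {γ}) :
    Good (2 ^ k + 1) (D.g.map φ) (D.f.map φ) :=
  D.good_of_principal hk (((Hens.of_field L).powerSeries (exists_half L)).powerSeries
    (exists_half_powerSeries (exists_half L)))
    (exists_half_powerSeries (exists_half_powerSeries (exists_half L)))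
    (hp.residueField (PowerSeries.constantCoeff.comp PowerSeries.constantCoeff)
      fun s => ⟨PowerSeries.C (PowerSeries.C s), by simp⟩) φ hφ hJ

end Datum

end

section

open Finset

section

variable {L : Type*} [CommRing L] {B : Type*} [CommRing B] [Algebra L B]

/-- The total order of a double power series is at least `s`. -/
def ordGe (L : Type*) [CommRing L] (s : ℕ) : Submodule L (PowerSeries (PowerSeries L)) where
  carrier := {a | ∀ i j, i + j < s → PowerSeries.coeff j (PowerSeries.coeff i a) = 0}
  add_mem' ha hb i j h := by rw [map_add, map_add, ha i j h, hb i j h, add_zero]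
  zero_mem' i j _ := by simp
  smul_mem' c a ha i j h := by
    have := ha i j h
    rw [PowerSeries.coeff_smul, PowerSeries.coeff_smul, this, smul_zero]

/-- Substitution of `b₀ X` and `b₁ X` into a double power series. -/
noncomputable def diag (b₀ b₁ : B) : PowerSeries (PowerSeries L) →ₐ[L] PowerSeries B where
  toFun a := PowerSeries.mk fun l => ∑ p ∈ antidiagonal l,
    algebraMap L B (PowerSeries.coeff p.2 (PowerSeries.coeff p.1 a)) * b₀ ^ p.1 * b₁ ^ p.2
  map_zero' := by ext; simp
  map_add' a b := by ext l; simp [add_mul, sum_add_distrib]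
  map_one' := by
    ext l
    rw [PowerSeries.coeff_mk]
    rcases Nat.eq_zero_or_pos l with rfl | hl
    · simp
    · rw [PowerSeries.coeff_one, if_neg hl.ne']
      refine sum_eq_zero fun p hp => ?_
      rw [Finset.HasAntidiagonal.mem_antidiagonal] at hp
      rw [PowerSeries.coeff_one]
      split_ifs with h
      · rw [PowerSeries.coeff_one, if_neg (by omega)]
        simp
      · simp
  commutes' c := by
    ext l
    rw [PowerSeries.coeff_mk]
    have e : algebraMap L (PowerSeries (PowerSeries L)) c = PowerSeries.C (PowerSeries.C c) := by
      rw [PowerSeries.algebraMap_apply, PowerSeries.algebraMap_apply, Algebra.algebraMap_self_apply]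
    rw [e]
    rcases Nat.eq_zero_or_pos l with rfl | hl
    · simp [PowerSeries.algebraMap_apply]
    · rw [PowerSeries.algebraMap_apply, PowerSeries.coeff_C, if_neg hl.ne']
      refine sum_eq_zero fun p hp => ?_
      rw [Finset.HasAntidiagonal.mem_antidiagonal] at hp
      rw [PowerSeries.coeff_C]
      split_ifs with h
      · rw [PowerSeries.coeff_C, if_neg (by omega)]
        simp
      · simp
  map_mul' a b := by
    ext l
    simp only [PowerSeries.coeff_mul, PowerSeries.coeff_mk, map_sum, map_mul, sum_mul, mul_sum,
      sum_sigma']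
    refine sum_nbij'
      (fun x => ⟨(x.2.1.1 + x.2.2.1, x.2.1.2 + x.2.2.2), ⟨(x.2.1.2, x.2.2.2), (x.2.1.1, x.2.2.1)⟩⟩)
      (fun x => ⟨(x.2.2.1 + x.2.1.1, x.2.2.2 + x.2.1.2), ⟨(x.2.2.1, x.2.1.1), (x.2.2.2, x.2.1.2)⟩⟩)
      ?_ ?_ ?_ ?_ ?_
    · rintro ⟨⟨p, p'⟩, ⟨⟨q, q'⟩, ⟨r, r'⟩⟩⟩ h
      simp at h ⊢
      omega
    · rintro ⟨⟨p, p'⟩, ⟨⟨q, q'⟩, ⟨r, r'⟩⟩⟩ h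
      simp at h ⊢
      omega
    · rintro ⟨⟨p, p'⟩, ⟨⟨q, q'⟩, ⟨r, r'⟩⟩⟩ h
      simp at h ⊢
      omega
    · rintro ⟨⟨p, p'⟩, ⟨⟨q, q'⟩, ⟨r, r'⟩⟩⟩ h
      simp at h ⊢
      omega
    · rintro ⟨⟨p, p'⟩, ⟨⟨q, q'⟩, ⟨r, r'⟩⟩⟩ h
      simp at h ⊢
      obtain ⟨-, h1, h2⟩ := h
      rw [← h1, ← h2]
      ring

lemma coeff_diag (b₀ b₁ : B) (a : PowerSeries (PowerSeries L)) (l : ℕ) :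
    PowerSeries.coeff l (diag b₀ b₁ a) = ∑ p ∈ antidiagonal l,
      algebraMap L B (PowerSeries.coeff p.2 (PowerSeries.coeff p.1 a)) * b₀ ^ p.1 * b₁ ^ p.2 :=
  PowerSeries.coeff_mk l fun l => ∑ p ∈ antidiagonal l,
    algebraMap L B (PowerSeries.coeff p.2 (PowerSeries.coeff p.1 a)) * b₀ ^ p.1 * b₁ ^ p.2

lemma map_diag {B' : Type*} [CommRing B'] [Algebra L B'] (τ : B →ₐ[L] B') (b₀ b₁ : B)
    (a : PowerSeries (PowerSeries L)) :
    PowerSeries.map τ.toRingHom (diag b₀ b₁ a) = diag (τ b₀) (τ b₁) a := by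
  ext l
  simp [coeff_diag]

lemma rescale_diag (c b₀ b₁ : B) (a : PowerSeries (PowerSeries L)) :
    PowerSeries.rescale c (diag b₀ b₁ a) = diag (c * b₀) (c * b₁) a := by
  ext l
  rw [PowerSeries.coeff_rescale, coeff_diag, coeff_diag, mul_sum]
  refine sum_congr rfl fun p hp => ?_
  rw [Finset.HasAntidiagonal.mem_antidiagonal] at hp
  rw [← hp]
  ring

lemma diag_X (b₀ b₁ : B) : diag (L := L) b₀ b₁ PowerSeries.X = PowerSeries.C b₀ * PowerSeries.X := by
  ext l
  rw [coeff_diag, PowerSeries.coeff_C_mul, PowerSeries.coeff_X]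
  have key : ∀ p ∈ HasAntidiagonal.antidiagonal l, p ≠ (1, 0) →
      algebraMap L B (PowerSeries.coeff p.2 (PowerSeries.coeff p.1 PowerSeries.X)) *
        b₀ ^ p.1 * b₁ ^ p.2 = 0 := by
    rintro ⟨i, j⟩ - hp
    rw [PowerSeries.coeff_X]
    split_ifs with h
    · have : j ≠ 0 := by rintro rfl; exact hp (by rw [← h])
      simp [PowerSeries.coeff_one, this]
    · simp
  split_ifs with h
  · rw [sum_eq_single_of_mem (1, 0) (by simp [h]) key]
    simp
  · rw [mul_zero]
    refine sum_eq_zero fun p hp => key p hp ?_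
    rintro rfl
    rw [HasAntidiagonal.mem_antidiagonal] at hp
    exact h hp.symm

lemma diag_C_X (b₀ b₁ : B) :
    diag (L := L) b₀ b₁ (PowerSeries.C PowerSeries.X) = PowerSeries.C b₁ * PowerSeries.X := by
  ext l
  rw [coeff_diag, PowerSeries.coeff_C_mul, PowerSeries.coeff_X]
  have key : ∀ p ∈ HasAntidiagonal.antidiagonal l, p ≠ (0, 1) →
      algebraMap L B (PowerSeries.coeff p.2 (PowerSeries.coeff p.1
        (PowerSeries.C PowerSeries.X))) * b₀ ^ p.1 * b₁ ^ p.2 = 0 := by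
    rintro ⟨i, j⟩ - hp
    rw [PowerSeries.coeff_C]
    split_ifs with h
    · have : j ≠ 1 := by rintro rfl; exact hp (by rw [← h])
      simp [PowerSeries.coeff_X, this]
    · simp
  split_ifs with h
  · rw [sum_eq_single_of_mem (0, 1) (by simp [h]) key]
    simp
  · rw [mul_zero]
    refine sum_eq_zero fun p hp => key p hp ?_
    rintro rfl
    rw [HasAntidiagonal.mem_antidiagonal] at hp
    exact h hp.symm

lemma X_dvd_diag {b₀ b₁ : B} {s : ℕ} {a : PowerSeries (PowerSeries L)} (ha : a ∈ ordGe L s) :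
    PowerSeries.X ^ s ∣ diag b₀ b₁ a := by
  rw [PowerSeries.X_pow_dvd_iff]
  intro m hm
  rw [coeff_diag]
  refine sum_eq_zero fun p hp => ?_
  rw [HasAntidiagonal.mem_antidiagonal] at hp
  rw [ha p.1 p.2 (by omega)]
  simp

end

end

section

section

/-- Division by `X ^ s`, forgetting the coefficients of lower degree. -/
noncomputable def shiftBy (L : Type*) {B : Type*} [CommRing L] [CommRing B] [Algebra L B] (s : ℕ) :
    PowerSeries B →ₗ[L] PowerSeries B where
  toFun r := PowerSeries.mk fun l => PowerSeries.coeff (l + s) r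
  map_add' a b := by ext; simp
  map_smul' c a := by ext; simp

lemma coeff_shiftBy (L : Type*) {B : Type*} [CommRing L] [CommRing B] [Algebra L B] (s l : ℕ)
    (r : PowerSeries B) :
    PowerSeries.coeff l (shiftBy L s r) = PowerSeries.coeff (l + s) r :=
  PowerSeries.coeff_mk l fun l => PowerSeries.coeff (l + s) r

lemma shiftBy_X_pow_mul (L : Type*) {B : Type*} [CommRing L] [CommRing B] [Algebra L B] (s : ℕ)
    (r : PowerSeries B) : shiftBy L s (PowerSeries.X ^ s * r) = r := by
  ext l
  rw [coeff_shiftBy, PowerSeries.coeff_X_pow_mul]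

lemma X_pow_mul_shiftBy (L : Type*) {B : Type*} [CommRing L] [CommRing B] [Algebra L B] {s : ℕ}
    {r : PowerSeries B} (h : PowerSeries.X ^ s ∣ r) : PowerSeries.X ^ s * shiftBy L s r = r := by
  obtain ⟨r, rfl⟩ := h
  rw [shiftBy_X_pow_mul]

lemma exists_mem_ordGe (L : Type*) [CommRing L] (s : ℕ) (c : ℕ → L) :
    ∃ a ∈ ordGe L s, ∀ p ∈ Finset.HasAntidiagonal.antidiagonal s,
      PowerSeries.coeff p.2 (PowerSeries.coeff p.1 a) = c p.2 := by
  refine ⟨PowerSeries.mk fun i => PowerSeries.mk fun j => if i + j = s then c j else 0, ?_, ?_⟩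
  · intro i j h
    simp [h.ne]
  · intro p hp
    rw [Finset.HasAntidiagonal.mem_antidiagonal] at hp
    simp [hp]

lemma mul_mem_ordGe {L : Type*} [CommRing L] {s : ℕ} (r : PowerSeries (PowerSeries L))
    {a : PowerSeries (PowerSeries L)} (ha : a ∈ ordGe L s) : r * a ∈ ordGe L s := by
  intro i j h
  rw [PowerSeries.coeff_mul, map_sum]
  refine Finset.sum_eq_zero fun p hp => ?_
  rw [PowerSeries.coeff_mul]
  refine Finset.sum_eq_zero fun q hq => ?_
  rw [Finset.HasAntidiagonal.mem_antidiagonal] at hp hq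
  rw [ha p.2 q.2 (by omega), mul_zero]

lemma isUnit_of_coeff_ne_zero {L : Type*} [Field L] {a : PowerSeries (PowerSeries L)}
    (h : PowerSeries.constantCoeff (PowerSeries.constantCoeff a) ≠ 0) : IsUnit a := by
  rw [PowerSeries.isUnit_iff_constantCoeff, PowerSeries.isUnit_iff_constantCoeff]
  exact h.isUnit

lemma exists_pow_mem_of_finite {L R : Type*} [Field L] [CommRing R] [Algebra L R] [IsLocalRing R]
    (J : Ideal R) [Module.Finite L (R ⧸ J)] {ξ : R} (hξ : ¬ IsUnit ξ) : ∃ n, ξ ^ n ∈ J := by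
  by_cases hJ : J = ⊤
  · exact ⟨0, by simp [hJ]⟩
  have : Nontrivial (R ⧸ J) := Ideal.Quotient.nontrivial_iff.mpr hJ
  have : IsLocalRing (R ⧸ J) := IsLocalRing.of_surjective' _ Ideal.Quotient.mk_surjective
  have : IsArtinianRing (R ⧸ J) := IsArtinianRing.of_finite L _
  obtain ⟨n, hn⟩ := IsArtinianRing.isNilpotent_jacobson_bot (R := R ⧸ J)
  refine ⟨n, ?_⟩
  rw [← Ideal.Quotient.eq_zero_iff_mem, map_pow]
  have h : Ideal.Quotient.mk J ξ ∈ IsLocalRing.maximalIdeal (R ⧸ J) := by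
    rw [IsLocalRing.mem_maximalIdeal, mem_nonunits_iff]
    intro h
    obtain ⟨y, hy⟩ := h.exists_right_inv
    obtain ⟨y, rfl⟩ := Ideal.Quotient.mk_surjective y
    rw [← map_mul, ← map_one (Ideal.Quotient.mk J), Ideal.Quotient.eq] at hy
    have h1 := IsLocalRing.le_maximalIdeal hJ hy
    have h2 : ξ * y ∈ IsLocalRing.maximalIdeal R :=
      Ideal.mul_mem_right _ _ ((IsLocalRing.mem_maximalIdeal _).mpr hξ)
    have h3 := sub_mem h2 h1
    rw [sub_sub_cancel] at h3
    exact (IsLocalRing.mem_maximalIdeal _).mp h3 isUnit_one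
  rw [← IsLocalRing.jacobson_eq_maximalIdeal ⊥ bot_ne_top] at h
  have := Ideal.pow_mem_pow h n
  rw [hn] at this
  simpa using this

variable {L κ : Type*} [Field L] [Field κ] [Algebra L κ] [Module.Finite L κ]

lemma finrank_quotient_lt {R S : Type*} [CommRing R] [CommRing S] [Algebra L R] [Algebra κ S]
    [Algebra L S] [IsScalarTower L κ S] (T : R →ₗ[L] S) (O : Submodule L R) (J : Ideal R)
    (J₁ : Ideal S) [Module.Finite L (R ⧸ J)] (hJ : ∀ a ∈ J, T a ∈ J₁)
    (hT : ∀ r, ∃ a ∈ O, T a - r ∈ J₁) (hO : ∀ a ∈ O, a - 1 ∉ J) :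
    Module.Finite κ (S ⧸ J₁) ∧ Module.finrank κ (S ⧸ J₁) < Module.finrank L (R ⧸ J) := by
  let Q : R →ₗ[L] S ⧸ J₁ := (Ideal.Quotient.mkₐ L J₁).toLinearMap.comp T
  have hQ : ∀ a ∈ J, Q a = 0 := fun a ha => Ideal.Quotient.eq_zero_iff_mem.mpr (hJ a ha)
  let Q' : (R ⧸ J) →ₗ[L] S ⧸ J₁ :=
    (Submodule.liftQ (J.restrictScalars L) Q fun a ha => hQ a ha)
  let U : Submodule L (R ⧸ J) := O.map (Ideal.Quotient.mkₐ L J).toLinearMap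
  have hU : U ≠ ⊤ := by
    intro h
    have h1 : (1 : R ⧸ J) ∈ U := by rw [h]; trivial
    obtain ⟨a, ha, ha1⟩ := h1
    refine hO a ha ?_
    rw [← Ideal.Quotient.eq_zero_iff_mem, map_sub, map_one, sub_eq_zero]
    exact ha1
  have hUQ : U.map Q' = ⊤ := by
    rw [eq_top_iff]
    rintro r -
    obtain ⟨r, rfl⟩ := Ideal.Quotient.mk_surjective r
    obtain ⟨a, ha, har⟩ := hT r
    refine ⟨Ideal.Quotient.mk J a, ⟨a, ha, rfl⟩, ?_⟩
    change Ideal.Quotient.mk J₁ (T a) = _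
    rwa [Ideal.Quotient.eq]
  have hQs : Function.Surjective Q' := by
    rw [← LinearMap.range_eq_top, eq_top_iff, ← hUQ]
    exact LinearMap.map_le_range
  have hfin : Module.Finite L (S ⧸ J₁) := Module.Finite.of_surjective Q' hQs
  refine ⟨Module.Finite.of_restrictScalars_finite L κ _, ?_⟩
  refine lt_of_le_of_lt ?_ (Submodule.finrank_lt hU)
  have h1 := Submodule.finrank_map_le Q' U
  rw [hUQ, finrank_top] at h1
  refine le_trans ?_ h1
  rw [← Module.finrank_mul_finrank L κ]
  exact Nat.le_mul_of_pos_left _ Module.finrank_pos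

lemma exists_colength_lt_aux {b₀ b₁ : PowerSeries κ} {ξ : PowerSeries (PowerSeries L)}
    (ψ : PowerSeries (PowerSeries L) →ₐ[L] PowerSeries (PowerSeries κ)) (hψ : ψ = diag b₀ b₁)
    (hξ : ψ ξ = PowerSeries.X)
    (hξ0 : PowerSeries.constantCoeff (PowerSeries.constantCoeff ξ) = 0)
    (H : ∀ (s : ℕ) (a : ℕ → L), (∃ j ≤ s, a j ≠ 0) → ∀ z : PowerSeries κ, ∃ c : ℕ → L, ∃ w,
      z = ∑ p ∈ Finset.HasAntidiagonal.antidiagonal s,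
          algebraMap L (PowerSeries κ) (c p.2) * b₀ ^ p.1 * b₁ ^ p.2 +
        w * ∑ p ∈ Finset.HasAntidiagonal.antidiagonal s,
          algebraMap L (PowerSeries κ) (a p.2) * b₀ ^ p.1 * b₁ ^ p.2)
    (J : Ideal (PowerSeries (PowerSeries L))) (hJ : J ≠ ⊤)
    [Module.Finite L (PowerSeries (PowerSeries L) ⧸ J)] :
    ∃ s : ℕ, ∃ J₁ : Ideal (PowerSeries (PowerSeries κ)),
      J.map ψ.toRingHom = Ideal.span {PowerSeries.X ^ s} * J₁ ∧
      Module.Finite κ (PowerSeries (PowerSeries κ) ⧸ J₁) ∧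
      Module.finrank κ (PowerSeries (PowerSeries κ) ⧸ J₁) <
        Module.finrank L (PowerSeries (PowerSeries L) ⧸ J) := by
  obtain ⟨I, hI⟩ : ∃ I, J.map ψ.toRingHom = I := ⟨_, rfl⟩
  have hmem : ∀ a ∈ J, ψ a ∈ I := fun a ha => hI ▸ Ideal.mem_map_of_mem ψ.toRingHom ha
  have hdvd : ∀ {s : ℕ}, ∀ a ∈ ordGe L s, PowerSeries.X ^ s ∣ ψ a := fun a ha =>
    hψ ▸ X_dvd_diag ha
  rw [hI]
  obtain ⟨n, hn⟩ : ∃ n, ξ ^ n ∈ J := by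
    refine exists_pow_mem_of_finite (L := L) J fun h => ?_
    rw [PowerSeries.isUnit_iff_constantCoeff, PowerSeries.isUnit_iff_constantCoeff, hξ0] at h
    exact not_isUnit_zero h
  have hex : ∃ s, ∃ g ∈ J, g ∉ ordGe L (s + 1) := by
    refine ⟨n, _, hn, fun h => ?_⟩
    have := hdvd _ h
    rw [map_pow, hξ, PowerSeries.X_pow_dvd_iff] at this
    have := this n (Nat.lt_succ_self n)
    rw [PowerSeries.coeff_X_pow_self] at this
    exact one_ne_zero this
  classical
  set s := Nat.find hex with hs
  obtain ⟨g, hgJ, hg⟩ := Nat.find_spec hex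
  have hJs : ∀ a ∈ J, a ∈ ordGe L s := by
    intro a ha
    rcases Nat.eq_zero_or_pos s with h0 | hpos
    · rw [h0]; intro i j h; omega
    · by_contra hna
      refine Nat.find_min hex (m := s - 1) (by omega) ⟨a, ha, ?_⟩
      rwa [Nat.sub_add_cancel hpos]
  have hs0 : s ≠ 0 := by
    intro h0
    rw [← hs, h0] at hg
    refine hJ (Ideal.eq_top_of_isUnit_mem _ hgJ (isUnit_of_coeff_ne_zero fun h => hg ?_))
    intro i j hij
    obtain ⟨rfl, rfl⟩ : i = 0 ∧ j = 0 := by omega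
    simpa using h
  rw [← hs] at hg
  have hg' : ∃ j ≤ s, PowerSeries.coeff j (PowerSeries.coeff (s - j) g) ≠ 0 := by
    by_contra! hcon
    refine hg fun i j hij => ?_
    rcases Nat.lt_succ_iff_lt_or_eq.mp hij with h | h
    · exact hJs g hgJ i j h
    · have := hcon j (by omega)
      rwa [show s - j = i by omega] at this
  have hIX : ∀ r ∈ I, PowerSeries.X ^ s ∣ r := by
    intro r hr
    rw [← Ideal.mem_span_singleton]
    rw [← hI] at hr
    refine (Ideal.map_le_iff_le_comap.mpr fun a ha => ?_ : J.map ψ.toRingHom ≤ _) hr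
    rw [Ideal.mem_comap, Ideal.mem_span_singleton]
    exact hdvd a (hJs a ha)
  obtain ⟨J₁, hJ₁⟩ : ∃ J₁ : Ideal (PowerSeries (PowerSeries κ)),
      ∀ r, r ∈ J₁ ↔ PowerSeries.X ^ s * r ∈ I :=
    ⟨Submodule.comap (LinearMap.mulLeft (PowerSeries (PowerSeries κ)) (PowerSeries.X ^ s)) I,
      fun r => Iff.rfl⟩
  have hIJ₁ : I = Ideal.span {PowerSeries.X ^ s} * J₁ := by
    ext r
    rw [Ideal.mem_span_singleton_mul]
    constructor
    · intro hr
      obtain ⟨r', rfl⟩ := hIX r hr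
      exact ⟨r', (hJ₁ r').mpr hr, rfl⟩
    · rintro ⟨z, hz, rfl⟩
      exact (hJ₁ z).mp hz
  obtain ⟨T, hTdef⟩ : ∃ T : PowerSeries (PowerSeries L) →ₗ[L] PowerSeries (PowerSeries κ),
      ∀ a, T a = shiftBy L s (ψ a) :=
    ⟨(shiftBy L s).comp ψ.toLinearMap, fun a => rfl⟩
  have hT : ∀ a ∈ ordGe L s, PowerSeries.X ^ s * T a = ψ a := fun a ha => by
    rw [hTdef, X_pow_mul_shiftBy L (hdvd a ha)]
  have hTc : ∀ a, PowerSeries.constantCoeff (T a) = PowerSeries.coeff s (ψ a) := by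
    intro a
    rw [← PowerSeries.coeff_zero_eq_constantCoeff_apply, hTdef, coeff_shiftBy, zero_add]
  have hXn : PowerSeries.X ^ n ∈ J₁ := by
    rw [hJ₁]
    refine I.mul_mem_left _ ?_
    rw [← hξ, ← map_pow]
    exact hmem _ hn
  have step : ∀ r, ∃ a ∈ ordGe L s, ∃ j ∈ J₁, ∃ r', r = T a + j + PowerSeries.X * r' := by
    intro r
    obtain ⟨c, w, hcw⟩ := H s (fun j => PowerSeries.coeff j (PowerSeries.coeff (s - j) g)) hg'
      (PowerSeries.constantCoeff r)
    obtain ⟨a, has, ha⟩ := exists_mem_ordGe L s c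
    refine ⟨a, has, PowerSeries.C w * T g, ?_, ?_⟩
    · rw [hJ₁, mul_left_comm, hT g (hJs g hgJ)]
      exact I.mul_mem_left _ (hmem g hgJ)
    · have e1 : PowerSeries.constantCoeff (T a) =
          ∑ p ∈ Finset.HasAntidiagonal.antidiagonal s,
            algebraMap L (PowerSeries κ) (c p.2) * b₀ ^ p.1 * b₁ ^ p.2 := by
        rw [hTc, hψ, coeff_diag]
        exact Finset.sum_congr rfl fun p hp => by rw [ha p hp]
      have e2 : PowerSeries.constantCoeff (T g) =
          ∑ p ∈ Finset.HasAntidiagonal.antidiagonal s,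
            algebraMap L (PowerSeries κ) (PowerSeries.coeff p.2 (PowerSeries.coeff (s - p.2) g)) *
              b₀ ^ p.1 * b₁ ^ p.2 := by
        rw [hTc, hψ, coeff_diag]
        exact Finset.sum_congr rfl fun p hp => by
          rw [← Nat.eq_sub_of_add_eq (Finset.HasAntidiagonal.mem_antidiagonal.mp hp)]
      have e3 : PowerSeries.constantCoeff r =
          PowerSeries.constantCoeff (T a + PowerSeries.C w * T g) := by
        rw [RingHom.map_add, RingHom.map_mul, PowerSeries.constantCoeff_C, e1, e2]
        exact hcw
      have : PowerSeries.X ∣ r - (T a + PowerSeries.C w * T g) := by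
        rw [PowerSeries.X_dvd_iff, RingHom.map_sub, e3, sub_self]
      obtain ⟨r', hr'⟩ := this
      refine ⟨r', ?_⟩
      rw [← hr', add_sub_cancel]
  have steps : ∀ m : ℕ, ∀ r, ∃ a ∈ ordGe L s, ∃ j ∈ J₁, ∃ r',
      r = T a + j + PowerSeries.X ^ m * r' := by
    intro m
    induction m with
    | zero => exact fun r => ⟨0, zero_mem _, 0, zero_mem _, r, by simp⟩
    | succ m ih =>
      intro r
      obtain ⟨a, ha, j, hj, r', hr⟩ := step r
      obtain ⟨a', ha', j', hj', r'', hr'⟩ := ih r'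
      have h1 : ψ (ξ * a') = PowerSeries.X ^ s * (PowerSeries.X * T a') := by
        rw [map_mul, hξ, ← hT a' ha']; ring
      have h2 : PowerSeries.X * T a' = T (ξ * a') := by
        rw [hTdef (ξ * a'), h1, shiftBy_X_pow_mul]
      have h3 : ξ * a' ∈ ordGe L s := mul_mem_ordGe ξ ha'
      refine ⟨a + ξ * a', add_mem ha h3, j + PowerSeries.X * j',
        add_mem hj (J₁.mul_mem_left _ hj'), r'', ?_⟩
      rw [map_add, ← h2, hr, hr']
      ring
  have hfin := finrank_quotient_lt (κ := κ) T (ordGe L s) J J₁ ?_ ?_ ?_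
  · exact ⟨s, J₁, hIJ₁, hfin⟩
  · intro a ha
    rw [hJ₁, hT a (hJs a ha)]
    exact hmem a ha
  · intro r
    obtain ⟨a, ha, j, hj, r', hr⟩ := steps n r
    refine ⟨a, ha, ?_⟩
    have : T a - r = -(j + r' * PowerSeries.X ^ n) := by rw [hr]; ring
    rw [this]
    exact neg_mem (add_mem hj (J₁.mul_mem_left _ hXn))
  · intro a ha h2
    have h3 := sub_mem ha (hJs _ h2) 0 0 (by omega)
    simp at h3

/-- Blowing up strictly decreases the colength of a proper ideal of finite colength. -/
theorem exists_colength_lt {b₀ b₁ : PowerSeries κ} {ξ : PowerSeries (PowerSeries L)}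
    (hξ : diag b₀ b₁ ξ = PowerSeries.X)
    (hξ0 : PowerSeries.constantCoeff (PowerSeries.constantCoeff ξ) = 0)
    (H : ∀ (s : ℕ) (a : ℕ → L), (∃ j ≤ s, a j ≠ 0) → ∀ z : PowerSeries κ, ∃ c : ℕ → L, ∃ w,
      z = ∑ p ∈ Finset.HasAntidiagonal.antidiagonal s,
          algebraMap L (PowerSeries κ) (c p.2) * b₀ ^ p.1 * b₁ ^ p.2 +
        w * ∑ p ∈ Finset.HasAntidiagonal.antidiagonal s,
          algebraMap L (PowerSeries κ) (a p.2) * b₀ ^ p.1 * b₁ ^ p.2)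
    (J : Ideal (PowerSeries (PowerSeries L))) (hJ : J ≠ ⊤)
    [Module.Finite L (PowerSeries (PowerSeries L) ⧸ J)] :
    ∃ s : ℕ, ∃ J₁ : Ideal (PowerSeries (PowerSeries κ)),
      J.map (diag (L := L) b₀ b₁).toRingHom = Ideal.span {PowerSeries.X ^ s} * J₁ ∧
      Module.Finite κ (PowerSeries (PowerSeries κ) ⧸ J₁) ∧
      Module.finrank κ (PowerSeries (PowerSeries κ) ⧸ J₁) <
        Module.finrank L (PowerSeries (PowerSeries L) ⧸ J) :=
  exists_colength_lt_aux _ rfl hξ hξ0 H J hJ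

end

end

section

section

lemma exists_span_singleton_mul {R : Type*} [CommRing R] [IsDomain R] [UniqueFactorizationMonoid R]
    [IsNoetherianRing R] {J : Ideal R} (hJ : J ≠ ⊥) :
    ∃ γ ≠ 0, ∃ J' : Ideal R, J = Ideal.span {γ} * J' ∧ ∀ p, Prime p → ¬ J' ≤ Ideal.span {p} := by
  classical
  let : NormalizedGCDMonoid R := Classical.arbitrary _
  obtain ⟨S, hS⟩ := IsNoetherian.noetherian J
  have hne : S.Nonempty := by
    rw [Finset.nonempty_iff_ne_empty]
    rintro rfl
    exact hJ (by rw [← hS]; simp)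
  obtain ⟨g, hg, hg1⟩ := Finset.extract_gcd (f := fun x : R => x) hne
  set γ := S.gcd fun x : R => x with hγ
  have key : J = Ideal.span {γ} * Ideal.span (g '' S) := by
    rw [Ideal.span_mul_span', ← hS]
    refine congrArg Ideal.span (Set.ext fun x => ?_)
    constructor
    · intro hx
      exact ⟨γ, rfl, g x, ⟨x, hx, rfl⟩, (hg x hx).symm⟩
    · rintro ⟨_, rfl, _, ⟨y, hy, rfl⟩, rfl⟩
      change γ * g y ∈ _
      rwa [← hg y hy]
  refine ⟨γ, ?_, _, key, ?_⟩
  · intro h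
    rw [h] at key
    exact hJ (by rw [key]; simp)
  · intro p hp hle
    refine hp.not_isUnit (isUnit_of_dvd_one ?_)
    rw [← hg1]
    refine Finset.dvd_gcd fun b hb => ?_
    rw [← Ideal.mem_span_singleton]
    exact hle (Ideal.subset_span ⟨b, hb, rfl⟩)

lemma maximalIdeal_powerSeries₂ (K : Type*) [Field K] :
    IsLocalRing.maximalIdeal (PowerSeries (PowerSeries K)) =
      Ideal.span {PowerSeries.X, PowerSeries.C PowerSeries.X} := by
  ext a
  rw [IsLocalRing.mem_maximalIdeal, mem_nonunits_iff, PowerSeries.isUnit_iff_constantCoeff,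
    PowerSeries.isUnit_iff_constantCoeff, isUnit_iff_ne_zero, not_not, Ideal.mem_span_pair]
  constructor
  · intro h
    obtain ⟨c, hc⟩ := PowerSeries.X_dvd_iff.mpr h
    have : PowerSeries.X ∣ a - PowerSeries.C (PowerSeries.constantCoeff a) := by
      rw [PowerSeries.X_dvd_iff]; simp
    obtain ⟨b, hb⟩ := this
    refine ⟨b, PowerSeries.C c, ?_⟩
    rw [← map_mul, mul_comm c, ← hc, mul_comm b, ← hb, sub_add_cancel]
  · rintro ⟨b, c, rfl⟩
    simp

lemma height_maximalIdeal_le (K : Type*) [Field K] :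
    (IsLocalRing.maximalIdeal (PowerSeries (PowerSeries K))).height ≤ 2 := by
  refine (Ideal.height_le_spanFinrank _ (IsLocalRing.maximalIdeal.isMaximal _).ne_top).trans ?_
  rw [maximalIdeal_powerSeries₂]
  refine (Nat.cast_le.mpr (Submodule.spanFinrank_span_le_ncard_of_finite (Set.toFinite _))).trans ?_
  refine (Nat.cast_le.mpr (Set.ncard_insert_le _ _)).trans ?_
  rw [Set.ncard_singleton]
  norm_num

lemma exists_maximalIdeal_pow_le {K : Type*} [Field K] {J : Ideal (PowerSeries (PowerSeries K))}
    (hJ : ∀ p, Prime p → ¬ J ≤ Ideal.span {p}) :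
    ∃ n, IsLocalRing.maximalIdeal (PowerSeries (PowerSeries K)) ^ n ≤ J := by
  refine Ideal.exists_pow_le_of_le_radical_of_fg ?_ (IsNoetherian.noetherian _)
  rw [Ideal.radical_eq_sInf]
  refine le_sInf ?_
  rintro P ⟨hJP, hP⟩
  have hP0 : P ≠ ⊥ := by
    rintro rfl
    exact hJ _ PowerSeries.X_prime (hJP.trans bot_le)
  obtain ⟨p, hpP, hp⟩ := hP.exists_mem_prime_of_ne_bot hP0
  have h1 : (Ideal.span {p}).IsPrime := (Ideal.span_singleton_prime hp.ne_zero).mpr hp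
  have l1 : (⊥ : Ideal (PowerSeries (PowerSeries K))) < Ideal.span {p} := by
    rw [bot_lt_iff_ne_bot, Ne, Ideal.span_singleton_eq_bot]
    exact hp.ne_zero
  have l2 : Ideal.span {p} < P := by
    refine lt_of_le_of_ne ((Ideal.span_singleton_le_iff_mem _).mpr hpP) ?_
    rintro rfl
    exact hJ p hp hJP
  by_contra hcon
  have l3 : P < IsLocalRing.maximalIdeal _ :=
    lt_of_le_not_ge (IsLocalRing.le_maximalIdeal hP.ne_top) hcon
  have e1 := Ideal.height_strict_mono_of_isPrime_of_isPrime l1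
  have e2 := Ideal.height_strict_mono_of_isPrime_of_isPrime l2
  have e3 := Ideal.height_strict_mono_of_isPrime_of_isPrime l3
  have e4 := e3.trans_le (height_maximalIdeal_le K)
  have e5 : P.height ≤ 1 := Order.le_of_lt_add_one (by simpa [one_add_one_eq_two] using e4)
  have e6 := e2.trans_le e5
  rw [Order.lt_one_iff] at e6
  rw [e6] at e1
  exact not_lt_zero e1

lemma exists_eq_sum_add_X_pow_mul {A : Type*} [CommRing A] (n : ℕ) (a : PowerSeries A) :
    ∃ r, a = ∑ i ∈ Finset.range n, PowerSeries.C (PowerSeries.coeff i a) * PowerSeries.X ^ i +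
      PowerSeries.X ^ n * r := by
  have : PowerSeries.X ^ n ∣
      a - ∑ i ∈ Finset.range n, PowerSeries.C (PowerSeries.coeff i a) * PowerSeries.X ^ i := by
    rw [PowerSeries.X_pow_dvd_iff]
    intro m hm
    rw [map_sub, map_sum, Finset.sum_eq_single_of_mem m (Finset.mem_range.mpr hm)]
    · simp
    · intro i _ hi
      rw [PowerSeries.coeff_C_mul, PowerSeries.coeff_X_pow, if_neg hi.symm, mul_zero]
  obtain ⟨r, hr⟩ := this
  exact ⟨r, by rw [← hr, add_sub_cancel]⟩

lemma smul_eq_C_C_mul {A : Type*} [CommRing A] (c : A) (a : PowerSeries (PowerSeries A)) :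
    c • a = PowerSeries.C (PowerSeries.C c) * a := by
  ext i j
  rw [PowerSeries.coeff_smul, PowerSeries.coeff_smul, PowerSeries.coeff_C_mul,
    PowerSeries.coeff_C_mul, smul_eq_mul]

lemma finite_quotient_of_maximalIdeal_pow_le {K : Type*} [Field K]
    {J : Ideal (PowerSeries (PowerSeries K))} {n : ℕ}
    (hJ : IsLocalRing.maximalIdeal (PowerSeries (PowerSeries K)) ^ n ≤ J) :
    Module.Finite K (PowerSeries (PowerSeries K) ⧸ J) := by
  have hx : PowerSeries.X ^ n ∈ J := hJ (Ideal.pow_mem_pow (by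
    rw [maximalIdeal_powerSeries₂]; exact Ideal.subset_span (by simp)) n)
  have hy : PowerSeries.C PowerSeries.X ^ n ∈ J := hJ (Ideal.pow_mem_pow (by
    rw [maximalIdeal_powerSeries₂]; exact Ideal.subset_span (by simp)) n)
  let e : ℕ × ℕ → PowerSeries (PowerSeries K) ⧸ J := fun p =>
    Ideal.Quotient.mk J (PowerSeries.C (PowerSeries.X ^ p.2) * PowerSeries.X ^ p.1)
  have hfg := Submodule.fg_span (R := K)
    (((Finset.range n ×ˢ Finset.range n).finite_toSet).image e)
  suffices h : Submodule.span K (e '' ↑(Finset.range n ×ˢ Finset.range n)) = ⊤ from ⟨h ▸ hfg⟩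
  rw [eq_top_iff]
  rintro a -
  obtain ⟨a, rfl⟩ := Ideal.Quotient.mk_surjective a
  obtain ⟨r, hr⟩ := exists_eq_sum_add_X_pow_mul n a
  rw [hr, map_add, map_sum, Ideal.Quotient.eq_zero_iff_mem.mpr (J.mul_mem_right r hx), add_zero]
  refine Submodule.sum_mem _ fun i hi => ?_
  obtain ⟨r', hr'⟩ := exists_eq_sum_add_X_pow_mul n (PowerSeries.coeff i a)
  have hz : Ideal.Quotient.mk J (PowerSeries.C (PowerSeries.X ^ n * r') * PowerSeries.X ^ i) = 0 := by
    rw [Ideal.Quotient.eq_zero_iff_mem, map_mul, map_pow]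
    exact J.mul_mem_right _ (J.mul_mem_right _ hy)
  rw [hr', map_add, add_mul, map_add, hz, add_zero, map_sum, Finset.sum_mul, map_sum]
  refine Submodule.sum_mem _ fun j hj => ?_
  have : Ideal.Quotient.mk J (PowerSeries.C (PowerSeries.C (PowerSeries.coeff j
      (PowerSeries.coeff i a)) * PowerSeries.X ^ j) * PowerSeries.X ^ i) =
      PowerSeries.coeff j (PowerSeries.coeff i a) • e (i, j) := by
    change _ = Ideal.Quotient.mk J (_ • _)
    rw [smul_eq_C_C_mul, RingHom.map_mul PowerSeries.C, mul_assoc]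
  rw [this]
  exact Submodule.smul_mem _ _ (Submodule.subset_span ⟨(i, j), by simpa using ⟨by simpa using hi, by simpa using hj⟩, rfl⟩)

/-- A nonzero ideal of `K⟦y⟧⟦x⟧` is a principal ideal times an ideal of finite colength. -/
theorem exists_span_mul_finite {K : Type*} [Field K] {J : Ideal (PowerSeries (PowerSeries K))}
    (hJ : J ≠ ⊥) : ∃ γ ≠ 0, ∃ J' : Ideal (PowerSeries (PowerSeries K)),
      J = Ideal.span {γ} * J' ∧ Module.Finite K (PowerSeries (PowerSeries K) ⧸ J') := by
  obtain ⟨γ, hγ, J', h, hp⟩ := exists_span_singleton_mul hJ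
  obtain ⟨n, hn⟩ := exists_maximalIdeal_pow_le hp
  exact ⟨γ, hγ, J', h, finite_quotient_of_maximalIdeal_pow_le hn⟩

end

end

section

section

variable {L B : Type*} [Field L] [CommRing B] [Algebra L B]

/-- The polynomial `∑ aⱼ Xʲ`, `j ≤ s`. -/
noncomputable def truncPoly (s : ℕ) (a : ℕ → L) : Polynomial L :=
  ∑ j ∈ Finset.range (s + 1), Polynomial.C (a j) * Polynomial.X ^ j

lemma coeff_truncPoly (s : ℕ) (a : ℕ → L) {j : ℕ} (hj : j ≤ s) :
    (truncPoly s a).coeff j = a j := by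
  rw [truncPoly, Polynomial.finsetSum_coeff,
    Finset.sum_eq_single_of_mem j (Finset.mem_range.mpr (by omega))]
  · simp
  · intro i _ hi
    rw [Polynomial.coeff_C_mul, Polynomial.coeff_X_pow, if_neg hi.symm, mul_zero]

lemma natDegree_truncPoly_le (s : ℕ) (a : ℕ → L) : (truncPoly s a).natDegree ≤ s := by
  refine Polynomial.natDegree_sum_le_of_forall_le _ _ fun j hj => ?_
  exact (Polynomial.natDegree_C_mul_X_pow_le _ _).trans (by
    have := Finset.mem_range.mp hj; omega)

lemma truncPoly_coeff {s : ℕ} {h : Polynomial L} (hs : h.natDegree ≤ s) :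
    truncPoly s h.coeff = h := by
  rw [truncPoly]
  exact (h.as_sum_range_C_mul_X_pow' (by omega)).symm

lemma algHom_C (ev : Polynomial L →ₐ[L] B) (a : L) : ev (Polynomial.C a) = algebraMap L B a :=
  ev.commutes a

lemma sum_antidiagonal_one_left (ev : Polynomial L →ₐ[L] B) (s : ℕ) (a : ℕ × ℕ → L) :
    ∑ p ∈ Finset.HasAntidiagonal.antidiagonal s,
        algebraMap L B (a p) * 1 ^ p.1 * ev Polynomial.X ^ p.2 =
      ev (truncPoly s fun j => a (s - j, j)) := by
  rw [← Finset.Nat.sum_antidiagonal_swap,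
    Finset.Nat.sum_antidiagonal_eq_sum_range_succ_mk, truncPoly, map_sum]
  refine Finset.sum_congr rfl fun j _ => ?_
  rw [map_mul, map_pow, algHom_C]
  simp

lemma sum_antidiagonal_one_right (ev : Polynomial L →ₐ[L] B) (s : ℕ) (a : ℕ × ℕ → L) :
    ∑ p ∈ Finset.HasAntidiagonal.antidiagonal s,
        algebraMap L B (a p) * ev Polynomial.X ^ p.1 * 1 ^ p.2 =
      ev (truncPoly s fun j => a (j, s - j)) := by
  rw [Finset.Nat.sum_antidiagonal_eq_sum_range_succ_mk, truncPoly, map_sum]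
  refine Finset.sum_congr rfl fun j _ => ?_
  rw [map_mul, map_pow, algHom_C]
  simp

lemma diag_one_left_injective (ev : Polynomial L →ₐ[L] B) (hev : Function.Injective ev) :
    Function.Injective (diag (L := L) 1 (ev Polynomial.X)) := by
  rw [injective_iff_map_eq_zero]
  intro a ha
  ext i j
  have h := congrArg (PowerSeries.coeff (i + j)) ha
  rw [coeff_diag, sum_antidiagonal_one_left ev (i + j)
    fun p => PowerSeries.coeff p.2 (PowerSeries.coeff p.1 a), map_zero,
    map_eq_zero_iff ev hev] at h
  have h2 := congrArg (fun q => Polynomial.coeff q j) h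
  simp only [Polynomial.coeff_zero] at h2
  rw [coeff_truncPoly _ _ (Nat.le_add_left j i)] at h2
  simpa using h2

lemma diag_one_right_injective (ev : Polynomial L →ₐ[L] B) (hev : Function.Injective ev) :
    Function.Injective (diag (L := L) (ev Polynomial.X) 1) := by
  rw [injective_iff_map_eq_zero]
  intro a ha
  ext i j
  have h := congrArg (PowerSeries.coeff (i + j)) ha
  rw [coeff_diag, sum_antidiagonal_one_right ev (i + j)
    fun p => PowerSeries.coeff p.2 (PowerSeries.coeff p.1 a), map_zero,
    map_eq_zero_iff ev hev] at h
  have h2 := congrArg (fun q => Polynomial.coeff q i) h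
  simp only [Polynomial.coeff_zero] at h2
  rw [coeff_truncPoly _ _ (Nat.le_add_right i j)] at h2
  simpa using h2

end

section

variable {L κ : Type*} [Field L] [Field κ] [Algebra L κ]

lemma exists_eq_X_pow_mul_unit {f : PowerSeries κ} (hf : f ≠ 0) :
    ∃ n u, IsUnit u ∧ f = PowerSeries.X ^ n * u := by
  obtain ⟨n, u, hu, h⟩ := WfDvdMonoid.max_power_factor hf PowerSeries.X_prime.irreducible
  refine ⟨n, u, ?_, h⟩
  rw [PowerSeries.isUnit_iff_constantCoeff, isUnit_iff_ne_zero]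
  exact fun h0 => hu (PowerSeries.X_dvd_iff.mpr h0)

lemma exists_eq_ev_add_mul (ev : Polynomial L →ₐ[L] PowerSeries κ) (hev : Function.Injective ev)
    (hd : ∀ z v, ∃ h, PowerSeries.X ^ v ∣ z - ev h) {h : Polynomial L} (h0 : h ≠ 0)
    (z : PowerSeries κ) :
    ∃ r w, r.natDegree ≤ h.natDegree ∧ z = ev r + w * ev h := by
  obtain ⟨v, u, hu, he⟩ := exists_eq_X_pow_mul_unit ((map_ne_zero_iff ev hev).mpr h0)
  obtain ⟨k, w, hw⟩ := hd z v
  obtain ⟨u', hu'⟩ := hu.exists_right_inv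
  refine ⟨k % h, ev (k / h) + w * u', ?_, ?_⟩
  · exact Polynomial.natDegree_le_natDegree (Polynomial.degree_mod_lt k h0).le
  · have e1 : ev k = ev h * ev (k / h) + ev (k % h) := by
      rw [← map_mul, ← map_add, EuclideanDomain.div_add_mod]
    have e2 : PowerSeries.X ^ v = ev h * u' := by rw [he, mul_assoc, hu', mul_one]
    rw [e2, e1, sub_eq_iff_eq_add] at hw
    rw [hw]
    ring

lemma exists_form_one_left (ev : Polynomial L →ₐ[L] PowerSeries κ) (hev : Function.Injective ev)
    (hd : ∀ z v, ∃ h, PowerSeries.X ^ v ∣ z - ev h) (s : ℕ) (a : ℕ → L)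
    (ha : ∃ j ≤ s, a j ≠ 0) (z : PowerSeries κ) : ∃ c : ℕ → L, ∃ w,
      z = ∑ p ∈ Finset.HasAntidiagonal.antidiagonal s,
          algebraMap L (PowerSeries κ) (c p.2) * 1 ^ p.1 * ev Polynomial.X ^ p.2 +
        w * ∑ p ∈ Finset.HasAntidiagonal.antidiagonal s,
          algebraMap L (PowerSeries κ) (a p.2) * 1 ^ p.1 * ev Polynomial.X ^ p.2 := by
  have h0 : truncPoly s a ≠ 0 := by
    obtain ⟨j, hj, hj0⟩ := ha
    intro h
    rw [← coeff_truncPoly s a hj, h] at hj0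
    exact hj0 (by simp)
  obtain ⟨r, w, hr, hz⟩ := exists_eq_ev_add_mul ev hev hd h0 z
  refine ⟨r.coeff, w, ?_⟩
  rw [sum_antidiagonal_one_left ev s fun p => r.coeff p.2,
    sum_antidiagonal_one_left ev s fun p => a p.2]
  rw [← truncPoly_coeff (hr.trans (natDegree_truncPoly_le s a))] at hz
  exact hz

lemma exists_form_one_right (ev : Polynomial L →ₐ[L] PowerSeries κ) (hev : Function.Injective ev)
    (hd : ∀ z v, ∃ h, PowerSeries.X ^ v ∣ z - ev h) (s : ℕ) (a : ℕ → L)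
    (ha : ∃ j ≤ s, a j ≠ 0) (z : PowerSeries κ) : ∃ c : ℕ → L, ∃ w,
      z = ∑ p ∈ Finset.HasAntidiagonal.antidiagonal s,
          algebraMap L (PowerSeries κ) (c p.2) * ev Polynomial.X ^ p.1 * 1 ^ p.2 +
        w * ∑ p ∈ Finset.HasAntidiagonal.antidiagonal s,
          algebraMap L (PowerSeries κ) (a p.2) * ev Polynomial.X ^ p.1 * 1 ^ p.2 := by
  have h0 : truncPoly s (fun j => a (s - j)) ≠ 0 := by
    obtain ⟨j, hj, hj0⟩ := ha
    intro h
    have := coeff_truncPoly s (fun j => a (s - j)) (Nat.sub_le s j)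
    rw [h, Nat.sub_sub_self hj] at this
    exact hj0 (by simpa using this.symm)
  obtain ⟨r, w, hr, hz⟩ := exists_eq_ev_add_mul ev hev hd h0 z
  refine ⟨fun j => r.coeff (s - j), w, ?_⟩
  rw [sum_antidiagonal_one_right ev s fun p => r.coeff (s - p.2),
    sum_antidiagonal_one_right ev s fun p => a p.2]
  have hr' := hr.trans (natDegree_truncPoly_le s _)
  have e : truncPoly s (fun j => r.coeff (s - (s - j))) = r := by
    rw [← truncPoly_coeff hr', truncPoly, truncPoly]
    refine Finset.sum_congr rfl fun j hj => ?_
    have := Finset.mem_range.mp hj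
    have h1 : j ≤ s := by omega
    rw [← truncPoly, truncPoly_coeff hr', Nat.sub_sub_self h1]
  rw [e]
  exact hz

end

section

variable {L κ : Type*} [Field L] [Field κ] [Algebra L κ]

/-- The completion of `L[t]` at the point `α` of `κ`. -/
noncomputable def evAt (α : κ) : Polynomial L →ₐ[L] PowerSeries κ :=
  Polynomial.aeval (PowerSeries.C α + PowerSeries.X)

lemma evAt_X (α : κ) : evAt (L := L) α Polynomial.X = PowerSeries.C α + PowerSeries.X :=
  Polynomial.aeval_X _

lemma constantCoeff_evAt (α : κ) (h : Polynomial L) :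
    PowerSeries.constantCoeff (evAt α h) = Polynomial.aeval α h := by
  induction h using Polynomial.induction_on' with
  | add p q hp hq => rw [map_add, map_add, map_add, hp, hq]
  | monomial n a =>
    rw [← Polynomial.C_mul_X_pow_eq_monomial]
    simp [evAt, ← Polynomial.algebraMap_eq, PowerSeries.algebraMap_apply]

lemma coeff_one_evAt (α : κ) (h : Polynomial L) :
    PowerSeries.coeff 1 (evAt α h) = Polynomial.aeval α h.derivative := by
  induction h using Polynomial.induction_on with
  | C a => simp [evAt, PowerSeries.algebraMap_apply]
  | add p q hp hq => simp only [map_add, hp, hq]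
  | monomial n a ih =>
    have key : ∀ f : PowerSeries κ, PowerSeries.coeff 1 (f * (PowerSeries.C α + PowerSeries.X)) =
        PowerSeries.coeff 1 f * α + PowerSeries.constantCoeff f := by
      intro f
      rw [mul_add, map_add, PowerSeries.coeff_mul_C, ← zero_add 1, PowerSeries.coeff_succ_mul_X,
        PowerSeries.coeff_zero_eq_constantCoeff_apply]
    rw [pow_succ, ← mul_assoc, map_mul (evAt α), evAt_X, key, ih, constantCoeff_evAt,
      Polynomial.derivative_mul (f := Polynomial.C a * Polynomial.X ^ n), map_add,
      map_mul (Polynomial.aeval α) _ Polynomial.X, Polynomial.aeval_X, Polynomial.derivative_X,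
      mul_one]

lemma isUnit_evAt_iff (α : κ) (h : Polynomial L) :
    IsUnit (evAt α h) ↔ Polynomial.aeval α h ≠ 0 := by
  rw [PowerSeries.isUnit_iff_constantCoeff, constantCoeff_evAt, isUnit_iff_ne_zero]

variable {P : Polynomial L} {α : κ} (hP : P.Separable) (h0 : Polynomial.aeval α P = 0)

include hP h0

lemma exists_evAt_eq : ∃ u, IsUnit u ∧ evAt α P = PowerSeries.X * u := by
  obtain ⟨u, hu⟩ := PowerSeries.X_dvd_iff.mpr ((constantCoeff_evAt α P).trans h0)
  refine ⟨u, ?_, hu⟩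
  rw [PowerSeries.isUnit_iff_constantCoeff, isUnit_iff_ne_zero]
  intro h
  have h1 := coeff_one_evAt α P
  rw [hu, ← zero_add 1, PowerSeries.coeff_succ_X_mul, PowerSeries.coeff_zero_eq_constantCoeff_apply,
    h] at h1
  obtain ⟨a, b, hab⟩ := hP
  have := congrArg (Polynomial.aeval α) hab
  rw [map_add, map_mul, map_mul, h0, ← h1, map_one] at this
  simp at this

lemma evAt_dense (hα : Function.Surjective (Polynomial.aeval (R := L) α)) (v : ℕ) :
    ∀ z : PowerSeries κ, ∃ h : Polynomial L, PowerSeries.X ^ v ∣ z - evAt α h := by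
  obtain ⟨u, hu, hPu⟩ := exists_evAt_eq hP h0
  obtain ⟨u', hu'⟩ := hu.exists_right_inv
  induction v with
  | zero => exact fun z => ⟨0, by simp⟩
  | succ v ih =>
    intro z
    obtain ⟨h, hh⟩ := hα (PowerSeries.constantCoeff z)
    have : PowerSeries.X ∣ z - evAt α h := by
      rw [PowerSeries.X_dvd_iff, map_sub, constantCoeff_evAt, hh, sub_self]
    obtain ⟨z', hz'⟩ := this
    obtain ⟨h', w, hw⟩ := ih (u' * z')
    refine ⟨h + P * h', u * w, ?_⟩
    rw [sub_eq_iff_eq_add] at hz'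
    rw [sub_eq_iff_eq_add] at hw
    rw [hz', map_add, map_mul, hPu]
    have : z' = u * (u' * z') := by rw [← mul_assoc, hu', one_mul]
    rw [this, hw]
    ring

lemma evAt_ne_zero_of_irreducible (hPi : Irreducible P) {h : Polynomial L} (hh : h ≠ 0) :
    ∃ v k u, h = P ^ v * k ∧ ¬ P ∣ k ∧ IsUnit u ∧ evAt α h = PowerSeries.X ^ v * u := by
  obtain ⟨v, k, hk, rfl⟩ := WfDvdMonoid.max_power_factor hh hPi
  obtain ⟨u, hu, hPu⟩ := exists_evAt_eq hP h0
  refine ⟨v, k, u ^ v * evAt α k, rfl, hk, (hu.pow v).mul ?_, ?_⟩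
  · rw [isUnit_evAt_iff]
    intro hk0
    rcases (EuclideanDomain.dvd_or_coprime P k hPi) with hd | ⟨a, b, hab⟩
    · exact hk hd
    · have := congrArg (Polynomial.aeval α) hab
      rw [map_add, map_mul, map_mul, h0, hk0, map_one] at this
      simp at this
  · rw [map_mul, map_pow, hPu]
    ring

lemma evAt_injective (hPi : Irreducible P) : Function.Injective (evAt (L := L) α) := by
  rw [injective_iff_map_eq_zero]
  intro h hh
  by_contra hne
  obtain ⟨v, k, u, -, -, hu, he⟩ := evAt_ne_zero_of_irreducible hP h0 hPi hne
  rw [hh] at he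
  exact mul_ne_zero (pow_ne_zero v PowerSeries.X_ne_zero) hu.ne_zero he.symm

end

end

section

open Polynomial

namespace Datum

section

variable {R : Type*} [CommRing R] (D : Datum R)

/-- The ideal of coefficients of the relations becomes, up to a principal factor, of colength at
most `m`. -/
def Colength {L : Type*} [Field L] (φ : R →+* PowerSeries (PowerSeries L)) (m : ℕ) : Prop :=
  ∃ γ ≠ 0, ∃ J' : Ideal (PowerSeries (PowerSeries L)), D.J.map φ = Ideal.span {γ} * J' ∧
    Module.Finite L (PowerSeries (PowerSeries L) ⧸ J') ∧
    Module.finrank L (PowerSeries (PowerSeries L) ⧸ J') ≤ m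

lemma exists_colength {L : Type*} [Field L] (φ : R →+* PowerSeries (PowerSeries L))
    (hφ : Function.Injective φ) : ∃ m, D.Colength φ m := by
  obtain ⟨γ, hγ, J', h, hf⟩ := exists_span_mul_finite (D.map_J_ne_bot φ hφ)
  exact ⟨_, γ, hγ, J', h, hf, le_rfl⟩

lemma Colength.diag {L κ : Type*} [Field L] [Field κ] [Algebra L κ] [Module.Finite L κ]
    {φ : R →+* PowerSeries (PowerSeries L)} {m : ℕ} (hm : D.Colength φ m)
    (hp : ¬ ∃ γ ≠ 0, D.J.map φ = Ideal.span {γ})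
    {b₀ b₁ : PowerSeries κ} {ξ : PowerSeries (PowerSeries L)}
    (hψ : Function.Injective (diag (L := L) b₀ b₁))
    (hξ : SosPaper.diag b₀ b₁ ξ = PowerSeries.X)
    (hξ0 : PowerSeries.constantCoeff (PowerSeries.constantCoeff ξ) = 0)
    (H : ∀ (s : ℕ) (a : ℕ → L), (∃ j ≤ s, a j ≠ 0) → ∀ z : PowerSeries κ, ∃ c : ℕ → L, ∃ w,
      z = ∑ p ∈ Finset.HasAntidiagonal.antidiagonal s,
          algebraMap L (PowerSeries κ) (c p.2) * b₀ ^ p.1 * b₁ ^ p.2 +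
        w * ∑ p ∈ Finset.HasAntidiagonal.antidiagonal s,
          algebraMap L (PowerSeries κ) (a p.2) * b₀ ^ p.1 * b₁ ^ p.2) :
    ∃ m' < m, D.Colength ((SosPaper.diag (L := L) b₀ b₁).toRingHom.comp φ) m' := by
  obtain ⟨γ, hγ, J', h, hf, hle⟩ := hm
  have hJ' : J' ≠ ⊤ := fun e => hp ⟨γ, hγ, by rw [h, e, Ideal.mul_top]⟩
  obtain ⟨s, J₁, h1, h2, h3⟩ := exists_colength_lt hξ hξ0 H J' hJ'
  refine ⟨_, h3.trans_le hle, (SosPaper.diag (L := L) b₀ b₁).toRingHom γ * PowerSeries.X ^ s, ?_, J₁, ?_, h2,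
    le_rfl⟩
  · exact mul_ne_zero ((map_ne_zero_iff _ hψ).mpr hγ) (pow_ne_zero _ PowerSeries.X_ne_zero)
  · rw [← Ideal.map_map, h, Ideal.map_mul, Ideal.map_span, Set.image_singleton, h1, ← mul_assoc,
      Ideal.span_singleton_mul_span_singleton]

end

section

variable {R : Type u} [CommRing R] [IsDomain R] (D : Datum R)

/-- All completed specialisations of `D` with colength at most `m` are good. -/
def GoodBelow (N m : ℕ) : Prop :=
  ∀ m' < m, ∀ (L : Type u) [Field L] [CharZero L], FunctionPyth N L →
    ∀ φ : R →+* PowerSeries (PowerSeries L), Function.Injective φ → D.Colength φ m' →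
      Good N (D.g.map φ) (D.f.map φ)

variable {D} {N m : ℕ} (ih : D.GoodBelow N m) {L : Type u} [Field L] [CharZero L]
  (hL : FunctionPyth N L) {φ : R →+* PowerSeries (PowerSeries L)} (hφ : Function.Injective φ)
  (hm : D.Colength φ m) (hp : ¬ ∃ γ ≠ 0, D.J.map φ = Ideal.span {γ})

include ih hL hφ hm hp

lemma GoodBelow.good_infinity :
    Good N (D.g.map ((diag (L := L) (PowerSeries.X : PowerSeries L) 1).toRingHom.comp φ))
      (D.f.map ((diag (L := L) (PowerSeries.X : PowerSeries L) 1).toRingHom.comp φ)) := by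
  have hev : evAt (0 : L) (X : L[X]) = PowerSeries.X := by rw [evAt_X]; simp
  have hP : (X : L[X]).Separable := separable_X
  have h0 : aeval (0 : L) (X : L[X]) = 0 := aeval_X _
  have hα : Function.Surjective (aeval (R := L) (0 : L)) := fun z => ⟨C z, by simp⟩
  have hinj := evAt_injective hP h0 irreducible_X
  have hψ : Function.Injective (diag (L := L) (PowerSeries.X : PowerSeries L) 1) := by
    rw [← hev]
    exact diag_one_right_injective _ hinj
  obtain ⟨m', hm', hc⟩ := hm.diag D hp hψ (ξ := PowerSeries.C PowerSeries.X)
    (by rw [diag_C_X, map_one, one_mul]) (by simp) (by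
      rw [← hev]
      exact exists_form_one_right _ hinj fun z v => evAt_dense hP h0 hα v z)
  exact ih m' hm' L hL _ (hψ.comp hφ) hc

lemma GoodBelow.good_point {P : L[X]} [hP : Fact (Irreducible P)] :
    Good N (D.g.map ((diag (L := L) 1 (evAt (L := L) (AdjoinRoot.root P) X)).toRingHom.comp φ))
      (D.f.map ((diag (L := L) 1 (evAt (L := L) (AdjoinRoot.root P) X)).toRingHom.comp φ)) := by
  replace hP := hP.out
  have : FiniteDimensional L (AdjoinRoot P) := (AdjoinRoot.powerBasis hP.ne_zero).finite
  have : CharZero (AdjoinRoot P) := charZero_of_injective_algebraMap (algebraMap L _).injective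
  have hα : Function.Surjective (aeval (R := L) (AdjoinRoot.root P)) := fun z => by
    obtain ⟨h, rfl⟩ := AdjoinRoot.mk_surjective z
    exact ⟨h, AdjoinRoot.aeval_eq h⟩
  have h0 : aeval (AdjoinRoot.root P) P = 0 := by rw [AdjoinRoot.aeval_eq, AdjoinRoot.mk_self]
  have hinj := evAt_injective hP.separable h0 hP
  have hψ := diag_one_left_injective _ hinj
  obtain ⟨m', hm', hc⟩ := hm.diag D hp hψ (ξ := PowerSeries.X)
    (by rw [diag_X, map_one, one_mul]) (by simp)
      (exists_form_one_left _ hinj fun z v => evAt_dense hP.separable h0 hα v z)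
  exact ih m' hm' (AdjoinRoot P) hL.of_finite _ (hψ.comp hφ) hc

end

end Datum

end

section

open Polynomial

/-- Gluing along a covering of a completed Rees ring by two others. -/
theorem Filt.good_of_cover {K : Type*} [Field K] [CharZero K] (A C : Filt K) (hA : (2 : K)⁻¹ ∈ A.A 0)
    (hC : (2 : K)⁻¹ ∈ C.A 0) (hadd : ∀ n y, ∃ a ∈ A.A n, ∃ b ∈ C.A n, y = a + b)
    (hπ : ∃ π ∈ C.A 0, π ≠ 0 ∧ ∀ ω, ∃ l₀, ∀ l ≥ l₀, π ^ l * ω ∈ C.A 0)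
    (hDA : ∀ m, ∀ a ∈ A.A m, a ≠ 0 → ∃ n, ∃ ρ ∈ A.A n, ρ ≠ 0 ∧ a * ρ ∈ C.A (m + n))
    (hDC : ∀ m, ∀ a ∈ C.A m, a ≠ 0 → ∃ n, ∃ ρ ∈ C.A n, ρ ≠ 0 ∧ a * ρ ∈ A.A (m + n))
    {R S₁ S₂ : Type*} [CommRing R] [CommRing S₁] [CommRing S₂]
    (Ψ : R →+* PowerSeries K) (hΨ : Function.Injective Ψ)
    (hr : ∀ p, p ∈ (A.inf C).rees ↔ p ∈ Ψ.range)
    (ψ₁ : R →+* S₁) (θ₁ : S₁ →+* PowerSeries K) (hθ₁ : Function.Injective θ₁)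
    (hm₁ : ∀ s, θ₁ s ∈ A.rees) (h₁ : θ₁.comp ψ₁ = Ψ)
    (ψ₂ : R →+* S₂) (θ₂ : S₂ →+* PowerSeries K) (hθ₂ : Function.Injective θ₂)
    (hm₂ : ∀ s, θ₂ s ∈ C.rees) (h₂ : θ₂.comp ψ₂ = Ψ)
    {g f : R[X]} (hg : g.Monic) (hf : ∃ r, r ≠ 0 ∧ ∃ f', g ∣ f * f' - Polynomial.C r)
    {N : ℕ} (hN : 3 ≤ N) (hg₁ : Good N (g.map ψ₁) (f.map ψ₁)) (hg₂ : Good N (g.map ψ₂) (f.map ψ₂)) :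
    Good N g f := by
  let Ψ' : R →+* (A.inf C).rees := Ψ.codRestrict _ fun s => (hr _).mpr ⟨s, rfl⟩
  have hΨ' : Function.Bijective Ψ' := by
    refine ⟨fun x y h => hΨ (congrArg Subtype.val h), fun y => ?_⟩
    obtain ⟨x, hx⟩ := (hr y.1).mp y.2
    exact ⟨x, Subtype.ext hx⟩
  let e := RingEquiv.ofBijective Ψ' hΨ'
  let θ₁' : S₁ →+* A.rees := θ₁.codRestrict _ hm₁
  let θ₂' : S₂ →+* C.rees := θ₂.codRestrict _ hm₂
  have e₁ : (Subring.inclusion (Filt.inf_le_left A C)).comp Ψ' = θ₁'.comp ψ₁ := by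
    ext1 x
    exact Subtype.ext (DFunLike.congr_fun h₁ x).symm
  have e₂ : (Subring.inclusion (Filt.inf_le_right A C)).comp Ψ' = θ₂'.comp ψ₂ := by
    ext1 x
    exact Subtype.ext (DFunLike.congr_fun h₂ x).symm
  have key : Good N (g.map Ψ') (f.map Ψ') := by
    refine Filt.good_rees A C hA hC hadd hπ hDA hDC (hg.map Ψ') ?_ hN ?_ ?_
    · obtain ⟨r, hr, f', h⟩ := hf
      refine ⟨Ψ' r, (map_ne_zero_iff Ψ' hΨ'.1).mpr hr, f'.map Ψ', ?_⟩
      have := Polynomial.map_dvd Ψ' h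
      rwa [Polynomial.map_sub, Polynomial.map_mul, map_C] at this
    · rw [Polynomial.map_map, Polynomial.map_map, e₁, ← Polynomial.map_map, ← Polynomial.map_map]
      exact hg₁.map θ₁' fun x y h => hθ₁ (congrArg Subtype.val h)
    · rw [Polynomial.map_map, Polynomial.map_map, e₂, ← Polynomial.map_map, ← Polynomial.map_map]
      exact hg₂.map θ₂' fun x y h => hθ₂ (congrArg Subtype.val h)
  have := key.map e.symm.toRingHom e.symm.injective
  have ee : e.symm.toRingHom.comp Ψ' = RingHom.id R := by
    ext1 x
    exact e.symm_apply_apply x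
  rwa [Polynomial.map_map, Polynomial.map_map, ee, Polynomial.map_id, Polynomial.map_id] at this

end

section

open Polynomial

lemma exists_X_pow_mul_eq_algebraMap {L E : Type*} [Field L] [Field E] [Algebra (PowerSeries L) E]
    [IsFractionRing (PowerSeries L) E] (y : E) :
    ∃ l p, algebraMap (PowerSeries L) E PowerSeries.X ^ l * y = algebraMap (PowerSeries L) E p := by
  obtain ⟨a, b, hb, rfl⟩ := IsFractionRing.div_surjective (A := PowerSeries L) y
  obtain ⟨l, w, hw, rfl⟩ := exists_eq_X_pow_mul_unit (nonZeroDivisors.ne_zero hb)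
  obtain ⟨w', hw'⟩ := hw.exists_right_inv
  refine ⟨l, a * w', ?_⟩
  have hx : algebraMap (PowerSeries L) E (PowerSeries.X ^ l * w) ≠ 0 :=
    IsFractionRing.to_map_ne_zero_of_mem_nonZeroDivisors hb
  rw [mul_div_assoc', div_eq_iff hx, ← map_pow, ← map_mul, ← map_mul]
  congr 1
  linear_combination -(a * PowerSeries.X ^ l) * hw'

lemma algebraMap_X_ne_zero {L E : Type*} [Field L] [Field E] [Algebra (PowerSeries L) E]
    [IsFractionRing (PowerSeries L) E] : algebraMap (PowerSeries L) E PowerSeries.X ≠ 0 :=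
  (map_ne_zero_iff _ (IsFractionRing.injective _ _)).mpr PowerSeries.X_ne_zero

section

variable {L E : Type*} [Field L] [Field E] [Algebra L E] [Algebra (PowerSeries L) E]
  [IsScalarTower L (PowerSeries L) E] [IsFractionRing (PowerSeries L) E]

variable (L E)

/-- The constant filtration by the polynomials in the inverse of the uniformiser. -/
noncomputable def polyFilt : Filt E where
  A _ := (aeval (R := L) (algebraMap (PowerSeries L) E PowerSeries.X)⁻¹).range.toSubring.toAddSubgroup
  one_mem := one_mem (aeval (R := L) (algebraMap (PowerSeries L) E PowerSeries.X)⁻¹).range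
  one_mem' := one_mem (aeval (R := L) (algebraMap (PowerSeries L) E PowerSeries.X)⁻¹).range
  mul_mem ha hb := mul_mem (S := Subalgebra L E) ha hb

/-- The filtration by the order of the pole. -/
noncomputable def poleFilt : Filt E where
  A n := (algebraMap (PowerSeries L) E).range.toAddSubgroup.comap
    (AddMonoidHom.mulLeft (algebraMap (PowerSeries L) E PowerSeries.X ^ n))
  one_mem := ⟨1, by simp⟩
  one_mem' := ⟨PowerSeries.X, by simp⟩
  mul_mem := by
    rintro i j a b ⟨p, hp⟩ ⟨q, hq⟩
    refine ⟨p * q, ?_⟩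
    rw [map_mul, hp, hq, AddMonoidHom.coe_mulLeft, AddMonoidHom.coe_mulLeft,
      AddMonoidHom.coe_mulLeft, pow_add]
    ring

variable {L E}

lemma mem_polyFilt {n : ℕ} {a : E} : a ∈ (polyFilt L E).A n ↔
    ∃ h : L[X], aeval (algebraMap (PowerSeries L) E PowerSeries.X)⁻¹ h = a := Iff.rfl

lemma mem_poleFilt {n : ℕ} {a : E} : a ∈ (poleFilt L E).A n ↔
    ∃ p, algebraMap (PowerSeries L) E p = algebraMap (PowerSeries L) E PowerSeries.X ^ n * a :=
  Iff.rfl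

/-- The sum of `h_i u ^ (d - i)`. -/
lemma X_pow_mul_aeval_inv (h : L[X]) {d : ℕ} (hd : h.natDegree ≤ d) :
    algebraMap (PowerSeries L) E PowerSeries.X ^ d *
      aeval (algebraMap (PowerSeries L) E PowerSeries.X)⁻¹ h =
    algebraMap (PowerSeries L) E
      (∑ i ∈ Finset.range (d + 1), PowerSeries.C (h.coeff i) * PowerSeries.X ^ (d - i)) := by
  have hu := algebraMap_X_ne_zero (L := L) (E := E)
  rw [aeval_eq_sum_range' (Nat.lt_succ_of_le hd), Finset.mul_sum, map_sum]
  refine Finset.sum_congr rfl fun i hi => ?_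
  have hi' : i ≤ d := Nat.lt_succ_iff.mp (Finset.mem_range.mp hi)
  rw [map_mul, map_pow, Algebra.smul_def, IsScalarTower.algebraMap_apply L (PowerSeries L) E,
    inv_pow, ← PowerSeries.algebraMap_eq]
  obtain ⟨k, rfl⟩ := Nat.exists_eq_add_of_le hi'
  rw [Nat.add_sub_cancel_left, pow_add]
  field_simp

lemma natDegree_le_of_mem_poleFilt {h : L[X]} {n : ℕ}
    (hn : aeval (algebraMap (PowerSeries L) E PowerSeries.X)⁻¹ h ∈ (poleFilt L E).A n) :
    h.natDegree ≤ n := by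
  by_contra! hlt
  obtain ⟨p, hp⟩ := mem_poleFilt.mp hn
  obtain ⟨k, hk⟩ := Nat.exists_eq_add_of_lt hlt
  have := X_pow_mul_aeval_inv (E := E) h le_rfl
  have e : algebraMap (PowerSeries L) E PowerSeries.X ^ h.natDegree =
      algebraMap (PowerSeries L) E PowerSeries.X ^ (k + 1) * algebraMap (PowerSeries L) E PowerSeries.X ^ n := by
    rw [← pow_add]; congr 1; omega
  rw [e, mul_assoc, ← hp, ← map_pow, ← map_mul] at this
  have h2 := congrArg PowerSeries.constantCoeff (IsFractionRing.injective (PowerSeries L) E this)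
  rw [map_mul, map_pow, PowerSeries.constantCoeff_X, zero_pow (Nat.succ_ne_zero k), zero_mul,
    Finset.sum_range_succ, map_add, map_sum, Finset.sum_eq_zero] at h2
  · have : h.leadingCoeff = 0 := by simpa using h2.symm
    rw [leadingCoeff_eq_zero] at this
    rw [this] at hlt
    simp at hlt
  · intro i hi
    have := Finset.mem_range.mp hi
    rw [map_mul, map_pow, PowerSeries.constantCoeff_X, zero_pow (by omega), mul_zero]

end

end

section

open Polynomial

section

variable {L E : Type*} [Field L] [Field E] [Algebra L E] [Algebra (PowerSeries L) E]
  [IsScalarTower L (PowerSeries L) E] [IsFractionRing (PowerSeries L) E]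

lemma diag_pole_mem_rees_iff (p : PowerSeries E) :
    p ∈ ((polyFilt L E).inf (poleFilt L E)).rees ↔
    p ∈ (diag (L := L) 1 (algebraMap (PowerSeries L) E PowerSeries.X)⁻¹).toRingHom.range := by
  have hu := algebraMap_X_ne_zero (L := L) (E := E)
  have hc (a : PowerSeries (PowerSeries L)) (n : ℕ) :
      PowerSeries.coeff n (diag (L := L) 1 (algebraMap (PowerSeries L) E PowerSeries.X)⁻¹ a) =
      aeval (algebraMap (PowerSeries L) E PowerSeries.X)⁻¹ (truncPoly n fun j =>
        PowerSeries.coeff j (PowerSeries.coeff (n - j) a)) := by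
    rw [coeff_diag]
    conv_lhs => rw [← aeval_X (R := L) (algebraMap (PowerSeries L) E PowerSeries.X)⁻¹]
    exact sum_antidiagonal_one_left (aeval (R := L) (algebraMap (PowerSeries L) E PowerSeries.X)⁻¹) n
      fun p => PowerSeries.coeff p.2 (PowerSeries.coeff p.1 a)
  constructor
  · intro hp
    have h1 (n : ℕ) : ∃ h : L[X], h.natDegree ≤ n ∧
        aeval (algebraMap (PowerSeries L) E PowerSeries.X)⁻¹ h = PowerSeries.coeff n p := by
      obtain ⟨h, hh⟩ := mem_polyFilt.mp (hp n).1
      exact ⟨h, natDegree_le_of_mem_poleFilt (E := E) (by rw [hh]; exact (hp n).2), hh⟩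
    choose h hd hh using h1
    refine ⟨PowerSeries.mk fun i => PowerSeries.mk fun j => (h (i + j)).coeff j, ?_⟩
    ext n
    refine (hc _ n).trans ?_
    rw [← hh n]
    conv_rhs => rw [← truncPoly_coeff (hd n)]
    unfold truncPoly
    refine congrArg _ (Finset.sum_congr rfl fun j hj => ?_)
    have := Finset.mem_range.mp hj
    dsimp only
    rw [PowerSeries.coeff_mk, PowerSeries.coeff_mk, Nat.sub_add_cancel (by omega)]
  · rintro ⟨a, rfl⟩ n
    refine ⟨mem_polyFilt.mpr ⟨_, (hc a n).symm⟩, mem_poleFilt.mpr ⟨?_, ?_⟩⟩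
    · exact ∑ i ∈ Finset.range (n + 1), PowerSeries.C ((truncPoly n fun j =>
        PowerSeries.coeff j (PowerSeries.coeff (n - j) a)).coeff i) * PowerSeries.X ^ (n - i)
    · refine Eq.trans ?_ (congrArg _ (hc a n).symm)
      exact (X_pow_mul_aeval_inv _ (natDegree_truncPoly_le _ _)).symm

lemma polyFilt_add_poleFilt (n : ℕ) (y : E) :
    ∃ a ∈ (polyFilt L E).A n, ∃ b ∈ (poleFilt L E).A n, y = a + b := by
  have hu := algebraMap_X_ne_zero (L := L) (E := E)
  obtain ⟨l, p, hp⟩ := exists_X_pow_mul_eq_algebraMap (L := L) y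
  obtain ⟨r, hr⟩ := exists_eq_sum_add_X_pow_mul l p
  refine ⟨_, mem_polyFilt.mpr ⟨∑ i ∈ Finset.range l, C (PowerSeries.coeff i p) * X ^ (l - i), rfl⟩,
    algebraMap (PowerSeries L) E r, mem_poleFilt.mpr ⟨PowerSeries.X ^ n * r, by
      rw [map_mul, map_pow]⟩, ?_⟩
  apply mul_left_cancel₀ (pow_ne_zero l hu)
  have he := congrArg (algebraMap (PowerSeries L) E) hr
  rw [map_add] at he
  rw [hp, he, mul_add, map_sum, map_sum, Finset.mul_sum]
  congr 1
  · refine Finset.sum_congr rfl fun i hi => ?_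
    obtain ⟨k, rfl⟩ := Nat.exists_eq_add_of_le (Finset.mem_range.mp hi).le
    rw [map_mul, map_mul, map_pow, map_pow, aeval_X, aeval_C, Nat.add_sub_cancel_left,
      IsScalarTower.algebraMap_apply L (PowerSeries L) E, ← PowerSeries.algebraMap_eq, pow_add]
    rw [inv_pow]
    field_simp
  · rw [map_mul, map_pow]

/-- Descent from the blow-up of the closed point: an affine chart and the point at infinity. -/
theorem good_of_affine_of_infinity [CharZero L] {N : ℕ} (hN : 3 ≤ N)
    {g f : (PowerSeries (PowerSeries L))[X]} (hg : g.Monic)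
    (hf : ∃ r, r ≠ 0 ∧ ∃ f', g ∣ f * f' - Polynomial.C r)
    (h₁ : Good N (g.map (diag (L := L) 1 (X : L[X])).toRingHom)
      (f.map (diag (L := L) 1 (X : L[X])).toRingHom))
    (h₂ : Good N (g.map (diag (L := L) (PowerSeries.X : PowerSeries L) 1).toRingHom)
      (f.map (diag (L := L) (PowerSeries.X : PowerSeries L) 1).toRingHom)) : Good N g f := by
  obtain ⟨E, _, _, _, _, _⟩ : ∃ (E : Type _) (_ : Field E) (_ : Algebra (PowerSeries L) E)
      (_ : Algebra L E) (_ : IsScalarTower L (PowerSeries L) E), IsFractionRing (PowerSeries L) E :=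
    ⟨FractionRing (PowerSeries L), inferInstance, inferInstance, inferInstance, inferInstance,
      inferInstance⟩
  have : CharZero E := charZero_of_injective_algebraMap (algebraMap L E).injective
  have hu := algebraMap_X_ne_zero (L := L) (E := E)
  have hι := IsFractionRing.injective (PowerSeries L) E
  have hev : Function.Injective (aeval (R := L) (algebraMap (PowerSeries L) E PowerSeries.X)⁻¹) := by
    rw [injective_iff_map_eq_zero]
    intro h hh
    by_contra hne
    have := natDegree_le_of_mem_poleFilt (E := E) (h := X * h) (n := 0)
      (by rw [map_mul, hh, mul_zero]; exact zero_mem _)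
    rw [natDegree_X_mul hne] at this
    omega
  let ι : PowerSeries L →ₐ[L] E := IsScalarTower.toAlgHom L (PowerSeries L) E
  refine Filt.good_of_cover (polyFilt L E) (poleFilt L E) ?_ ?_ polyFilt_add_poleFilt ?_ ?_ ?_
    (diag (L := L) 1 (algebraMap (PowerSeries L) E PowerSeries.X)⁻¹).toRingHom ?_
    diag_pole_mem_rees_iff _
    (PowerSeries.map (aeval (R := L) (algebraMap (PowerSeries L) E PowerSeries.X)⁻¹).toRingHom) ?_ ?_ ?_
    _ ((PowerSeries.rescale (algebraMap (PowerSeries L) E PowerSeries.X)⁻¹).comp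
      (PowerSeries.map ι.toRingHom)) ?_ ?_ ?_ hg hf hN h₁ h₂
  · exact mem_polyFilt.mpr ⟨C (2⁻¹ : L), by rw [aeval_C, map_inv₀, map_ofNat]⟩
  · exact mem_poleFilt.mpr ⟨PowerSeries.C (2⁻¹ : L), by
      rw [← PowerSeries.algebraMap_eq, ← IsScalarTower.algebraMap_apply, map_inv₀, map_ofNat,
        pow_zero, one_mul]⟩
  · refine ⟨_, mem_poleFilt.mpr ⟨PowerSeries.X, by rw [pow_zero, one_mul]⟩, hu, fun ω => ?_⟩
    obtain ⟨l₀, p, hp⟩ := exists_X_pow_mul_eq_algebraMap (L := L) ω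
    refine ⟨l₀, fun l hl => ?_⟩
    obtain ⟨k, rfl⟩ := Nat.exists_eq_add_of_le' hl
    exact mem_poleFilt.mpr ⟨PowerSeries.X ^ k * p, by
      rw [map_mul, map_pow, ← hp, pow_zero, one_mul, pow_add, mul_assoc]⟩
  · intro m a ha ha0
    obtain ⟨h, rfl⟩ := mem_polyFilt.mp ha
    refine ⟨h.natDegree, 1, mem_polyFilt.mpr ⟨1, map_one _⟩, one_ne_zero, mem_poleFilt.mpr ⟨?_, ?_⟩⟩
    · exact PowerSeries.X ^ m * (∑ i ∈ Finset.range (h.natDegree + 1),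
        PowerSeries.C (h.coeff i) * PowerSeries.X ^ (h.natDegree - i))
    · rw [map_mul, ← X_pow_mul_aeval_inv h le_rfl, map_pow, mul_one, pow_add, mul_assoc]
  · intro m c hc hc0
    obtain ⟨p, hp⟩ := mem_poleFilt.mp hc
    have hp0 : p ≠ 0 := by
      rintro rfl
      rw [map_zero] at hp
      exact mul_ne_zero (pow_ne_zero m hu) hc0 hp.symm
    obtain ⟨v, w, hw, rfl⟩ := exists_eq_X_pow_mul_unit hp0
    obtain ⟨w', hw'⟩ := hw.exists_right_inv
    have hw0 : w' ≠ 0 := by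
      rintro rfl
      simp at hw'
    refine ⟨v, algebraMap (PowerSeries L) E w' * (algebraMap (PowerSeries L) E PowerSeries.X)⁻¹ ^ v,
      mem_poleFilt.mpr ⟨w', ?_⟩,
      mul_ne_zero ((map_ne_zero_iff _ hι).mpr hw0) (pow_ne_zero _ (inv_ne_zero hu)),
      mem_polyFilt.mpr ⟨X ^ m, ?_⟩⟩
    · rw [mul_comm, mul_assoc, ← mul_pow, inv_mul_cancel₀ hu, one_pow, mul_one]
    · have h1 := congrArg (algebraMap (PowerSeries L) E) hw'
      rw [map_mul, map_one] at h1
      rw [map_mul, map_pow] at hp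
      rw [map_pow, aeval_X]
      apply mul_left_cancel₀ (pow_ne_zero m hu)
      rw [← mul_pow, mul_inv_cancel₀ hu, one_pow, ← mul_assoc, ← hp, inv_pow]
      have := pow_ne_zero v hu
      field_simp
      exact h1.symm
  · have := diag_one_left_injective _ hev
    rwa [aeval_X] at this
  · exact PowerSeries.map_injective _ hev
  · intro s n
    exact mem_polyFilt.mpr ⟨PowerSeries.coeff n s, (PowerSeries.coeff_map _ n s).symm⟩
  · ext1 a
    have := map_diag (aeval (R := L) (algebraMap (PowerSeries L) E PowerSeries.X)⁻¹) 1 X a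
    rw [map_one, aeval_X] at this
    exact this
  · intro p q h
    have h2 := congrArg (PowerSeries.rescale (algebraMap (PowerSeries L) E PowerSeries.X)) h
    rw [RingHom.comp_apply, RingHom.comp_apply] at h2
    rw [PowerSeries.rescale_rescale, PowerSeries.rescale_rescale, inv_mul_cancel₀ hu,
      PowerSeries.rescale_one, RingHom.id_apply, RingHom.id_apply] at h2
    exact PowerSeries.map_injective _ hι h2
  · intro s n
    refine mem_poleFilt.mpr ⟨PowerSeries.coeff n s, ?_⟩
    rw [RingHom.comp_apply, PowerSeries.coeff_rescale, PowerSeries.coeff_map, ← mul_assoc, ← mul_pow,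
      mul_inv_cancel₀ hu, one_pow, one_mul]
    rfl
  · ext1 a
    have := map_diag ι PowerSeries.X 1 a
    refine (congrArg (PowerSeries.rescale (algebraMap (PowerSeries L) E PowerSeries.X)⁻¹) this).trans ?_
    rw [rescale_diag, map_one, mul_one]
    exact congrArg (fun z => diag (L := L) z _ a) (inv_mul_cancel₀ hu)

end

end

section

open Polynomial

section

variable {L E : Type*} [Field L] [Field E] [Algebra L E]

/-- The localisation of the polynomial ring away from `b`, as a subalgebra of a field. -/
def awaySub (ev : L[X] →ₐ[L] E) (b : L[X]) : Subalgebra L E where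
  carrier := {z | ∃ k h, ev b ^ k * z = ev h}
  mul_mem' := by
    rintro a c ⟨k, h, hk⟩ ⟨k', h', hk'⟩
    exact ⟨k + k', h * h', by rw [map_mul, ← hk, ← hk', pow_add]; ring⟩
  add_mem' := by
    rintro a c ⟨k, h, hk⟩ ⟨k', h', hk'⟩
    exact ⟨k + k', b ^ k' * h + b ^ k * h', by
      rw [map_add, map_mul, map_mul, map_pow, map_pow, ← hk, ← hk', pow_add]; ring⟩
  algebraMap_mem' r := ⟨0, C r, by rw [pow_zero, one_mul, algHom_C]⟩

lemma ev_mem_awaySub (ev : L[X] →ₐ[L] E) (b h : L[X]) : ev h ∈ awaySub ev b :=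
  ⟨0, h, by rw [pow_zero, one_mul]⟩

lemma awaySub_le_mul (ev : L[X] →ₐ[L] E) (b c : L[X]) : awaySub ev b ≤ awaySub ev (b * c) := by
  rintro z ⟨k, h, hk⟩
  exact ⟨k, c ^ k * h, by rw [map_mul, map_mul, map_pow, mul_pow, ← hk]; ring⟩

/-- A subring as a constant filtration. -/
def Filt.const (S : Subring E) : Filt E where
  A _ := S.toAddSubgroup
  one_mem := S.one_mem
  one_mem' := S.one_mem
  mul_mem ha hb := S.mul_mem ha hb

lemma Filt.mem_const {S : Subring E} {n : ℕ} {a : E} : a ∈ (Filt.const S).A n ↔ a ∈ S := Iff.rfl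

end

section

variable {L κ E : Type*} [Field L] [Field κ] [Algebra L κ] [Field E] [Algebra L E]
  [Algebra (PowerSeries κ) E] [IsScalarTower L (PowerSeries κ) E] 
  {P : L[X]} {α : κ}

variable (E) in
/-- Evaluation at a point, in the field of fractions of the completion. -/
noncomputable def evFrac (α : κ) : L[X] →ₐ[L] E :=
  (IsScalarTower.toAlgHom L (PowerSeries κ) E).comp (evAt α)

lemma evFrac_apply (α : κ) (h : L[X]) :
    evFrac E α h = algebraMap (PowerSeries κ) E (evAt α h) := rfl

lemma isUnit_evAt_of_not_dvd (hP : P.Separable) (h0 : aeval α P = 0) (hPi : Irreducible P)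
    {h : L[X]} (hd : ¬ P ∣ h) : IsUnit (evAt α h) := by
  obtain ⟨v, k, u, rfl, hk, hu, he⟩ := evAt_ne_zero_of_irreducible hP h0 hPi (h := h)
    (by rintro rfl; exact hd (dvd_zero P))
  cases v with
  | zero => rw [he, pow_zero, one_mul]; exact hu
  | succ v => exact absurd ((Dvd.intro _ (pow_succ' P v).symm).mul_right k) hd

variable [IsFractionRing (PowerSeries κ) E]

lemma mem_awaySub_iff (hP : P.Separable) (h0 : aeval α P = 0) (hPi : Irreducible P) {b : L[X]}
    (hb : ¬ P ∣ b) {z : E} : z ∈ awaySub (evFrac E α) b ↔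
      z ∈ awaySub (evFrac E α) (b * P) ∧ z ∈ (algebraMap (PowerSeries κ) E).range := by
  have hι := IsFractionRing.injective (PowerSeries κ) E
  have hbu := isUnit_evAt_of_not_dvd hP h0 hPi hb
  constructor
  · intro hz
    refine ⟨awaySub_le_mul _ b P hz, ?_⟩
    obtain ⟨k, h, hk⟩ := hz
    obtain ⟨w, hw⟩ := (hbu.pow k).exists_left_inv
    refine ⟨w * evAt α h, ?_⟩
    rw [map_mul, ← evFrac_apply, ← hk, evFrac_apply, ← mul_assoc, ← map_pow, ← map_mul, hw, map_one,
      one_mul]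
  · rintro ⟨⟨k, h, hk⟩, y, rfl⟩
    rcases eq_or_ne h 0 with rfl | hh
    · refine ⟨k, 0, ?_⟩
      have hP0 : evFrac E α P ≠ 0 := by
        rw [evFrac_apply]
        exact (map_ne_zero_iff _ hι).mpr ((map_ne_zero_iff _ (evAt_injective hP h0 hPi)).mpr
          hPi.ne_zero)
      rw [map_zero] at hk ⊢
      rw [map_mul, mul_pow] at hk
      apply mul_left_cancel₀ (pow_ne_zero k hP0)
      rw [mul_zero, ← hk]
      ring
    · obtain ⟨v, k', u, rfl, hk', hu, he⟩ := evAt_ne_zero_of_irreducible hP h0 hPi hh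
      obtain ⟨w, hw, hPw⟩ := exists_evAt_eq hP h0
      have h1 : (evAt α b * (PowerSeries.X * w)) ^ k * y = PowerSeries.X ^ v * u := by
        apply hι
        rw [← he, map_mul, map_pow, ← hPw, ← map_mul (evAt α), ← evFrac_apply, ← evFrac_apply]
        exact hk
      have hvk : k ≤ v := by
        have : (PowerSeries.X : PowerSeries κ) ^ k ∣ PowerSeries.X ^ v := by
          obtain ⟨u', hu'⟩ := hu.exists_right_inv
          refine ⟨evAt α b ^ k * w ^ k * y * u', ?_⟩
          linear_combination (-(u' : PowerSeries κ)) * h1 - PowerSeries.X ^ v * hu'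
        exact (pow_dvd_pow_iff PowerSeries.X_ne_zero PowerSeries.X_prime.not_isUnit).mp this
      obtain ⟨j, rfl⟩ := Nat.exists_eq_add_of_le hvk
      refine ⟨k, P ^ j * k', ?_⟩
      have hP0 : evFrac E α P ≠ 0 := by
        rw [evFrac_apply]
        exact (map_ne_zero_iff _ hι).mpr ((map_ne_zero_iff _ (evAt_injective hP h0 hPi)).mpr
          hPi.ne_zero)
      apply mul_left_cancel₀ (pow_ne_zero k hP0)
      rw [← map_pow (evFrac E α) P, ← map_mul (evFrac E α), ← mul_assoc (P ^ k), ← pow_add, ← hk,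
        map_mul, map_pow]
      ring

lemma awaySub_add (hP : P.Separable) (h0 : aeval α P = 0) 
    (hα : Function.Surjective (aeval (R := L) α)) (b : L[X]) (y : E) :
    ∃ a ∈ awaySub (evFrac E α) (b * P), ∃ c ∈ (algebraMap (PowerSeries κ) E).range, y = a + c := by
  obtain ⟨l, p, hp⟩ := exists_X_pow_mul_eq_algebraMap (L := κ) y
  obtain ⟨u, hu, hPu⟩ := exists_evAt_eq hP h0
  obtain ⟨h, r, hr⟩ := evAt_dense hP h0 hα l (u ^ l * p)
  obtain ⟨w, hw⟩ := (hu.pow l).exists_right_inv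
  refine ⟨y - algebraMap (PowerSeries κ) E (r * w), ⟨l, b ^ l * h, ?_⟩, _, ⟨r * w, rfl⟩,
    (sub_add_cancel _ _).symm⟩
  have e1 : evFrac E α P ^ l * y = algebraMap (PowerSeries κ) E (u ^ l * p) := by
    rw [evFrac_apply, hPu, map_mul, mul_pow, map_mul, ← hp, map_pow]
    ring
  have e2 : evFrac E α P ^ l * algebraMap (PowerSeries κ) E (r * w) =
      algebraMap (PowerSeries κ) E (u ^ l * p) - evFrac E α h := by
    rw [evFrac_apply, evFrac_apply, ← map_sub, hr, hPu, ← map_pow, ← map_mul]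
    congr 1
    linear_combination PowerSeries.X ^ l * r * hw
  rw [map_mul, mul_pow, map_mul (evFrac E α), map_pow]
  linear_combination evFrac E α b ^ l * e1 - evFrac E α b ^ l * e2

end

end

section

open Polynomial

section

variable (L : Type*) [Field L]

/-- Polynomials as rational functions. -/
noncomputable def evRat : L[X] →ₐ[L] RatFunc L := IsScalarTower.toAlgHom L L[X] (RatFunc L)

lemma evRat_injective : Function.Injective (evRat L) := IsFractionRing.injective L[X] (RatFunc L)

variable {L}

/-- An affine chart of the blow-up, away from the points where `b` vanishes. -/
noncomputable def chart (b : L[X]) :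
    PowerSeries (PowerSeries L) →ₐ[L] PowerSeries (awaySub (evRat L) b) :=
  diag 1 ⟨evRat L X, ev_mem_awaySub _ _ _⟩

lemma map_chart {b : L[X]} {B : Type*} [CommRing B] [Algebra L B] (τ : awaySub (evRat L) b →ₐ[L] B) :
    (PowerSeries.map τ.toRingHom).comp (chart b).toRingHom =
      (diag (L := L) 1 (τ ⟨evRat L X, ev_mem_awaySub _ _ _⟩)).toRingHom := by
  ext1 a
  refine (map_diag τ 1 _ a).trans ?_
  rw [map_one]
  rfl

lemma chart_injective (b : L[X]) : Function.Injective (chart b) := by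
  intro x y h
  have := congrArg (PowerSeries.map (awaySub (evRat L) b).val.toRingHom) h
  have h2 (x) := DFunLike.congr_fun (map_chart (awaySub (evRat L) b).val) x
  have h3 := ((h2 x).symm.trans this).trans (h2 y)
  exact diag_one_left_injective _ (evRat_injective L) h3

end

/-- Adding a point to an affine chart. -/
theorem good_chart_of_mul {L κ : Type*} [Field L] [CharZero L] [Field κ] [Algebra L κ] {P : L[X]}
    {α : κ} (hP : P.Separable) (h0 : aeval α P = 0) (hPi : Irreducible P)
    (hα : Function.Surjective (aeval (R := L) α)) {b : L[X]} (hb : ¬ P ∣ b)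
    {N : ℕ} (hN : 3 ≤ N) {g f : (PowerSeries (PowerSeries L))[X]} (hg : g.Monic)
    (hf : ∃ r, r ≠ 0 ∧ ∃ f', g ∣ f * f' - Polynomial.C r)
    (h₁ : Good N (g.map (chart (b * P)).toRingHom) (f.map (chart (b * P)).toRingHom))
    (h₂ : Good N (g.map (diag (L := L) 1 (evAt (L := L) α X)).toRingHom)
      (f.map (diag (L := L) 1 (evAt (L := L) α X)).toRingHom)) :
    Good N (g.map (chart b).toRingHom) (f.map (chart b).toRingHom) := by
  obtain ⟨E, _, _, _, _, _⟩ : ∃ (E : Type _) (_ : Field E) (_ : Algebra (PowerSeries κ) E)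
      (_ : Algebra L E) (_ : IsScalarTower L (PowerSeries κ) E), IsFractionRing (PowerSeries κ) E :=
    ⟨FractionRing (PowerSeries κ), inferInstance, inferInstance, inferInstance, inferInstance,
      inferInstance⟩
  have : CharZero E := charZero_of_injective_algebraMap (algebraMap L E).injective
  have hu := algebraMap_X_ne_zero (L := κ) (E := E)
  have hι := IsFractionRing.injective (PowerSeries κ) E
  have hev : Function.Injective (evFrac (L := L) E α) := hι.comp (evAt_injective hP h0 hPi)
  obtain ⟨τ, hτ⟩ : ∃ τ : RatFunc L →ₐ[L] E, ∀ h, τ (evRat L h) = evFrac E α h :=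
    ⟨IsFractionRing.liftAlgHom hev, fun h => IsFractionRing.lift_algebraMap hev h⟩
  have hτi : Function.Injective τ := τ.toRingHom.injective
  have hmem {b : L[X]} (hb : b ≠ 0) (z : E) : z ∈ awaySub (evFrac (L := L) E α) b ↔
      ∃ y ∈ awaySub (evRat L) b, τ y = z := by
    constructor
    · rintro ⟨k, h, hk⟩
      have hb1 : evRat L b ≠ 0 := (map_ne_zero_iff _ (evRat_injective L)).mpr hb
      have hb2 : evFrac E α b ≠ 0 := (map_ne_zero_iff _ hev).mpr hb
      refine ⟨evRat L h / evRat L b ^ k, ⟨k, h, mul_div_cancel₀ _ (pow_ne_zero k hb1)⟩, ?_⟩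
      rw [map_div₀, map_pow, hτ, hτ, ← hk, mul_div_cancel_left₀ _ (pow_ne_zero k hb2)]
    · rintro ⟨y, ⟨k, h, hk⟩, rfl⟩
      exact ⟨k, h, by rw [← hτ, ← map_pow, ← map_mul, hk, hτ]⟩
  have hb0 : b ≠ 0 := by
    rintro rfl
    exact hb (dvd_zero P)
  have hbP : b * P ≠ 0 := mul_ne_zero hb0 hPi.ne_zero
  let ι : PowerSeries κ →ₐ[L] E := IsScalarTower.toAlgHom L (PowerSeries κ) E
  have hr {z : RatFunc L} (hz : z ∈ awaySub (evRat L) b) : τ z ∈ ι.range :=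
    ((mem_awaySub_iff hP h0 hPi hb).mp ((hmem hb0 _).mpr ⟨z, hz, rfl⟩)).2
  let σ : awaySub (evRat L) b →ₐ[L] ι.range :=
    (τ.comp (awaySub (evRat L) b).val).codRestrict _ fun z => hr z.2
  have hbu := isUnit_evAt_of_not_dvd hP h0 hPi hb
  refine Filt.good_of_cover (Filt.const (awaySub (evFrac E α) (b * P)).toSubring)
    (Filt.const (algebraMap (PowerSeries κ) E).range) ?_ ?_ (fun _ => awaySub_add hP h0 hα b) ?_ ?_ ?_
    (PowerSeries.map (τ.comp (awaySub (evRat L) b).val).toRingHom) ?_ ?_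
    (PowerSeries.map (Subalgebra.inclusion (awaySub_le_mul (evRat L) b P)).toRingHom)
    (PowerSeries.map (τ.comp (awaySub (evRat L) (b * P)).val).toRingHom) ?_ ?_ ?_
    (PowerSeries.map σ.toRingHom) (PowerSeries.map ι.range.val.toRingHom) ?_ ?_ ?_
    (hg.map _) ?_ hN ?_ ?_
  · refine Filt.mem_const.mpr ⟨0, C 2⁻¹, ?_⟩
    rw [algHom_C, map_inv₀, map_ofNat, pow_zero, one_mul]
  · exact Filt.mem_const.mpr ⟨PowerSeries.C (2⁻¹ : κ), by
      have : CharZero κ := charZero_of_injective_algebraMap (algebraMap L κ).injective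
      refine eq_inv_of_mul_eq_one_left ?_
      rw [← map_ofNat (algebraMap (PowerSeries κ) E) 2, ← map_mul, ← map_ofNat PowerSeries.C 2,
        ← map_mul, inv_mul_cancel₀ two_ne_zero, map_one, map_one]⟩
  · refine ⟨_, Filt.mem_const.mpr ⟨PowerSeries.X, rfl⟩, hu, fun ω => ?_⟩
    obtain ⟨l₀, p, hp⟩ := exists_X_pow_mul_eq_algebraMap (L := κ) ω
    refine ⟨l₀, fun l hl => ?_⟩
    obtain ⟨k, rfl⟩ := Nat.exists_eq_add_of_le' hl
    exact Filt.mem_const.mpr ⟨PowerSeries.X ^ k * p, by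
      rw [map_mul, map_pow, ← hp, pow_add, mul_assoc]⟩
  · rintro m a ⟨k, h, hk⟩ -
    refine ⟨0, evFrac E α P ^ k, ⟨0, P ^ k, by rw [pow_zero, one_mul, map_pow]⟩,
      pow_ne_zero _ ((map_ne_zero_iff _ hev).mpr hPi.ne_zero), Filt.mem_const.mpr ?_⟩
    obtain ⟨w, hw⟩ := (hbu.pow k).exists_left_inv
    refine ⟨w * evAt α h, ?_⟩
    have hw' := congrArg (algebraMap (PowerSeries κ) E) hw
    rw [map_mul, map_pow, map_one, ← evFrac_apply] at hw'
    rw [map_mul, mul_pow] at hk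
    rw [map_mul, ← evFrac_apply, ← hk]
    linear_combination a * evFrac E α P ^ k * hw'
  · rintro m a ⟨p, rfl⟩ ha
    have hp0 : p ≠ 0 := by
      rintro rfl
      exact ha (map_zero _)
    obtain ⟨v, w, hw, rfl⟩ := exists_eq_X_pow_mul_unit hp0
    obtain ⟨w', hw'⟩ := hw.exists_right_inv
    obtain ⟨u, hu', hPu⟩ := exists_evAt_eq hP h0
    have hw0 : w' ≠ 0 := by
      rintro rfl
      simp at hw'
    refine ⟨0, algebraMap (PowerSeries κ) E (u ^ v * w'), ⟨_, rfl⟩, (map_ne_zero_iff _ hι).mpr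
      (mul_ne_zero (pow_ne_zero _ hu'.ne_zero) hw0), Filt.mem_const.mpr ⟨0, P ^ v, ?_⟩⟩
    rw [pow_zero, one_mul, map_pow, evFrac_apply, hPu, ← map_mul, ← map_pow]
    congr 1
    linear_combination PowerSeries.X ^ v * u ^ v * hw'
  · exact PowerSeries.map_injective _ (hτi.comp Subtype.val_injective)
  · intro p
    constructor
    · intro hp
      have h1 (n : ℕ) := (hmem hb0 _).mp ((mem_awaySub_iff hP h0 hPi hb).mpr (hp n))
      choose y hy hyp using h1
      refine ⟨PowerSeries.mk fun n => ⟨y n, hy n⟩, ?_⟩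
      ext n
      rw [PowerSeries.coeff_map, PowerSeries.coeff_mk]
      exact hyp n
    · rintro ⟨q, rfl⟩ n
      rw [PowerSeries.coeff_map]
      exact (mem_awaySub_iff hP h0 hPi hb).mp ((hmem hb0 _).mpr ⟨_, (PowerSeries.coeff n q).2, rfl⟩)
  · exact PowerSeries.map_injective _ (hτi.comp Subtype.val_injective)
  · intro s n
    rw [PowerSeries.coeff_map]
    exact (hmem hbP _).mpr ⟨_, (PowerSeries.coeff n s).2, rfl⟩
  · ext a n
    rw [RingHom.comp_apply, PowerSeries.coeff_map, PowerSeries.coeff_map, PowerSeries.coeff_map]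
    rfl
  · exact PowerSeries.map_injective _ Subtype.val_injective
  · intro s n
    rw [PowerSeries.coeff_map]
    exact (PowerSeries.coeff n s).2
  · ext a n
    rw [RingHom.comp_apply, PowerSeries.coeff_map, PowerSeries.coeff_map, PowerSeries.coeff_map]
    rfl
  · obtain ⟨r, hr, f', h⟩ := hf
    refine ⟨_, (map_ne_zero_iff (chart b).toRingHom (chart_injective b)).mpr hr,
      f'.map (chart b).toRingHom, ?_⟩
    have := Polynomial.map_dvd (chart b).toRingHom h
    rwa [Polynomial.map_sub, Polynomial.map_mul, map_C] at this
  · rw [Polynomial.map_map, Polynomial.map_map, map_chart]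
    exact h₁
  · rw [Polynomial.map_map, Polynomial.map_map, map_chart]
    have h3 := h₂.map (PowerSeries.map ι.rangeRestrict.toRingHom)
      (PowerSeries.map_injective _ fun x y h => hι (congrArg Subtype.val h))
    rw [Polynomial.map_map, Polynomial.map_map] at h3
    have e : (PowerSeries.map ι.rangeRestrict.toRingHom).comp
        (diag (L := L) 1 (evAt (L := L) α X)).toRingHom =
        (diag 1 (σ ⟨evRat L X, ev_mem_awaySub _ _ _⟩)).toRingHom := by
      ext1 a
      refine (map_diag ι.rangeRestrict 1 _ a).trans ?_
      rw [map_one]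
      refine congrArg (fun z => diag (L := L) 1 z a) (Subtype.ext ?_)
      exact (hτ X).symm
    rwa [e] at h3

end

section

open Polynomial

/-- An approximate representation as a sum of squares can be corrected. -/
lemma good_of_approx {S : Type*} [CommRing S] [Nontrivial S] (h2 : ∃ r : S, r * 2 = 1)
    {g f : (PowerSeries S)[X]} (hg : g.Monic) {f' : (PowerSeries S)[X]} {h : PowerSeries S} {e : ℕ}
    (hf : g ∣ f * f' - C (PowerSeries.X ^ e * h)) (hh : IsUnit h) {N m : ℕ}
    (v : Fin N → (PowerSeries S)[X]) (y : (PowerSeries S)[X])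
    (hv : g ∣ (∑ i, v i ^ 2 - C (PowerSeries.X ^ (2 * m)) * f) - C (PowerSeries.X ^ (2 * m + e + 1)) * y) :
    Good N g f := by
  have hA : XComplete (PowerSeries.X : PowerSeries S) (AdjoinRoot g) :=
    (xComplete_powerSeries S).adjoinRoot hg
  obtain ⟨h', hh'⟩ := hh.exists_right_inv
  obtain ⟨z, hz, -⟩ := hA.exists_sq (exists_half_powerSeries h2)
    (AdjoinRoot.mk g f' * AdjoinRoot.of g h' * AdjoinRoot.mk g y)
  obtain ⟨w, hw, -⟩ := hA.exists_mul_one_add z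
  have hs (a : AdjoinRoot g) : (PowerSeries.X : PowerSeries S) • a = AdjoinRoot.of g PowerSeries.X * a := by
    rw [Algebra.smul_def, AdjoinRoot.algebraMap_eq]
  rw [hs] at hz
  rw [hs, hs] at hw
  rw [hs] at hz
  have e1 : AdjoinRoot.of g h * AdjoinRoot.of g h' = 1 := by rw [← map_mul, hh', map_one]
  have e2 : AdjoinRoot.mk g f * AdjoinRoot.mk g f' =
      AdjoinRoot.of g PowerSeries.X ^ e * AdjoinRoot.of g h := by
    rw [← map_mul, ← map_pow, ← map_mul, ← AdjoinRoot.mk_C]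
    exact AdjoinRoot.mk_eq_mk.mpr hf
  have e3 : ∑ i, AdjoinRoot.mk g (v i) ^ 2 = AdjoinRoot.of g PowerSeries.X ^ (2 * m) * AdjoinRoot.mk g f +
      AdjoinRoot.of g PowerSeries.X ^ (2 * m + e + 1) * AdjoinRoot.mk g y := by
    rw [← AdjoinRoot.mk_eq_zero] at hv
    rw [map_sub, map_sub, map_sum, map_mul, map_mul, AdjoinRoot.mk_C, AdjoinRoot.mk_C, map_pow, map_pow] at hv
    simp only [map_pow] at hv
    linear_combination hv
  rw [good_iff]
  refine ⟨PowerSeries.X ^ m, fun h0 => ?_, fun i => (1 + AdjoinRoot.of g PowerSeries.X * w) *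
    AdjoinRoot.mk g (v i), ?_⟩
  · have := congrArg (PowerSeries.coeff m) h0
    rw [PowerSeries.coeff_X_pow_self, map_zero] at this
    exact one_ne_zero this
  · have e4 : (fun i => (1 + AdjoinRoot.of g PowerSeries.X * w) * AdjoinRoot.mk g (v i)) ⬝ᵥ
        (fun i => (1 + AdjoinRoot.of g PowerSeries.X * w) * AdjoinRoot.mk g (v i)) =
        (1 + AdjoinRoot.of g PowerSeries.X * w) ^ 2 * ∑ i, AdjoinRoot.mk g (v i) ^ 2 := by
      rw [dotProduct, Finset.mul_sum]
      exact Finset.sum_congr rfl fun i _ => by ring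
    rw [e4, e3, map_pow]
    generalize AdjoinRoot.of g PowerSeries.X = x at *
    generalize AdjoinRoot.mk g f = F at *
    generalize AdjoinRoot.mk g f' = F' at *
    generalize AdjoinRoot.mk g y = Y at *
    generalize AdjoinRoot.of g h = H at *
    generalize AdjoinRoot.of g h' = H' at *
    have e5 : x ^ (2 * m) * F + x ^ (2 * m + e + 1) * Y =
        x ^ (2 * m) * F * ((1 + x * z) * (1 + x * z)) := by
      rw [hz]
      linear_combination (-(x ^ (2 * m + 1) * H' * Y)) * e2 - x ^ (2 * m + e + 1) * Y * e1
    rw [e5]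
    linear_combination (x ^ (2 * m) * F) * ((1 + x * z) * (1 + x * w) + 1) * hw

/-- Divisibility by a power of the variable descends along injections. -/
lemma exists_dvd_sub_of_map {S S' : Type*} [CommRing S] [CommRing S'] (σ : S →+* S')
    (hσ : Function.Injective σ) {g p : (PowerSeries S)[X]} (hg : g.Monic) {M : ℕ}
    {y' : (PowerSeries S')[X]}
    (h : g.map (PowerSeries.map σ) ∣ p.map (PowerSeries.map σ) - C (PowerSeries.X ^ M) * y') :
    ∃ y, g ∣ p - C (PowerSeries.X ^ M) * y := by
  have h1 : C (PowerSeries.X ^ M) ∣ p %ₘ g := by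
    rw [C_dvd_iff_dvd_coeff]
    intro i
    rw [PowerSeries.X_pow_dvd_iff]
    intro j hj
    apply hσ
    have e : (p %ₘ g).map (PowerSeries.map σ) =
        C (PowerSeries.X ^ M) * (y' %ₘ g.map (PowerSeries.map σ)) := by
      rw [map_modByMonic _ hg, ← smul_eq_C_mul, ← smul_modByMonic, smul_eq_C_mul]
      rwa [← modByMonic_eq_zero_iff_dvd (hg.map _), sub_modByMonic, sub_eq_zero] at h
    have := congrArg (fun q => PowerSeries.coeff j (q.coeff i)) e
    simp only [coeff_map, PowerSeries.coeff_map, coeff_C_mul] at this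
    rw [this, map_zero]
    exact PowerSeries.X_pow_dvd_iff.mp (dvd_mul_right _ _) j hj
  obtain ⟨y, hy⟩ := h1
  exact ⟨y, p /ₘ g, by rw [← hy, sub_eq_iff_eq_add, add_comm, modByMonic_add_div]⟩

/-- Polynomials with power series coefficients can be approximated with finitely many
denominators. -/
lemma exists_approx {L : Type*} [Field L] {N : ℕ} (M : ℕ) (v : Fin N → (PowerSeries (RatFunc L))[X]) :
    ∃ b : L[X], b ≠ 0 ∧ ∀ c, ∃ w : Fin N → (PowerSeries (awaySub (evRat L) (b * c)))[X],
      ∀ i, C (PowerSeries.X ^ M) ∣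
        v i - (w i).map (PowerSeries.map (awaySub (evRat L) (b * c)).val.toRingHom) := by
  obtain ⟨D, hD⟩ : ∃ D, ∀ i k, D ≤ k → (v i).coeff k = 0 :=
    ⟨Finset.univ.sup (fun i => (v i).natDegree) + 1, fun i k hk => coeff_eq_zero_of_natDegree_lt
      ((Finset.le_sup (f := fun i => (v i).natDegree) (Finset.mem_univ i)).trans_lt hk)⟩
  obtain ⟨b, hb⟩ := IsLocalization.exist_integer_multiples (nonZeroDivisors L[X])
    (Finset.univ ×ˢ (Finset.range D ×ˢ Finset.range M) : Finset (Fin N × ℕ × ℕ))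
    (fun x => PowerSeries.coeff x.2.2 ((v x.1).coeff x.2.1))
  refine ⟨b, nonZeroDivisors.ne_zero b.2, fun c => ?_⟩
  have h1 (i : Fin N) (k j : ℕ) : ∃ t : awaySub (evRat L) (b * c), k < D → j < M →
      (t : RatFunc L) = PowerSeries.coeff j ((v i).coeff k) := by
    by_cases hkj : k < D ∧ j < M
    · obtain ⟨h, hh⟩ := hb (i, k, j) (Finset.mem_product.mpr ⟨Finset.mem_univ _,
        Finset.mem_product.mpr ⟨Finset.mem_range.mpr hkj.1, Finset.mem_range.mpr hkj.2⟩⟩)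
      refine ⟨⟨_, awaySub_le_mul _ _ _ ⟨1, h, ?_⟩⟩, fun _ _ => rfl⟩
      rw [pow_one]
      exact ((Algebra.smul_def _ _).symm.trans hh.symm)
    · exact ⟨0, fun h1 h2 => absurd ⟨h1, h2⟩ hkj⟩
  choose t ht using h1
  refine ⟨fun i => ∑ k ∈ Finset.range D, monomial k (PowerSeries.mk (t i k)), fun i => ?_⟩
  rw [C_dvd_iff_dvd_coeff]
  intro k
  rw [PowerSeries.X_pow_dvd_iff]
  intro j hj
  rw [coeff_sub, coeff_map, finsetSum_coeff]
  simp only [coeff_monomial]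
  rw [Finset.sum_ite_eq' , map_sub, PowerSeries.coeff_map]
  split_ifs with hk
  · rw [PowerSeries.coeff_mk, ← ht i k j (Finset.mem_range.mp hk) hj]
    exact sub_self _
  · rw [hD i k (by simpa using hk)]
    simp

end

section

open Polynomial

lemma exists_eq_X_pow_mul {S : Type*} [CommRing S] {p : PowerSeries S} (hp : p ≠ 0) :
    ∃ e h, p = PowerSeries.X ^ e * h ∧ PowerSeries.constantCoeff h ≠ 0 := by
  obtain ⟨h, hh⟩ := PowerSeries.X_pow_order_dvd (φ := p)
  refine ⟨_, h, hh, fun h0 => PowerSeries.coeff_order hp ?_⟩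
  refine (congrArg (PowerSeries.coeff _) hh).trans ?_
  rw [PowerSeries.coeff_X_pow_mul', if_pos le_rfl, Nat.sub_self, PowerSeries.coeff_zero_eq_constantCoeff_apply, h0]

/-- Spreading out from the generic point of the exceptional divisor. -/
theorem exists_good_chart {L : Type*} [Field L] [CharZero L] {N : ℕ}
    {g f : (PowerSeries (PowerSeries L))[X]} (hg : g.Monic)
    (hf : ∃ r, r ≠ 0 ∧ ∃ f', g ∣ f * f' - Polynomial.C r)
    (h : Good N (g.map (diag (L := L) 1 (evRat L X)).toRingHom)
      (f.map (diag (L := L) 1 (evRat L X)).toRingHom)) :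
    ∃ b : L[X], b ≠ 0 ∧ Good N (g.map (chart b).toRingHom) (f.map (chart b).toRingHom) := by
  obtain ⟨r, hr, f', hf'⟩ := hf
  obtain ⟨c, hc, v, hv⟩ := h
  obtain ⟨m, c', hc', rfl⟩ := exists_eq_X_pow_mul_unit hc
  obtain ⟨c'', hc''⟩ := hc'.exists_right_inv
  have hψ₀ : Function.Injective (diag (L := L) 1 (X : L[X])) :=
    diag_one_left_injective (AlgHom.id L L[X]) Function.injective_id
  obtain ⟨e, h, hrh, hh⟩ := exists_eq_X_pow_mul ((map_ne_zero_iff _ hψ₀).mpr hr)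
  obtain ⟨b, hb, happ⟩ := exists_approx (2 * m + e + 1) fun i => C c'' * v i
  obtain ⟨β, hβ⟩ : ∃ β, β = PowerSeries.constantCoeff h := ⟨_, rfl⟩
  rw [← hβ] at hh
  obtain ⟨w, hw⟩ := happ β
  have hval := map_chart (awaySub (evRat L) (b * β)).val
  let S := awaySub (evRat L) (b * β)
  let σ : L[X] →ₐ[L] S := (evRat L).codRestrict _ fun x => ev_mem_awaySub _ _ x
  have hσ : (PowerSeries.map σ.toRingHom).comp (diag (L := L) 1 (X : L[X])).toRingHom =
      (chart (b * β)).toRingHom := by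
    ext1 a
    refine (map_diag σ 1 _ a).trans ?_
    rw [map_one]
    rfl
  have hβu : IsUnit (σ β) := by
    have hβ0 : evRat L β ≠ 0 := (map_ne_zero_iff _ (evRat_injective L)).mpr hh
    refine IsUnit.of_mul_eq_one ⟨(evRat L β)⁻¹, 1, b, ?_⟩ (Subtype.ext (mul_inv_cancel₀ hβ0))
    rw [pow_one, map_mul, mul_assoc, mul_inv_cancel₀ hβ0, mul_one]
  have hgc := hg.map (chart (b * β)).toRingHom
  have key : g.map (diag (L := L) 1 (evRat L X)).toRingHom ∣
      ∑ i, (C c'' * v i) ^ 2 - C (PowerSeries.X ^ (2 * m)) *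
        f.map (diag (L := L) 1 (evRat L X)).toRingHom := by
    have h1 := hv.mul_left (C (c'' ^ 2))
    have h2 : C (c'' ^ 2) * C ((PowerSeries.X ^ m * c') ^ 2) = C (PowerSeries.X ^ (2 * m)) := by
      rw [← C_mul]
      congr 1
      linear_combination PowerSeries.X ^ (2 * m) * (c' * c'' + 1) * hc''
    rw [mul_sub, ← mul_assoc, h2, Finset.mul_sum] at h1
    convert h1 using 3
    · rw [mul_pow, C_pow]
  choose d hd using hw
  obtain ⟨y, hy⟩ : ∃ y, (g.map (chart (b * β)).toRingHom) ∣
      (∑ i, w i ^ 2 - C (PowerSeries.X ^ (2 * m)) * f.map (chart (b * β)).toRingHom) -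
        C (PowerSeries.X ^ (2 * m + e + 1)) * y := by
    refine exists_dvd_sub_of_map S.val.toRingHom Subtype.val_injective hgc
      (y' := ∑ i, (d i * (C (PowerSeries.X ^ (2 * m + e + 1)) * d i - 2 * (C c'' * v i)))) ?_
    rw [Polynomial.map_map, hval, Polynomial.map_sub, Polynomial.map_mul, Polynomial.map_map, hval,
      map_C, map_pow, PowerSeries.map_X, Polynomial.map_sum, Finset.mul_sum]
    refine key.trans (dvd_of_eq ?_)
    refine Eq.symm ?_
    rw [sub_right_comm, ← Finset.sum_sub_distrib]
    congr 1
    refine Finset.sum_congr rfl fun i _ => ?_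
    rw [Polynomial.map_pow]
    have h3 : (w i).map (PowerSeries.map S.val.toRingHom) =
      C c'' * v i - C (PowerSeries.X ^ (2 * m + e + 1)) * d i := by rw [← hd i]; ring
    rw [h3]
    ring
  refine ⟨b * β, mul_ne_zero hb hh, good_of_approx ?_ hgc (f' := f'.map (chart (b * β)).toRingHom)
    (h := PowerSeries.map σ.toRingHom h) (e := e) ?_ ?_ w y hy⟩
  · obtain ⟨r, hr⟩ : ∃ r : L, r * 2 = 1 := ⟨2⁻¹, inv_mul_cancel₀ two_ne_zero⟩
    refine ⟨algebraMap L _ r, ?_⟩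
    rw [← map_ofNat (algebraMap L _) 2, ← map_mul, hr, map_one]
  · have h1 := Polynomial.map_dvd (chart (b * β)).toRingHom hf'
    rw [Polynomial.map_sub, Polynomial.map_mul, map_C] at h1
    have h2 : (chart (b * β)).toRingHom r = PowerSeries.X ^ e * PowerSeries.map σ.toRingHom h := by
      rw [← hσ]
      refine (congrArg (PowerSeries.map σ.toRingHom) hrh).trans ?_
      rw [RingHom.map_mul, map_pow, PowerSeries.map_X]
    rwa [h2] at h1
  · rw [PowerSeries.isUnit_iff_constantCoeff, ← PowerSeries.coeff_zero_eq_constantCoeff_apply,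
      PowerSeries.coeff_map, PowerSeries.coeff_zero_eq_constantCoeff_apply, ← hβ]
    exact hβu

end

section

open Polynomial

lemma evRat_mem_iff {L : Type*} [Field L] {b : L[X]} (hb : IsUnit b) {z : RatFunc L} :
    z ∈ awaySub (evRat L) b ↔ ∃ h, evRat L h = z := by
  constructor
  · rintro ⟨k, h, hk⟩
    obtain ⟨c, hc⟩ := (hb.pow k).exists_left_inv
    refine ⟨c * h, ?_⟩
    have h1 := congrArg (evRat L) hc
    rw [map_mul, map_pow, map_one] at h1
    rw [map_mul, ← hk, ← mul_assoc, h1, one_mul]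
  · rintro ⟨h, rfl⟩
    exact ev_mem_awaySub _ _ h

/-- A form that is locally good at every point of the affine line is good there. -/
theorem good_affine_of_points {L : Type*} [Field L] [CharZero L] {N : ℕ} (hN : 3 ≤ N)
    {g f : (PowerSeries (PowerSeries L))[X]} (hg : g.Monic)
    (hf : ∃ r, r ≠ 0 ∧ ∃ f', g ∣ f * f' - Polynomial.C r)
    (hP : ∀ (P : L[X]) [Fact (Irreducible P)],
      Good N (g.map (diag (L := L) 1 (evAt (L := L) (AdjoinRoot.root P) X)).toRingHom)
        (f.map (diag (L := L) 1 (evAt (L := L) (AdjoinRoot.root P) X)).toRingHom))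
    {b : L[X]} (hb : b ≠ 0)
    (h : Good N (g.map (chart b).toRingHom) (f.map (chart b).toRingHom)) :
    Good N (g.map (diag (L := L) 1 (X : L[X])).toRingHom)
      (f.map (diag (L := L) 1 (X : L[X])).toRingHom) := by
  induction hd : b.natDegree using Nat.strong_induction_on generalizing b with
  | _ d ih =>
  subst hd
  by_cases hu : IsUnit b
  · let S := awaySub (evRat L) b
    let σ : L[X] →ₐ[L] S := (evRat L).codRestrict _ fun x => ev_mem_awaySub _ _ x
    have hσ : Function.Bijective σ := by
      constructor
      · intro x y hxy
        exact evRat_injective L (congrArg Subtype.val hxy)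
      · rintro ⟨z, hz⟩
        obtain ⟨x, hx⟩ := (evRat_mem_iff hu).mp hz
        exact ⟨x, Subtype.ext hx⟩
    let τ : S →ₐ[L] L[X] := (AlgEquiv.ofBijective σ hσ).symm.toAlgHom
    have hτ : τ ⟨evRat L X, ev_mem_awaySub _ _ _⟩ = X :=
      (AlgEquiv.ofBijective σ hσ).symm_apply_apply X
    have hm := map_chart τ
    rw [hτ] at hm
    have h1 := h.map (PowerSeries.map τ.toRingHom)
      (PowerSeries.map_injective _ (AlgEquiv.ofBijective σ hσ).symm.injective)
    rwa [Polynomial.map_map, Polynomial.map_map, hm] at h1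
  · obtain ⟨P, hPi, hPb⟩ := WfDvdMonoid.exists_irreducible_factor hu hb
    obtain ⟨v, b', hb', rfl⟩ := WfDvdMonoid.max_power_factor hb hPi
    have hv : v ≠ 0 := by
      rintro rfl
      rw [pow_zero, one_mul] at hPb
      exact hb' hPb
    have hb0 : b' ≠ 0 := right_ne_zero_of_mul hb
    have : Fact (Irreducible P) := ⟨hPi⟩
    have hle : awaySub (evRat L) (P ^ v * b') ≤ awaySub (evRat L) (b' * P) := by
      rintro z ⟨k, y, hk⟩
      refine ⟨v * k, b' ^ (v * k - k) * y, ?_⟩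
      obtain ⟨w, rfl⟩ := Nat.exists_eq_add_one_of_ne_zero hv
      have : (w + 1) * k - k = w * k := by rw [add_mul, one_mul, Nat.add_sub_cancel]
      rw [this, map_mul (evRat L) _ y, ← hk]
      simp only [map_mul, map_pow]
      ring
    have hm := map_chart (Subalgebra.inclusion hle)
    have h1 := h.map (PowerSeries.map (Subalgebra.inclusion hle).toRingHom)
      (PowerSeries.map_injective _ (Subalgebra.inclusion_injective hle))
    rw [Polynomial.map_map, Polynomial.map_map, hm] at h1
    refine ih b'.natDegree ?_ hb0 (good_chart_of_mul hPi.separable ?_ hPi ?_ hb' hN hg hf h1 (hP P)) rfl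
    · rw [natDegree_mul (pow_ne_zero _ hPi.ne_zero) hb0, natDegree_pow]
      have := hPi.natDegree_pos
      have := Nat.mul_pos (Nat.pos_of_ne_zero hv) this
      omega
    · rw [AdjoinRoot.aeval_eq, AdjoinRoot.mk_self]
    · intro z
      obtain ⟨p, rfl⟩ := AdjoinRoot.mk_surjective z
      exact ⟨p, AdjoinRoot.aeval_eq p⟩

end

section

open Polynomial

/-- The local-global principle over two-dimensional power series rings. -/
theorem Datum.good {R : Type u} [CommRing R] [IsDomain R] (D : Datum R) {k : ℕ} (hk : 1 ≤ k)
    (L : Type u) [Field L] [CharZero L] (hL : FunctionPyth (2 ^ k + 1) L)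
    (φ : R →+* PowerSeries (PowerSeries L)) (hφ : Function.Injective φ) :
    Good (2 ^ k + 1) (D.g.map φ) (D.f.map φ) := by
  have hN : 3 ≤ 2 ^ k + 1 := by
    have := Nat.pow_le_pow_right (n := 2) two_pos hk
    omega
  obtain ⟨m, hm⟩ := D.exists_colength φ hφ
  induction m using Nat.strong_induction_on generalizing L φ with
  | _ m ih =>
  have ih' : D.GoodBelow (2 ^ k + 1) m := fun m' hm' L _ _ hL φ hφ hc => ih m' hm' L hL φ hφ hc
  by_cases hp : ∃ γ ≠ 0, D.J.map φ = Ideal.span {γ}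
  · exact D.good_powerSeries₂ hk (hL.finitePyth two_ne_zero) φ hφ hp
  have hg := D.monic.map φ
  have hf : ∃ r, r ≠ 0 ∧ ∃ f', D.g.map φ ∣ D.f.map φ * f' - Polynomial.C r := by
    obtain ⟨r, hr, f', h⟩ := D.inv
    refine ⟨φ r, (map_ne_zero_iff _ hφ).mpr hr, f'.map φ, ?_⟩
    have := Polynomial.map_dvd φ h
    rwa [Polynomial.map_sub, Polynomial.map_mul, map_C] at this
  have h0 := ih'.good_infinity hL hφ hm hp
  rw [← Polynomial.map_map, ← Polynomial.map_map] at h0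
  have : CharZero (RatFunc L) := charZero_of_injective_algebraMap (algebraMap L _).injective
  have h1 : Good (2 ^ k + 1) ((D.g.map φ).map (diag (L := L) 1 (evRat L X)).toRingHom)
      ((D.f.map φ).map (diag (L := L) 1 (evRat L X)).toRingHom) := by
    rw [Polynomial.map_map, Polynomial.map_map]
    exact D.good_powerSeries hk hL.ratFunc _
      ((diag_one_left_injective (evRat L) (evRat_injective L)).comp hφ)
  obtain ⟨b, hb, h2⟩ := exists_good_chart hg hf h1
  refine good_of_affine_of_infinity hN hg hf (good_affine_of_points hN hg hf (fun P hP => ?_) hb h2) h0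
  rw [Polynomial.map_map, Polynomial.map_map]
  exact ih'.good_point hL hφ hm hp

end

section

open Polynomial

section

/-- An isomorphism of coefficient rings induces an isomorphism of power series rings. -/
noncomputable def powerSeriesCongr {A B : Type*} [CommRing A] [CommRing B] (e : A ≃+* B) :
    PowerSeries A ≃+* PowerSeries B :=
  RingEquiv.ofRingHom (PowerSeries.map (e : A →+* B)) (PowerSeries.map (e.symm : B →+* A))
    (by ext x n; simp) (by ext x n; simp)

/-- Power series in two variables as iterated power series. -/
noncomputable def mvPowerSeriesFinTwoEquiv (K : Type*) [CommRing K] :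
    MvPowerSeries (Fin 2) K ≃+* PowerSeries (PowerSeries K) :=
  (MvPowerSeries.finSuccEquiv K 1).toRingEquiv.trans (powerSeriesCongr
    ((MvPowerSeries.finSuccEquiv K 0).toRingEquiv.trans
      (powerSeriesCongr (MvPowerSeries.isEmptyEquiv (σ := Fin 0) (R := K)).toRingEquiv)))

end

section

variable {R : Type*} [CommRing R] [IsDomain R] (Q : Type*) [Field Q] [Algebra R Q]
  [IsFractionRing R Q] {F : Type*} [Field F] [Algebra Q F] [FiniteDimensional Q F] [Algebra R F]
  [IsScalarTower R Q F]

include Q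

lemma exists_mul_eq_aeval {θ : F} (hθ : IntermediateField.adjoin Q {θ} = ⊤) {M : ℕ}
    (z : Fin M → F) :
    ∃ d : R, d ≠ 0 ∧ ∃ w : Fin M → R[X], ∀ i, aeval θ (w i) = algebraMap R F d * z i := by
  have h (z : F) : ∃ q : Q[X], aeval θ q = z := by
    have hz : z ∈ (IntermediateField.adjoin Q {θ}).toSubalgebra := by
      rw [hθ]
      trivial
    rwa [IntermediateField.adjoin_simple_toSubalgebra_of_isAlgebraic
      (Algebra.IsAlgebraic.isAlgebraic θ), Algebra.adjoin_singleton_eq_range_aeval] at hz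
  choose q hq using fun i => h (z i)
  obtain ⟨d, hd, w, hw⟩ := exists_common_denominator R q
  refine ⟨d, hd, w, fun i => ?_⟩
  rw [← aeval_map_algebraMap Q, hw, map_mul, hq, aeval_C, ← IsScalarTower.algebraMap_apply]

lemma exists_integral_primitive_element [CharZero Q] :
    ∃ θ : F, IntermediateField.adjoin Q {θ} = ⊤ ∧ ∃ g : R[X], g.Monic ∧
      g.map (algebraMap R Q) = minpoly Q θ := by
  obtain ⟨θ, hθ⟩ := Field.exists_primitive_element Q F
  obtain ⟨d, hd, p, hp⟩ := exists_common_denominator R (K := Q) (N := 1) fun _ => minpoly Q θ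
  replace hp := hp 0
  generalize p 0 = p at hp
  have hR := IsFractionRing.injective R Q
  have hm := minpoly.ne_zero (Algebra.IsIntegral.isIntegral (R := Q) θ)
  have hdQ : algebraMap R Q d ≠ 0 := (map_ne_zero_iff _ hR).mpr hd
  have hp0 : p ≠ 0 := by
    rintro rfl
    rw [Polynomial.map_zero] at hp
    exact mul_ne_zero (C_ne_zero.mpr hdQ) hm hp.symm
  have hl : algebraMap R Q p.leadingCoeff ≠ 0 :=
    (map_ne_zero_iff _ hR).mpr (leadingCoeff_ne_zero.mpr hp0)
  have hl' : algebraMap R F p.leadingCoeff ≠ 0 := by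
    rw [IsScalarTower.algebraMap_apply R Q F]
    exact (map_ne_zero_iff _ (algebraMap Q F).injective).mpr hl
  have hRF : Function.Injective (algebraMap R F) := by
    rw [IsScalarTower.algebraMap_eq R Q F]
    exact (algebraMap Q F).injective.comp hR
  have hpθ : aeval θ p = 0 := by
    rw [← aeval_map_algebraMap Q, hp, map_mul, minpoly.aeval, mul_zero]
  have hroot := integralNormalization_aeval_eq_zero hpθ fun x hx =>
    (map_eq_zero_iff _ hRF).mp hx
  have hmon := monic_integralNormalization hp0
  obtain ⟨θ', hθ'⟩ : ∃ θ' : F, θ' = algebraMap R F p.leadingCoeff * θ := ⟨_, rfl⟩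
  have htop : IntermediateField.adjoin Q {θ'} = ⊤ := by
    rw [eq_top_iff, ← hθ, IntermediateField.adjoin_simple_le_iff]
    have : θ = algebraMap Q F (algebraMap R Q p.leadingCoeff)⁻¹ * θ' := by
      rw [hθ', map_inv₀, ← IsScalarTower.algebraMap_apply, inv_mul_cancel_left₀ hl']
    rw [this]
    exact mul_mem (algebraMap_mem _ _) (IntermediateField.mem_adjoin_simple_self _ _)
  refine ⟨θ', htop, _, hmon, eq_of_monic_of_dvd_of_natDegree_le
    (minpoly.monic (Algebra.IsIntegral.isIntegral _)) (hmon.map _) (minpoly.dvd _ _ ?_) ?_⟩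
  · rw [aeval_map_algebraMap, hθ']
    exact hroot
  · rw [hmon.natDegree_map, natDegree_integralNormalization,
      (Field.primitive_element_iff_minpoly_natDegree_eq Q θ').mp htop,
      ← (Field.primitive_element_iff_minpoly_natDegree_eq Q θ).mp hθ,
      ← natDegree_map_eq_of_injective hR p, hp, natDegree_C_mul hdQ]

/-- A sum of nonzero squares in a finite extension of the fraction field of a domain gives rise to
a datum over that domain. -/
theorem exists_datum [CharZero Q] {M : ℕ} (z : Fin M → F) (hz : ∀ i, z i ≠ 0)
    (hf : ∑ i, z i ^ 2 ≠ 0) :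
    ∃ D : Datum R, ∃ θ : F, ∃ a : F, a ≠ 0 ∧ aeval θ D.g = 0 ∧
      aeval θ D.f = a ^ 2 * ∑ i, z i ^ 2 := by
  obtain ⟨θ, hθ, g, hg, hgm⟩ := exists_integral_primitive_element (R := R) Q (F := F)
  have hR := IsFractionRing.injective R Q
  have hRF : Function.Injective (algebraMap R F) := by
    rw [IsScalarTower.algebraMap_eq R Q F]
    exact (algebraMap Q F).injective.comp hR
  have hdvd (p : R[X]) (hp : aeval θ p = 0) : g ∣ p := by
    refine (Polynomial.map_dvd_map _ hR hg).mp ?_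
    rw [hgm]
    exact minpoly.dvd _ _ (by rw [aeval_map_algebraMap, hp])
  obtain ⟨a, ha, w, hw⟩ := exists_mul_eq_aeval (R := R) Q hθ z
  have ha' : algebraMap R F a ≠ 0 := (map_ne_zero_iff _ hRF).mpr ha
  have hw0 (i) : aeval θ (w i) ≠ 0 := by
    rw [hw]
    exact mul_ne_zero ha' (hz i)
  have hfw : aeval θ (∑ i, w i ^ 2) = algebraMap R F a ^ 2 * ∑ i, z i ^ 2 := by
    rw [map_sum, Finset.mul_sum]
    exact Finset.sum_congr rfl fun i _ => by rw [map_pow, hw, mul_pow]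
  have hrel (i j) : ∃ p : R[X], p ≠ 0 ∧ aeval (aeval θ (w i) / aeval θ (w j)) p = 0 := by
    exact (IsFractionRing.comap_isAlgebraic_iff (A := R) (K := Q) (C := F)).mpr inferInstance
      |>.isAlgebraic _
  choose p hp0 hp using hrel
  refine ⟨⟨M, g, ∑ i, w i ^ 2, w, fun i j => (p i j).natDegree, fun i j => (p i j).coeff, hg, ?_,
    ?_, ⟨1, one_ne_zero, by simp⟩, fun i j => hdvd _ ?_, fun i j => ⟨_, le_rfl, ?_⟩⟩, θ, _, ha', ?_,
      hfw⟩
  · have hs : (minpoly Q θ).Separable :=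
      (minpoly.irreducible (Algebra.IsIntegral.isIntegral θ)).separable
    obtain ⟨A, B, hAB⟩ := hs
    obtain ⟨r, hr, v, hv⟩ := exists_common_denominator R ![A, B]
    refine ⟨r, hr, v 0, v 1, Polynomial.map_injective _ hR ?_⟩
    rw [Polynomial.map_add, Polynomial.map_mul, Polynomial.map_mul, ← derivative_map, hgm, hv, hv,
      map_C]
    simp only [Matrix.cons_val_zero, Matrix.cons_val_one]
    linear_combination C (algebraMap R Q r) * hAB
  · obtain ⟨r, hr, v, hv⟩ := exists_mul_eq_aeval (R := R) Q hθ
      fun _ : Fin 1 => (aeval θ (∑ i, w i ^ 2))⁻¹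
    refine ⟨r, hr, v 0, hdvd _ ?_⟩
    have h0 : aeval θ (∑ i, w i ^ 2) ≠ 0 := by
      rw [hfw]
      exact mul_ne_zero (pow_ne_zero _ ha') hf
    rw [map_sub, map_mul, hv, aeval_C, mul_comm, mul_assoc, inv_mul_cancel₀ h0, mul_one, sub_self]
  · have h1 := hp i j
    rw [aeval_eq_sum_range] at h1
    rw [map_sum, ← mul_zero (aeval θ (w j) ^ (p i j).natDegree), ← h1, Finset.mul_sum]
    refine Finset.sum_congr rfl fun e he => ?_
    obtain ⟨l, hl⟩ := Nat.exists_eq_add_of_le (Finset.mem_range_succ_iff.mp he)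
    rw [hl, Nat.add_sub_cancel_left, map_mul, map_mul, map_pow, map_pow, aeval_C, Algebra.smul_def,
      div_pow, pow_add]
    have := pow_ne_zero e (hw0 j)
    field_simp
  · exact leadingCoeff_ne_zero.mpr (hp0 i j)
  · rw [← aeval_map_algebraMap Q, hgm, minpoly.aeval]

end

lemma exists_nonzero_sum_sq {F : Type*} [Field F] {f : F} (hf : f ∈ sums F) :
    ∃ (M : ℕ) (z : Fin M → F), (∀ i, z i ≠ 0) ∧ f = ∑ i, z i ^ 2 := by
  classical
  obtain ⟨k, y, rfl⟩ := mem_sums.mp hf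
  let e := Fintype.equivFin {i // y i ≠ 0}
  refine ⟨_, fun i => y (e.symm i), fun i => (e.symm i).2, ?_⟩
  rw [e.symm.sum_comp fun i : {i // y i ≠ 0} => y i ^ 2,
    ← Fintype.sum_subtype_add_sum_subtype (fun i => y i ≠ 0), add_eq_left]
  refine Finset.sum_eq_zero fun i _ => ?_
  rw [not_not.mp i.2, zero_pow two_ne_zero]

/-- In odd characteristic, three squares suffice. -/
lemma mem_sumSq_three {F : Type*} [Field F] (p : ℕ) [hp : Fact p.Prime] [CharP F p] (h2 : p ≠ 2)
    (x : F) : x ∈ sumSq F 3 := by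
  obtain ⟨a, b, hab⟩ := ZMod.sq_add_sq p (-1)
  refine mem_sumSq_of_neg_one_mem (Ring.two_ne_zero ?_) ⟨![ZMod.castHom dvd_rfl F a,
    ZMod.castHom dvd_rfl F b], ?_⟩ x
  · rwa [ringChar.eq F p]
  · have := congrArg (ZMod.castHom dvd_rfl F) hab
    rw [map_add, map_pow, map_pow, map_neg, map_one] at this
    simpa using this.symm

lemma sums_subset_of_functionPyth {k : ℕ} (hk : 1 ≤ k) {K : Type u} [Field K] [CharZero K]
    (hK : FunctionPyth (2 ^ k + 1) K) (F : Type u) [Field F]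
    [Algebra (FractionRing (MvPowerSeries (Fin 2) K)) F]
    [FiniteDimensional (FractionRing (MvPowerSeries (Fin 2) K)) F] :
    sums F ⊆ sumSq F (2 ^ k + 1) := by
  intro x hx
  by_cases hx0 : x = 0
  · rw [hx0]
    exact ⟨0, by simp⟩
  obtain ⟨M, z, hz, rfl⟩ := exists_nonzero_sum_sq hx
  have : IsDomain (MvPowerSeries (Fin 2) K) := NoZeroDivisors.to_isDomain _
  let _ : Algebra (MvPowerSeries (Fin 2) K) F :=
    ((algebraMap (FractionRing (MvPowerSeries (Fin 2) K)) F).comp (algebraMap _ _)).toAlgebra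
  have : IsScalarTower (MvPowerSeries (Fin 2) K) (FractionRing (MvPowerSeries (Fin 2) K)) F :=
    IsScalarTower.of_algebraMap_eq' rfl
  have hRF : Function.Injective (algebraMap (MvPowerSeries (Fin 2) K) F) :=
    (algebraMap (FractionRing (MvPowerSeries (Fin 2) K)) F).injective.comp
      (IsFractionRing.injective _ _)
  have : CharZero (FractionRing (MvPowerSeries (Fin 2) K)) :=
    charZero_of_injective_algebraMap
      ((algebraMap (MvPowerSeries (Fin 2) K) (FractionRing _)).comp MvPowerSeries.C).injective
  obtain ⟨D, θ, a, ha, hg, hf⟩ := exists_datum (R := MvPowerSeries (Fin 2) K)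
    (FractionRing (MvPowerSeries (Fin 2) K)) z hz hx0
  obtain ⟨e, -⟩ : ∃ e : MvPowerSeries (Fin 2) K ≃+* PowerSeries (PowerSeries K), e = e :=
    ⟨mvPowerSeriesFinTwoEquiv K, rfl⟩
  have h := (D.good hk K hK e.toRingHom e.injective).map e.symm.toRingHom e.symm.injective
  rw [Polynomial.map_map, Polynomial.map_map, show e.symm.toRingHom.comp e.toRingHom = RingHom.id _ from e.symm_comp, Polynomial.map_id,
    Polynomial.map_id] at h
  obtain ⟨c, hc, v, y, hv⟩ := h
  have h1 := congrArg (aeval θ) hv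
  rw [map_mul, hg, zero_mul, map_sub, sub_eq_zero, map_mul, hf, aeval_C, map_sum, map_pow] at h1
  have hc' : algebraMap (MvPowerSeries (Fin 2) K) F c ≠ 0 := (map_ne_zero_iff _ hRF).mpr hc
  have h2 : ∑ i, z i ^ 2 = (algebraMap (MvPowerSeries (Fin 2) K) F c * a)⁻¹ ^ 2 *
      ∑ i, aeval θ (v i ^ 2) := by
    rw [h1]
    field_simp
  rw [h2]
  exact sq_mul_mem_sumSq _ ⟨fun i => aeval θ (v i), by simp⟩

end

theorem statement19 (n : ℕ) (K : Type u) [Field K] (hchar : ringChar K ≠ 2)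
    (hK : IsPnField n K)
    (F : Type u) [Field F]
    [Algebra (FractionRing (MvPowerSeries (Fin 2) K)) F]
    [FiniteDimensional (FractionRing (MvPowerSeries (Fin 2) K)) F] :
    pyth F ≤ ((2 ^ (n + 1) + 1 : ℕ) : ℕ∞) := by
  rw [pyth_le_iff]
  obtain ⟨φ⟩ : Nonempty (K →+* F) :=
    ⟨((algebraMap (FractionRing (MvPowerSeries (Fin 2) K)) F).comp (algebraMap _ _)).comp
      (MvPowerSeries.C (σ := Fin 2))⟩
  obtain ⟨p, hp⟩ := CharP.exists K
  rcases CharP.char_is_prime_or_zero K p with hpr | rfl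
  · have : Fact p.Prime := ⟨hpr⟩
    have : CharP F p := charP_of_injective_ringHom φ.injective p
    have h3 : 3 ≤ 2 ^ (n + 1) + 1 := by
      have := Nat.one_le_two_pow (n := n)
      rw [pow_succ]
      omega
    exact fun x _ => sumSq_mono h3 (mem_sumSq_three p (by rwa [ringChar.eq K p] at hchar) x)
  · have := CharP.charP_to_charZero K
    exact sums_subset_of_functionPyth (Nat.le_add_left 1 n) hK.functionPyth F

end SosPaper
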